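/- Let X be a tame stationary Gaussian field on ℝⁿ and F^σ_{(0,m)^n}[X] = ∫_{(0,m)^n} φ_{σ²I}(∇X(s)) det(∇²X(s)) X(s) ds. Then sup_{σ>0} E[ |F^σ_{(0,m)^n}[X]|^{2+ε} ] < ∞ for some ε > 0, provided E[(sup|X|)^k] < ∞ for all k and E[N_u(∇X,(0,m)^n)^{2+ε'}] is uniformly bounded in u for some ε' > 0. -/

import Mathlib

open MeasureTheory

noncomputable def gradient18 {n : ℕ} (f : (Fin n → ℝ) → ℝ) (s : Fin n → ℝ) : Fin n → ℝ :=
  fun i => fderiv ℝ f s (Pi.single i 1)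

noncomputable def hessian18 {n : ℕ} (f : (Fin n → ℝ) → ℝ) (s : Fin n → ℝ) :
    Matrix (Fin n) (Fin n) ℝ :=
  Matrix.of fun i j => fderiv ℝ (fun t => fderiv ℝ f t (Pi.single j 1)) s (Pi.single i 1)

noncomputable def gaussKernel18 {n : ℕ} (σ : ℝ) (x : Fin n → ℝ) : ℝ :=
  (2 * Real.pi * σ ^ 2) ^ (-(n : ℝ) / 2) * Real.exp (-(∑ i, x i ^ 2) / (2 * σ ^ 2))

section
open MeasureTheory
theorem lintegral_fin_prod18 {n : ℕ} {E : Type*} [MeasurableSpace E]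
    {μ : Fin n → Measure E} [∀ i, SigmaFinite (μ i)] (f : Fin n → E → ENNReal)
    (hf : ∀ i, Measurable (f i)) :
    ∫⁻ x : Fin n → E, ∏ i, f i (x i) ∂(Measure.pi μ) = ∏ i, ∫⁻ x, f i x ∂(μ i) := by
  induction n with
  | zero => simp
  | succ n ih =>
    calc
      _ = ∫⁻ x : E × (Fin n → E), f 0 x.1 * ∏ i : Fin n, f (Fin.succ i) (x.2 i)
            ∂((μ 0).prod (Measure.pi (fun i ↦ μ i.succ))) := by
          rw [← ((measurePreserving_piFinSuccAbove μ 0).symm).lintegral_comp_emb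
            (MeasurableEquiv.measurableEmbedding _)]
          simp_rw [MeasurableEquiv.piFinSuccAbove_symm_apply, Fin.insertNthEquiv,
            Fin.prod_univ_succ, Fin.insertNth_zero, Equiv.coe_fn_mk, Fin.cons_succ,
            Fin.zero_succAbove, cast_eq, Fin.cons_zero]
      _ = (∫⁻ x, f 0 x ∂μ 0)
            * ∏ i : Fin n, ∫⁻ x, f (Fin.succ i) x ∂(μ i.succ) := by
          rw [← ih (fun i => f i.succ) (fun i => hf _)]
          rw [← lintegral_prod_mul (hf 0).aemeasurable]
          exact (Finset.measurable_fun_prod _ fun i _ => (hf i.succ).comp (measurable_pi_apply i)).aemeasurable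
      _ = ∏ i, ∫⁻ x, f i x ∂(μ i) := by rw [Fin.prod_univ_succ]

noncomputable def gg18 (x : ℝ) : ℝ := 1 / max 1 |x|

theorem gg18_pos (x : ℝ) : 0 < gg18 x := by unfold gg18; positivity

theorem gg18_meas : Measurable gg18 := by unfold gg18; fun_prop

theorem gauss1_bound18 (a x : ℝ) :
    ∫ y, Real.exp (-(1/2) * (a * y + x) ^ 2) ∂(ProbabilityTheory.gaussianReal 0 1) ≤ gg18 a := by
  have hb : ∀ y, Real.exp (-(1/2) * (a * y + x) ^ 2) ≤ 1 := fun y => by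
    rw [Real.exp_le_one_iff]; nlinarith [sq_nonneg (a * y + x)]
  have hIntg : Integrable (fun y => Real.exp (-(1/2) * (a * y + x) ^ 2))
      (ProbabilityTheory.gaussianReal 0 1) := by
    refine Integrable.of_bound (by fun_prop) 1 (Filter.Eventually.of_forall fun y => ?_)
    rw [Real.norm_eq_abs, abs_of_pos (Real.exp_pos _)]; exact hb y
  unfold gg18
  rcases le_total |a| 1 with h | h
  · rw [max_eq_left h]
    calc _ ≤ ∫ y, (1:ℝ) ∂(ProbabilityTheory.gaussianReal 0 1) :=
          integral_mono hIntg (integrable_const _) hb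
      _ = 1 / 1 := by simp
  · rw [max_eq_right h]
    have ha : a ≠ 0 := by rintro rfl; norm_num at h
    rw [ProbabilityTheory.integral_gaussianReal_eq_integral_smul (by norm_num)]
    have hI : Integrable (fun y => Real.exp (-(1/2) * (a * y + x) ^ 2)) := by
      have := ((integrable_exp_neg_mul_sq (b := 1/2) (by norm_num)).comp_add_right x).comp_mul_left' ha
      exact this
    have hval : ∫ y, Real.exp (-(1/2) * (a * y + x) ^ 2) = |a|⁻¹ * √(2 * Real.pi) := by
      have h1 := Measure.integral_comp_mul_left (fun z => Real.exp (-(1/2) * (z + x) ^ 2)) a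
      rw [h1, integral_add_right_eq_self (fun z => Real.exp (-(1/2) * z ^ 2)) x, integral_gaussian]
      rw [smul_eq_mul, abs_inv]
      congr 2; ring
    have hp : ∀ y, ProbabilityTheory.gaussianPDFReal 0 1 y ≤ (√(2 * Real.pi))⁻¹ := fun y => by
      rw [ProbabilityTheory.gaussianPDFReal]
      simp only [NNReal.coe_one, mul_one, sub_zero]
      refine mul_le_of_le_one_right (by positivity) ?_
      rw [Real.exp_le_one_iff]; nlinarith [sq_nonneg y]
    calc _ ≤ ∫ y, (√(2 * Real.pi))⁻¹ * Real.exp (-(1/2) * (a * y + x) ^ 2) := by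
          refine integral_mono_of_nonneg (Filter.Eventually.of_forall fun y => ?_) (hI.const_mul _)
            (Filter.Eventually.of_forall fun y => ?_)
          · have := ProbabilityTheory.gaussianPDFReal_nonneg 0 1 y
            simp only [smul_eq_mul, Pi.zero_apply]; positivity
          · simp only [smul_eq_mul]
            exact mul_le_mul_of_nonneg_right (hp y) (Real.exp_pos _).le
      _ = 1 / |a| := by
          rw [integral_const_mul, hval]
          have : √(2 * Real.pi) ≠ 0 := by positivity
          field_simp

theorem gauss2_bound18 (a b d : ℝ) :
    ∫ z : ℝ × ℝ, Real.exp (-(1/2) * ((a * z.1 + b * z.2) ^ 2 + (d * z.2) ^ 2))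
      ∂((ProbabilityTheory.gaussianReal 0 1).prod (ProbabilityTheory.gaussianReal 0 1))
      ≤ gg18 a * gg18 d := by
  have hIntg : Integrable (fun z : ℝ × ℝ =>
      Real.exp (-(1/2) * ((a * z.1 + b * z.2) ^ 2 + (d * z.2) ^ 2)))
      ((ProbabilityTheory.gaussianReal 0 1).prod (ProbabilityTheory.gaussianReal 0 1)) := by
    refine Integrable.of_bound (by fun_prop) 1 (Filter.Eventually.of_forall fun y => ?_)
    rw [Real.norm_eq_abs, abs_of_pos (Real.exp_pos _), Real.exp_le_one_iff]
    nlinarith [sq_nonneg (a * y.1 + b * y.2), sq_nonneg (d * y.2)]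
  rw [integral_prod_symm _ hIntg]
  have h1 : ∀ y : ℝ, ∫ x, Real.exp (-(1/2) * ((a * x + b * y) ^ 2 + (d * y) ^ 2))
      ∂(ProbabilityTheory.gaussianReal 0 1) ≤ gg18 a * Real.exp (-(1/2) * (d * y + 0) ^ 2) := by
    intro y
    have : ∀ x, Real.exp (-(1/2) * ((a * x + b * y) ^ 2 + (d * y) ^ 2)) =
      Real.exp (-(1/2) * (a * x + b * y) ^ 2) * Real.exp (-(1/2) * (d * y + 0) ^ 2) := by
      intro x; rw [← Real.exp_add]; congr 1; ring
    simp_rw [this]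
    rw [integral_mul_const]
    exact mul_le_mul_of_nonneg_right (gauss1_bound18 _ _) (Real.exp_pos _).le
  have h2 : Integrable (fun y => Real.exp (-(1/2) * (d * y + 0) ^ 2))
      (ProbabilityTheory.gaussianReal 0 1) := by
    refine Integrable.of_bound (by fun_prop) 1 (Filter.Eventually.of_forall fun y => ?_)
    rw [Real.norm_eq_abs, abs_of_pos (Real.exp_pos _), Real.exp_le_one_iff]
    nlinarith [sq_nonneg (d * y + 0)]
  calc _ ≤ ∫ y, gg18 a * Real.exp (-(1/2) * (d * y + 0) ^ 2) ∂(ProbabilityTheory.gaussianReal 0 1) :=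
        integral_mono hIntg.integral_prod_right (h2.const_mul _) h1
    _ ≤ _ := by
        rw [integral_const_mul]
        exact mul_le_mul_of_nonneg_left (gauss1_bound18 _ _) (gg18_pos _).le

theorem gauss_cos18 {n : ℕ} (a b : Fin n → ℝ) :
    ∫ z : Fin n → ℝ × ℝ, Real.cos (∑ i, (a i * (z i).1 + b i * (z i).2))
      ∂(Measure.pi fun _ : Fin n => (ProbabilityTheory.gaussianReal 0 1).prod
        (ProbabilityTheory.gaussianReal 0 1)) =
      Real.exp (-(1/2) * ∑ i, ((a i) ^ 2 + (b i) ^ 2)) := by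
  have key : ∫ z : Fin n → ℝ × ℝ, Complex.exp ((∑ i, (a i * (z i).1 + b i * (z i).2) : ℝ) * Complex.I)
      ∂(Measure.pi fun _ : Fin n => (ProbabilityTheory.gaussianReal 0 1).prod
        (ProbabilityTheory.gaussianReal 0 1)) =
      ((Real.exp (-(1/2) * ∑ i, ((a i) ^ 2 + (b i) ^ 2)) : ℝ) : ℂ) := by
    have h1 : ∀ z : Fin n → ℝ × ℝ, Complex.exp ((∑ i, (a i * (z i).1 + b i * (z i).2) : ℝ) * Complex.I)
      = ∏ i, (Complex.exp ((a i) * (z i).1 * Complex.I) * Complex.exp ((b i) * (z i).2 * Complex.I)) := by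
      intro z
      simp_rw [← Complex.exp_add]
      rw [← Complex.exp_sum]
      congr 1
      push_cast
      rw [Finset.sum_mul]
      exact Finset.sum_congr rfl fun i _ => by ring
    simp_rw [h1]
    rw [integral_fintype_prod_eq_prod (f := fun i (z : ℝ × ℝ) =>
      Complex.exp ((a i) * z.1 * Complex.I) * Complex.exp ((b i) * z.2 * Complex.I))]
    have h2 : ∀ s : ℝ, ∫ x : ℝ, Complex.exp (s * x * Complex.I) ∂(ProbabilityTheory.gaussianReal 0 1)
        = Complex.exp (-(1/2) * (s : ℂ) ^ 2) := by
      intro s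
      have := ProbabilityTheory.charFun_gaussianReal (μ := 0) (v := 1) s
      rw [charFun_apply_real] at this
      rw [this]; congr 1; push_cast; ring
    have h3 : ∀ i, ∫ z : ℝ × ℝ, Complex.exp ((a i) * z.1 * Complex.I) * Complex.exp ((b i) * z.2 * Complex.I)
       ∂((ProbabilityTheory.gaussianReal 0 1).prod (ProbabilityTheory.gaussianReal 0 1))
       = Complex.exp (-(1/2) * ((a i : ℂ) ^ 2 + (b i : ℂ) ^ 2)) := by
      intro i
      rw [integral_prod_mul (fun x : ℝ => Complex.exp ((a i) * x * Complex.I))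
        (fun x : ℝ => Complex.exp ((b i) * x * Complex.I)), h2, h2, ← Complex.exp_add]
      congr 1; ring
    simp_rw [h3]
    rw [← Complex.exp_sum]
    push_cast
    rw [Finset.mul_sum]
  have h4 : Integrable (fun z : Fin n → ℝ × ℝ =>
      Complex.exp ((∑ i, (a i * (z i).1 + b i * (z i).2) : ℝ) * Complex.I))
      (Measure.pi fun _ : Fin n => (ProbabilityTheory.gaussianReal 0 1).prod
        (ProbabilityTheory.gaussianReal 0 1)) := by
    refine Integrable.of_bound (Measurable.aestronglyMeasurable (by fun_prop)) 1
      (Filter.Eventually.of_forall fun y => ?_)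
    rw [Complex.norm_exp_ofReal_mul_I]
  have h5 := congrArg Complex.re key
  rw [Complex.ofReal_re] at h5
  rw [← h5]
  have h6 := integral_re h4
  simp only [RCLike.re_eq_complex_re] at h6
  rw [← h6]
  refine integral_congr_ae (Filter.Eventually.of_forall fun z => ?_)
  simp only [Complex.exp_ofReal_mul_I_re]

theorem star18 {n : ℕ} {Ω : Type*} [MeasurableSpace Ω] (P : Measure Ω) [IsProbabilityMeasure P]
    (U U' : Fin n → Ω → ℝ) (hU : ∀ i, Measurable (U i)) (hU' : ∀ i, Measurable (U' i))
    (c : ℝ) (hc : 0 < c) (t : Fin n → ℝ)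
    (hch : ∀ v w : Fin n → ℝ, ∫ ω, Real.cos (∑ i, (v i * U i ω + w i * U' i ω)) ∂P ≤
      Real.exp (-(c ^ 2 / 2) * ∑ i, ((v i + w i) ^ 2 + (w i) ^ 2 * (t i) ^ 2)))
    (τ τ' : Fin n → ℝ) :
    ∫ ω, Real.exp (-(1/2) * ∑ i, ((τ i * U i ω) ^ 2 + (τ' i * U' i ω) ^ 2)) ∂P ≤
      ∏ i, (gg18 (c * τ i) * gg18 (c * (τ' i * t i))) := by
  set Γ := (Measure.pi fun _ : Fin n => (ProbabilityTheory.gaussianReal 0 1).prod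
        (ProbabilityTheory.gaussianReal 0 1)) with hΓ
  have h1 : ∀ ω, Real.exp (-(1/2) * ∑ i, ((τ i * U i ω) ^ 2 + (τ' i * U' i ω) ^ 2)) =
     ∫ z : Fin n → ℝ × ℝ, Real.cos (∑ i, ((τ i * U i ω) * (z i).1 + (τ' i * U' i ω) * (z i).2)) ∂Γ :=
    fun ω => (gauss_cos18 _ _).symm
  simp_rw [h1]
  rw [integral_integral_swap]
  · have h2 : ∀ z : Fin n → ℝ × ℝ, ∫ ω, Real.cos (∑ i, ((τ i * U i ω) * (z i).1 + (τ' i * U' i ω) * (z i).2)) ∂P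
        ≤ ∏ i, Real.exp (-(1/2) * (((c * τ i) * (z i).1 + (c * τ' i) * (z i).2) ^ 2
            + ((c * (τ' i * t i)) * (z i).2) ^ 2)) := by
      intro z
      have := hch (fun i => τ i * (z i).1) (fun i => τ' i * (z i).2)
      calc _ = ∫ ω, Real.cos (∑ i, (τ i * (z i).1 * U i ω + τ' i * (z i).2 * U' i ω)) ∂P := by
            congr 1; ext ω; congr 1; exact Finset.sum_congr rfl fun i _ => by ring
        _ ≤ _ := this
        _ = _ := by
            rw [← Real.exp_sum, Finset.mul_sum]
            congr 1; exact Finset.sum_congr rfl fun i _ => by ring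
    have h3 : Integrable (fun z : Fin n → ℝ × ℝ => ∏ i, Real.exp (-(1/2) *
        (((c * τ i) * (z i).1 + (c * τ' i) * (z i).2) ^ 2 + ((c * (τ' i * t i)) * (z i).2) ^ 2))) Γ := by
      refine Integrable.of_bound (Measurable.aestronglyMeasurable (by fun_prop)) 1
        (Filter.Eventually.of_forall fun y => ?_)
      rw [Real.norm_eq_abs, Finset.abs_prod]
      refine Finset.prod_le_one (fun i _ => abs_nonneg _) fun i _ => ?_
      rw [abs_of_pos (Real.exp_pos _), Real.exp_le_one_iff]
      nlinarith [sq_nonneg ((c * τ i) * (y i).1 + (c * τ' i) * (y i).2),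
        sq_nonneg ((c * (τ' i * t i)) * (y i).2)]
    calc _ ≤ ∫ z, _ ∂Γ := integral_mono ?_ h3 h2
      _ = _ := integral_fintype_prod_eq_prod (f := fun i (z : ℝ × ℝ) => Real.exp (-(1/2) *
        (((c * τ i) * z.1 + (c * τ' i) * z.2) ^ 2 + ((c * (τ' i * t i)) * z.2) ^ 2)))
      _ ≤ _ := Finset.prod_le_prod (fun i _ => integral_nonneg fun z => (Real.exp_pos _).le)
        fun i _ => gauss2_bound18 _ _ _
    refine Integrable.of_bound ?_ 1 (Filter.Eventually.of_forall fun z => ?_)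
    · have : Measurable (Function.uncurry fun (z : Fin n → ℝ × ℝ) ω =>
        Real.cos (∑ i, ((τ i * U i ω) * (z i).1 + (τ' i * U' i ω) * (z i).2))) := by
        unfold Function.uncurry
        have h7 : ∀ i, Measurable (fun p : (Fin n → ℝ × ℝ) × Ω => U i p.2) :=
          fun i => (hU i).comp measurable_snd
        have h8 : ∀ i, Measurable (fun p : (Fin n → ℝ × ℝ) × Ω => U' i p.2) :=
          fun i => (hU' i).comp measurable_snd
        fun_prop
      exact this.stronglyMeasurable.integral_prod_right.aestronglyMeasurable
    · calc _ ≤ ∫ ω, ‖Real.cos (∑ i, ((τ i * U i ω) * (z i).1 + (τ' i * U' i ω) * (z i).2))‖ ∂P :=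
            norm_integral_le_integral_norm _
        _ ≤ ∫ ω, (1:ℝ) ∂P := by
            refine integral_mono_of_nonneg (Filter.Eventually.of_forall fun _ => norm_nonneg _)
              (integrable_const _) (Filter.Eventually.of_forall fun ω => ?_)
            simpa using Real.abs_cos_le_one _
        _ = 1 := by simp
  · refine Integrable.of_bound (Measurable.aestronglyMeasurable ?_) 1
      (Filter.Eventually.of_forall fun y => by
        simpa [Function.uncurry] using Real.abs_cos_le_one _)
    unfold Function.uncurry
    have h7 : ∀ i, Measurable (fun p : Ω × (Fin n → ℝ × ℝ) => U i p.1) :=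
      fun i => (hU i).comp measurable_fst
    have h8 : ∀ i, Measurable (fun p : Ω × (Fin n → ℝ × ℝ) => U' i p.1) :=
      fun i => (hU' i).comp measurable_fst
    fun_prop

end

section
open MeasureTheory

theorem kprod_bound18 {n : ℕ} {Ω : Type*} [MeasurableSpace Ω] (P : Measure Ω) [IsProbabilityMeasure P]
    (U U' : Fin n → Ω → ℝ) (hU : ∀ i, Measurable (U i)) (hU' : ∀ i, Measurable (U' i))
    (c : ℝ) (hc : 0 < c) (t : Fin n → ℝ)
    (hch : ∀ v w : Fin n → ℝ, ∫ ω, Real.cos (∑ i, (v i * U i ω + w i * U' i ω)) ∂P ≤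
      Real.exp (-(c ^ 2 / 2) * ∑ i, ((v i + w i) ^ 2 + (w i) ^ 2 * (t i) ^ 2)))
    (κ κ' : Fin n → Measure ℝ) [∀ i, SigmaFinite (κ i)] [∀ i, SigmaFinite (κ' i)] :
    ∫⁻ ω, ∏ i, ((∫⁻ τ, ENNReal.ofReal (Real.exp (-(1/2) * (τ * U i ω) ^ 2)) ∂(κ i)) *
        (∫⁻ τ, ENNReal.ofReal (Real.exp (-(1/2) * (τ * U' i ω) ^ 2)) ∂(κ' i))) ∂P ≤
      ∏ i, ((∫⁻ τ, ENNReal.ofReal (gg18 (c * τ)) ∂(κ i)) *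
        (∫⁻ τ, ENNReal.ofReal (gg18 (c * (τ * t i))) ∂(κ' i))) := by
  have hgm := gg18_meas
  have h1 : ∀ ω, ∏ i, ((∫⁻ τ, ENNReal.ofReal (Real.exp (-(1/2) * (τ * U i ω) ^ 2)) ∂(κ i)) *
        (∫⁻ τ, ENNReal.ofReal (Real.exp (-(1/2) * (τ * U' i ω) ^ 2)) ∂(κ' i))) =
      ∫⁻ z : Fin n → ℝ × ℝ, ENNReal.ofReal (Real.exp (-(1/2) * ∑ i, (((z i).1 * U i ω) ^ 2 +
        ((z i).2 * U' i ω) ^ 2))) ∂(Measure.pi fun i => (κ i).prod (κ' i)) := by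
    intro ω
    have : ∀ i, ((∫⁻ τ, ENNReal.ofReal (Real.exp (-(1/2) * (τ * U i ω) ^ 2)) ∂(κ i)) *
        (∫⁻ τ, ENNReal.ofReal (Real.exp (-(1/2) * (τ * U' i ω) ^ 2)) ∂(κ' i))) =
        ∫⁻ z : ℝ × ℝ, ENNReal.ofReal (Real.exp (-(1/2) * (z.1 * U i ω) ^ 2)) *
          ENNReal.ofReal (Real.exp (-(1/2) * (z.2 * U' i ω) ^ 2)) ∂((κ i).prod (κ' i)) := fun i =>
      (lintegral_prod_mul (Measurable.aemeasurable (by fun_prop))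
        (Measurable.aemeasurable (by fun_prop))).symm
    simp_rw [this]
    rw [← lintegral_fin_prod18 (fun i (z : ℝ × ℝ) => ENNReal.ofReal (Real.exp (-(1/2) * (z.1 * U i ω) ^ 2)) *
          ENNReal.ofReal (Real.exp (-(1/2) * (z.2 * U' i ω) ^ 2))) (fun i => by fun_prop)]
    refine lintegral_congr fun z => ?_
    simp_rw [← ENNReal.ofReal_mul (Real.exp_pos _).le]
    rw [← ENNReal.ofReal_prod_of_nonneg (fun i _ => by positivity)]
    simp_rw [← Real.exp_add]
    rw [← Real.exp_sum, Finset.mul_sum]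
    congr 2
    exact Finset.sum_congr rfl fun i _ => by ring
  simp_rw [h1]
  have h7 : ∀ i, Measurable (fun p : Ω × (Fin n → ℝ × ℝ) => U i p.1) :=
      fun i => (hU i).comp measurable_fst
  have h8 : ∀ i, Measurable (fun p : Ω × (Fin n → ℝ × ℝ) => U' i p.1) :=
      fun i => (hU' i).comp measurable_fst
  rw [lintegral_lintegral_swap (Measurable.aemeasurable (by unfold Function.uncurry; fun_prop))]
  calc _ ≤ ∫⁻ z : Fin n → ℝ × ℝ, ∏ i, (ENNReal.ofReal (gg18 (c * (z i).1)) *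
          ENNReal.ofReal (gg18 (c * ((z i).2 * t i)))) ∂(Measure.pi fun i => (κ i).prod (κ' i)) := by
        refine lintegral_mono fun z => ?_
        have := star18 P U U' hU hU' c hc t hch (fun i => (z i).1) (fun i => (z i).2)
        rw [← ofReal_integral_eq_lintegral_ofReal]
        · simp_rw [← ENNReal.ofReal_mul (gg18_pos _).le]
          rw [← ENNReal.ofReal_prod_of_nonneg (fun i _ => mul_nonneg (gg18_pos _).le (gg18_pos _).le)]
          exact ENNReal.ofReal_le_ofReal this
        · refine Integrable.of_bound (Measurable.aestronglyMeasurable (by fun_prop)) 1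
            (Filter.Eventually.of_forall fun y => ?_)
          rw [Real.norm_eq_abs, abs_of_pos (Real.exp_pos _), Real.exp_le_one_iff]
          have : 0 ≤ ∑ i, (((z i).1 * U i y) ^ 2 + ((z i).2 * U' i y) ^ 2) :=
            Finset.sum_nonneg fun i _ => by positivity
          linarith
        · exact Filter.Eventually.of_forall fun y => (Real.exp_pos _).le
    _ = _ := by
        rw [lintegral_fin_prod18 (fun i (z : ℝ × ℝ) => ENNReal.ofReal (gg18 (c * z.1)) *
          ENNReal.ofReal (gg18 (c * (z.2 * t i)))) (fun i => by fun_prop)]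
        refine Finset.prod_congr rfl fun i _ => ?_
        rw [← lintegral_prod_mul]
        · exact Measurable.aemeasurable (by fun_prop)
        · exact Measurable.aemeasurable (by fun_prop)

/-- the integral of `τ ^ (b-1)` over `(0, M)` -/
theorem lint_low18 (b : ℝ) (hb : 0 < b) (M : ℝ) (hM : 0 < M) :
    ∫⁻ τ in Set.Ioc 0 M, ENNReal.ofReal (τ ^ (b - 1)) = ENNReal.ofReal (M ^ b / b) := by
  have hi : IntervalIntegrable (fun x : ℝ => x ^ (b - 1)) volume 0 M :=
    intervalIntegral.intervalIntegrable_rpow' (by linarith)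
  rw [← ofReal_integral_eq_lintegral_ofReal ((intervalIntegrable_iff_integrableOn_Ioc_of_le hM.le).1 hi)]
  · rw [← intervalIntegral.integral_of_le hM.le, integral_rpow (Or.inl (by linarith))]
    simp [Real.zero_rpow hb.ne']
  · refine (ae_restrict_iff' measurableSet_Ioc).2 (Filter.Eventually.of_forall fun x hx => ?_)
    exact Real.rpow_nonneg hx.1.le _

theorem lint_high18 (b : ℝ) (hb : b < 1) (M : ℝ) (hM : 0 < M) :
    ∫⁻ τ in Set.Ioi M, ENNReal.ofReal (τ ^ (b - 2)) = ENNReal.ofReal (M ^ (b - 1) / (1 - b)) := by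
  rw [← ofReal_integral_eq_lintegral_ofReal (integrableOn_Ioi_rpow_of_lt (by linarith) hM)]
  · rw [integral_Ioi_rpow_of_lt (by linarith) hM]
    congr 1
    rw [show b - 2 + 1 = b - 1 by ring, neg_div, ← div_neg, neg_sub]
  · refine (ae_restrict_iff' measurableSet_Ioi).2 (Filter.Eventually.of_forall fun x hx => ?_)
    exact Real.rpow_nonneg (hM.trans hx).le _

theorem exists_kernel18 (b : ℝ) (hb0 : 0 ≤ b) (hb1 : b < 1) :
    ∃ κ : Measure ℝ, SigmaFinite κ ∧ ∃ C : ENNReal, C ≠ ⊤ ∧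
      (∀ z : ℝ, ENNReal.ofReal |z| ^ (-b) ≤
        C * ∫⁻ τ, ENNReal.ofReal (Real.exp (-(1/2) * (τ * z) ^ 2)) ∂κ) ∧
      (∀ T : ℝ, ∫⁻ τ, ENNReal.ofReal (gg18 (T * τ)) ∂κ ≤ C * ENNReal.ofReal |T| ^ (-b)) := by
  have hgm := gg18_meas
  rcases hb0.eq_or_lt with rfl | hb
  · refine ⟨Measure.dirac 0, inferInstance, 1, by simp, fun z => by simp, fun T => ?_⟩
    simp [gg18]
  set κ := (volume.restrict (Set.Ioi (0:ℝ))).withDensity (fun τ => ENNReal.ofReal (τ ^ (b - 1))) with hκ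
  have hmeas : Measurable (fun τ : ℝ => ENNReal.ofReal (τ ^ (b - 1))) := by fun_prop
  set C1 := ENNReal.ofReal (Real.exp (1/2) * b) with hC1
  set C2 := ENNReal.ofReal (1 / b + 1 / (1 - b)) with hC2
  refine ⟨κ, by rw [hκ]; exact SigmaFinite.withDensity_ofReal _, C1 + C2, by simp [C1, C2], ?_, ?_⟩
  · intro z
    have key : ∀ M : ℝ, 0 < M → M * |z| ≤ 1 → ENNReal.ofReal (M ^ b) ≤
        C1 * ∫⁻ τ, ENNReal.ofReal (Real.exp (-(1/2) * (τ * z) ^ 2)) ∂κ := by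
      intro M hM hz
      have h1 : ENNReal.ofReal (Real.exp (-(1/2))) * ENNReal.ofReal (M ^ b / b) ≤
          ∫⁻ τ, ENNReal.ofReal (Real.exp (-(1/2) * (τ * z) ^ 2)) ∂κ := by
        rw [hκ, lintegral_withDensity_eq_lintegral_mul _ hmeas (by fun_prop), ← lint_low18 b hb M hM,
          ← lintegral_const_mul _ hmeas]
        calc _ ≤ ∫⁻ τ in Set.Ioc 0 M, ENNReal.ofReal (τ ^ (b - 1)) *
                ENNReal.ofReal (Real.exp (-(1/2) * (τ * z) ^ 2)) := by
              refine setLIntegral_mono' measurableSet_Ioc fun τ hτ => ?_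
              rw [mul_comm]
              gcongr
              have : |τ * z| ≤ 1 := by
                rw [abs_mul, abs_of_pos hτ.1]
                exact (mul_le_mul_of_nonneg_right hτ.2 (abs_nonneg z)).trans hz
              have := sq_le_one_iff_abs_le_one _ |>.2 this
              linarith
          _ ≤ _ := lintegral_mono_set Set.Ioc_subset_Ioi_self
      calc _ = C1 * (ENNReal.ofReal (Real.exp (-(1/2))) * ENNReal.ofReal (M ^ b / b)) := by
            rw [hC1, ← ENNReal.ofReal_mul (Real.exp_pos _).le, ← ENNReal.ofReal_mul (by positivity)]
            congr 1
            rw [Real.exp_neg]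
            field_simp
        _ ≤ _ := by gcongr
    refine le_trans ?_ (mul_le_mul_left (le_self_add : C1 ≤ C1 + C2) _)
    rcases eq_or_ne z 0 with rfl | hz
    · have : (⊤ : ENNReal) ≤ C1 * ∫⁻ τ, ENNReal.ofReal (Real.exp (-(1/2) * (τ * 0) ^ 2)) ∂κ := by
        refine ENNReal.le_of_forall_nnreal_lt fun r _ => ?_
        have := key ((r + 1) ^ (1/b)) (by positivity) (by simp)
        rw [← Real.rpow_mul (by positivity), one_div_mul_cancel hb.ne', Real.rpow_one] at this
        refine le_trans ?_ this
        rw [ENNReal.ofReal_add (by positivity) (by positivity)]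
        simp
      rw [top_le_iff.1 this]; exact le_top
    · have hz' : 0 < |z| := abs_pos.2 hz
      have := key (|z|⁻¹) (by positivity) (by rw [inv_mul_cancel₀ hz'.ne'])
      rwa [Real.inv_rpow hz'.le, ← Real.rpow_neg hz'.le, ← ENNReal.ofReal_rpow_of_pos hz'] at this
  · intro T
    refine le_trans ?_ (mul_le_mul_left (le_add_self : C2 ≤ C1 + C2) _)
    rcases eq_or_ne T 0 with rfl | hT
    · have : C2 ≠ 0 := by
        rw [hC2]; have : 0 < 1 - b := by linarith
        simp only [ne_eq, ENNReal.ofReal_eq_zero, not_le]; positivity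
      simp [ENNReal.zero_rpow_of_neg (neg_lt_zero.2 hb), ENNReal.mul_top this]
    have hT' : 0 < |T| := abs_pos.2 hT
    have hb' : 0 < 1 - b := by linarith
    rw [hκ, lintegral_withDensity_eq_lintegral_mul _ hmeas (by fun_prop)]
    rw [← Set.Ioc_union_Ioi_eq_Ioi (inv_pos.2 hT').le]
    refine (lintegral_union_le _ _ _).trans ?_
    have hA : ∫⁻ τ in Set.Ioc 0 |T|⁻¹, ENNReal.ofReal (τ ^ (b - 1)) * ENNReal.ofReal (gg18 (T * τ)) ≤
        ENNReal.ofReal (|T|⁻¹ ^ b / b) := by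
      rw [← lint_low18 b hb _ (inv_pos.2 hT')]
      refine lintegral_mono fun τ => ?_
      refine mul_le_of_le_one_right' ?_
      rw [ENNReal.ofReal_le_one, gg18]
      exact div_le_one_of_le₀ (le_max_left _ _) (by positivity)
    have hB : ∫⁻ τ in Set.Ioi |T|⁻¹, ENNReal.ofReal (τ ^ (b - 1)) * ENNReal.ofReal (gg18 (T * τ)) ≤
        ENNReal.ofReal |T|⁻¹ * ENNReal.ofReal (|T|⁻¹ ^ (b - 1) / (1 - b)) := by
      rw [← lint_high18 b hb1 _ (inv_pos.2 hT'), ← lintegral_const_mul _ (by fun_prop)]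
      refine setLIntegral_mono' measurableSet_Ioi fun τ hτ => ?_
      have hτ0 : 0 < τ := (inv_pos.2 hT').trans hτ
      rw [← ENNReal.ofReal_mul (by positivity), ← ENNReal.ofReal_mul (by positivity)]
      refine ENNReal.ofReal_le_ofReal ?_
      calc _ ≤ τ ^ (b - 1) * (1 / (|T| * τ)) := by
            refine mul_le_mul_of_nonneg_left ?_ (by positivity)
            rw [gg18, abs_mul, abs_of_pos hτ0]
            exact one_div_le_one_div_of_le (by positivity) (le_max_right _ _)
        _ = _ := by
            have e : τ ^ (b - 2) = τ ^ (b - 1) / τ := by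
              rw [← Real.rpow_sub_one hτ0.ne']; congr 1; ring
            rw [e, one_div, mul_inv]
            ring
    refine (add_le_add hA hB).trans (le_of_eq ?_)
    rw [← ENNReal.ofReal_mul (by positivity), ← ENNReal.ofReal_add (by positivity) (by positivity),
      ENNReal.ofReal_rpow_of_pos hT', hC2, ← ENNReal.ofReal_mul (by positivity)]
    congr 1
    rw [Real.rpow_sub_one (by positivity), Real.inv_rpow hT'.le, Real.rpow_neg hT'.le]
    field_simp

theorem neg_moment18 {n : ℕ} {Ω : Type*} [MeasurableSpace Ω] (P : Measure Ω) [IsProbabilityMeasure P]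
    (b b' : Fin n → ℝ) (hb : ∀ i, 0 ≤ b i ∧ b i < 1) (hb' : ∀ i, 0 ≤ b' i ∧ b' i < 1)
    (c : ℝ) (hc : 0 < c) :
    ∃ C : ENNReal, C ≠ ⊤ ∧ ∀ (U U' : Fin n → Ω → ℝ) (_ : ∀ i, Measurable (U i))
      (_ : ∀ i, Measurable (U' i)) (t : Fin n → ℝ)
      (_ : ∀ v w : Fin n → ℝ, ∫ ω, Real.cos (∑ i, (v i * U i ω + w i * U' i ω)) ∂P ≤
      Real.exp (-(c ^ 2 / 2) * ∑ i, ((v i + w i) ^ 2 + (w i) ^ 2 * (t i) ^ 2))),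
      ∫⁻ ω, ∏ i, (ENNReal.ofReal |U i ω| ^ (-(b i)) * ENNReal.ofReal |U' i ω| ^ (-(b' i))) ∂P ≤
      C * ∏ i, ENNReal.ofReal |t i| ^ (-(b' i)) := by
  choose κ hκ D hD hDz hDT using fun i => exists_kernel18 (b i) (hb i).1 (hb i).2
  choose κ' hκ' D' hD' hDz' hDT' using fun i => exists_kernel18 (b' i) (hb' i).1 (hb' i).2
  refine ⟨(∏ i, (D i * D' i)) * ∏ i, (D i * ENNReal.ofReal |c| ^ (-(b i)) * (D' i * ENNReal.ofReal |c| ^ (-(b' i)))),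
    ?_, ?_⟩
  · have hc0 : ∀ x : ℝ, ENNReal.ofReal |c| ^ x ≠ ⊤ := fun x => by
      rw [ENNReal.ofReal_rpow_of_pos (abs_pos.2 hc.ne')]; simp
    refine ENNReal.mul_ne_top (ENNReal.prod_ne_top fun i _ => ENNReal.mul_ne_top (hD i) (hD' i))
      (ENNReal.prod_ne_top fun i _ => ENNReal.mul_ne_top (ENNReal.mul_ne_top (hD i) (hc0 _))
        (ENNReal.mul_ne_top (hD' i) (hc0 _)))
  intro U U' hU hU' t hch
  have h := kprod_bound18 P U U' hU hU' c hc t hch κ κ'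
  calc _ ≤ ∫⁻ ω, (∏ i, (D i * D' i)) * ∏ i, ((∫⁻ τ, ENNReal.ofReal (Real.exp (-(1/2) * (τ * U i ω) ^ 2)) ∂(κ i)) *
        (∫⁻ τ, ENNReal.ofReal (Real.exp (-(1/2) * (τ * U' i ω) ^ 2)) ∂(κ' i))) ∂P := by
        refine lintegral_mono fun ω => ?_
        rw [← Finset.prod_mul_distrib]
        refine Finset.prod_le_prod' fun i _ => ?_
        calc _ ≤ _ := mul_le_mul' (hDz i (U i ω)) (hDz' i (U' i ω))
          _ = _ := by ring
    _ = (∏ i, (D i * D' i)) * _ :=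
        lintegral_const_mul' _ _ (ENNReal.prod_ne_top fun i _ => ENNReal.mul_ne_top (hD i) (hD' i))
    _ ≤ _ := by
        rw [mul_assoc]
        refine mul_le_mul_right (h.trans ?_) _
        rw [← Finset.prod_mul_distrib]
        refine Finset.prod_le_prod' fun i _ => ?_
        have e1 : ∀ τ, c * (τ * t i) = (c * t i) * τ := fun τ => by ring
        simp_rw [e1]
        calc _ ≤ _ := mul_le_mul' (hDT i c) (hDT' i (c * t i))
          _ = _ := by
            rw [abs_mul, ENNReal.ofReal_mul (abs_nonneg _), ENNReal.mul_rpow_of_ne_top (by simp) (by simp)]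
            ring

end

section
open MeasureTheory

section Fourier18
open Filter Complex Module Real
open scoped Topology FourierTransform RealInnerProductSpace

theorem tendsto_gauss_fourier18 {V : Type*} [NormedAddCommGroup V] [InnerProductSpace ℝ V]
    [MeasurableSpace V] [BorelSpace V] [FiniteDimensional ℝ V] (f : V → ℂ) (hf : Integrable f)
    (hc : ContinuousAt f 0) :
    Tendsto (fun (c : ℝ) ↦ (∫ w : V, cexp (- c⁻¹ * ‖w‖ ^ 2) • (𝓕 f) w)) atTop (𝓝 (f 0)) := by
  refine (Real.tendsto_integral_gaussian_smul' hf hc).congr' ?_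
  filter_upwards [Ioi_mem_atTop 0] with c (hc : 0 < c)
  have J : Integrable (fun w : V ↦ cexp (- c⁻¹ * ‖w‖ ^ 2 + 2 * π * I * ⟪(0:V), w⟫)) :=
      GaussianFourier.integrable_cexp_neg_mul_sq_norm_add (by simpa) _ _
  have h1 := (VectorFourier.integral_fourierIntegral_smul_eq_flip (L := innerₗ V)
      Real.continuous_fourierChar continuous_inner J hf).symm
  have h2 : ∫ w : V, cexp (- c⁻¹ * ‖w‖ ^ 2 + 2 * π * I * ⟪(0:V), w⟫) • (𝓕 f) w =
    ∫ w : V, 𝓕 (fun w ↦ cexp (- c⁻¹ * ‖w‖ ^ 2 + 2 * π * I * ⟪(0:V), w⟫)) w • f w := by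
    simpa using! h1
  trans ∫ w : V, 𝓕 (fun w ↦ cexp (- c⁻¹ * ‖w‖ ^ 2 + 2 * π * I * ⟪(0:V), w⟫)) w • f w
  · congr with w
    rw [fourier_gaussian_innerProductSpace' (by simpa)]
    have e1 : (π : ℂ) / (c⁻¹ : ℝ) = π * c := by push_cast; rw [div_inv_eq_mul]
    have e2 : -(π : ℂ) ^ 2 * ‖(0:V) - w‖ ^ 2 / (c⁻¹ : ℝ) = -π ^ 2 * c * ‖(0:V) - w‖ ^ 2 := by
      push_cast; rw [div_inv_eq_mul]; ring
    rw [e1, e2]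
  · rw [← h2]; simp

theorem integrable_gauss18 {V : Type*} [NormedAddCommGroup V] [InnerProductSpace ℝ V]
    [MeasurableSpace V] [BorelSpace V] [FiniteDimensional ℝ V] (b : ℝ) (hb : 0 < b) :
    Integrable (fun w : V => Real.exp (-b * ‖w‖ ^ 2)) := by
  have := (GaussianFourier.integrable_cexp_neg_mul_sq_norm_add (V := V) (b := (b : ℝ))
              (by simpa using hb) 0 0).re
  refine this.congr (Eventually.of_forall fun w => ?_)
  simp only [zero_mul, add_zero]
  rw [show -(b : ℂ) * (‖w‖:ℂ) ^ 2 = ((-b * ‖w‖ ^ 2 : ℝ) : ℂ) by push_cast; ring,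
              ← Complex.ofReal_exp]
  exact Complex.ofReal_re _

theorem integrable_fourier18 {V : Type*} [NormedAddCommGroup V] [InnerProductSpace ℝ V]
    [MeasurableSpace V] [BorelSpace V] [FiniteDimensional ℝ V] (f : V → ℂ) (hf : Integrable f)
    (hc : ContinuousAt f 0) (F : V → ℝ) (hF : ∀ w, 0 ≤ F w) (hFf : ∀ w, 𝓕 f w = F w) :
    Integrable F := by
  have hcont : Continuous (fun w => 𝓕 f w) :=
    VectorFourier.fourierIntegral_continuous Real.continuous_fourierChar continuous_inner hf
  have hFc : Continuous F := by
    have : F = fun w => (𝓕 f w).re := by ext w; rw [hFf]; simp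
    rw [this]; exact Complex.continuous_re.comp hcont
  have ht := (tendsto_gauss_fourier18 f hf hc).comp (tendsto_natCast_atTop_atTop (R := ℝ))
  have hbd : ∀ w, ‖𝓕 f w‖ ≤ ∫ v, ‖f v‖ := fun w =>
    VectorFourier.norm_fourierIntegral_le_integral_norm _ _ _ _ _
  refine ⟨hFc.aestronglyMeasurable, ?_⟩
  rw [hasFiniteIntegral_iff_ofReal (Eventually.of_forall hF)]
  have hlim : ∀ w, Tendsto (fun k : ℕ => ENNReal.ofReal (Real.exp (-(k:ℝ)⁻¹ * ‖w‖ ^ 2) * F w)) atTop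
      (𝓝 (ENNReal.ofReal (F w))) := by
    intro w
    refine ENNReal.tendsto_ofReal ?_
    have : Tendsto (fun k : ℕ => Real.exp (-(k:ℝ)⁻¹ * ‖w‖ ^ 2) * F w) atTop
      (𝓝 (Real.exp (-0 * ‖w‖ ^ 2) * F w)) := by
      refine Tendsto.mul_const _ ((Real.continuous_exp.tendsto _).comp (Tendsto.mul_const _ ?_))
      exact (tendsto_inv_atTop_zero.comp tendsto_natCast_atTop_atTop).neg
    simpa using this
  calc ∫⁻ w, ENNReal.ofReal (F w) = ∫⁻ w, liminf (fun k : ℕ =>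
        ENNReal.ofReal (Real.exp (-(k:ℝ)⁻¹ * ‖w‖ ^ 2) * F w)) atTop :=
        lintegral_congr fun w => (hlim w).liminf_eq.symm
    _ ≤ liminf (fun k : ℕ => ∫⁻ w, ENNReal.ofReal (Real.exp (-(k:ℝ)⁻¹ * ‖w‖ ^ 2) * F w)) atTop :=
        lintegral_liminf_le fun k => by fun_prop
    _ = liminf (fun k : ℕ => ENNReal.ofReal
        (∫ w : V, cexp (- ((k:ℝ)⁻¹ : ℝ) * ‖w‖ ^ 2) • (𝓕 f) w).re) atTop := by
        refine liminf_congr ?_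
        filter_upwards [eventually_gt_atTop 0] with k hk
        have hk' : (0:ℝ) < (k:ℝ)⁻¹ := by positivity
        have e : ∀ w : V, cexp (- ((k:ℝ)⁻¹ : ℝ) * ‖w‖ ^ 2) • (𝓕 f) w =
            ((Real.exp (-(k:ℝ)⁻¹ * ‖w‖ ^ 2) * F w : ℝ) : ℂ) := by
          intro w; rw [hFf]; push_cast; rw [smul_eq_mul]
        simp_rw [e]
        rw [integral_complex_ofReal, Complex.ofReal_re, ofReal_integral_eq_lintegral_ofReal]
        · have hg : Integrable (fun w : V => Real.exp (-(k:ℝ)⁻¹ * ‖w‖ ^ 2)) :=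
            integrable_gauss18 _ hk'
          refine Integrable.mul_bdd (c := ∫ v, ‖f v‖) hg hFc.aestronglyMeasurable
            (Eventually.of_forall fun w => ?_)
          have := hbd w; rw [hFf] at this; simpa using this
        · exact Eventually.of_forall fun w => mul_nonneg (Real.exp_pos _).le (hF w)
    _ = ENNReal.ofReal (f 0).re := by
        refine Tendsto.liminf_eq (ENNReal.tendsto_ofReal ?_)
        exact (Complex.continuous_re.tendsto _).comp ht
    _ < ⊤ := ENNReal.ofReal_lt_top
end Fourier18

end

section
open MeasureTheory

section Bochner18
open Filter Complex Module Real
open scoped Topology FourierTransform RealInnerProductSpace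

theorem fourier_pos18 {V : Type*} [NormedAddCommGroup V] [InnerProductSpace ℝ V]
    [MeasurableSpace V] [BorelSpace V] [FiniteDimensional ℝ V]
    {Ω : Type*} [MeasurableSpace Ω] (P : Measure Ω) [IsProbabilityMeasure P]
    (Y : V → Ω → ℝ) (hY : Measurable (Function.uncurry Y)) (r : V → ℝ) (hr : Continuous r)
    (hY2 : ∀ s, MemLp (Y s) 2 P) (hY1 : ∀ s, ∫ ω, (Y s ω) ^ 2 ∂P = 1)
    (hcov : ∀ s t, ∫ ω, Y s ω * Y t ω ∂P = r (t - s)) (a : ℝ) (ha : 0 < a) (w : V) :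
    ∃ x : ℝ, 0 ≤ x ∧ 𝓕 (fun t : V => ((r t * Real.exp (-a * ‖t‖ ^ 2) : ℝ) : ℂ)) w = x := by
  have hYY : ∀ s t, Integrable (fun ω => Y s ω * Y t ω) P := fun s t => (hY2 s).integrable_mul (hY2 t)
  have hY22 : ∀ s, Integrable (fun ω => Y s ω ^ 2) P := fun s => (hY2 s).integrable_sq
  have hYabs : ∀ s t, ∫ ω, ‖Y s ω * Y t ω‖ ∂P ≤ 1 := by
    intro s t
    calc ∫ ω, ‖Y s ω * Y t ω‖ ∂P ≤ ∫ ω, (Y s ω ^ 2 / 2 + Y t ω ^ 2 / 2) ∂P := by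
          refine integral_mono (hYY s t).norm (((hY22 s).div_const 2).add ((hY22 t).div_const 2)) fun ω => ?_
          simp only [norm_mul, Real.norm_eq_abs]
          nlinarith [sq_nonneg (|Y s ω| - |Y t ω|), sq_abs (Y s ω), sq_abs (Y t ω)]
      _ = 1 := by
          rw [integral_add ((hY22 s).div_const 2) ((hY22 t).div_const 2), integral_div, integral_div,
            hY1, hY1]; norm_num
  have hr1 : ∀ t, ‖r t‖ ≤ 1 := fun t => by
    have := hcov 0 t; rw [sub_zero] at this
    rw [← this]; exact (norm_integral_le_integral_norm _).trans (hYabs _ _)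
  set e : V → ℂ := fun s => cexp ((-2 * π * ⟪s, w⟫ : ℝ) * I) with he
  have hen : ∀ s, ‖e s‖ = 1 := fun s => Complex.norm_exp_ofReal_mul_I _
  have hec : Continuous e := by rw [he]; fun_prop
  set h : V → ℝ := fun s => Real.exp (-(2 * a) * ‖s‖ ^ 2) with hh
  have hhi : Integrable h := integrable_gauss18 _ (by positivity)
  have hhc : Continuous h := by rw [hh]; fun_prop
  have hhp : ∀ s, 0 < h s := fun s => Real.exp_pos _
  set k : V → ℂ := fun s => h s * e s with hk
  have hkc : Continuous k := by rw [hk]; fun_prop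
  have hkn : ∀ s, ‖k s‖ = h s := fun s => by
    rw [hk]; simp only [norm_mul, hen, mul_one, Complex.norm_real, Real.norm_eq_abs, abs_of_pos (hhp s)]
  have hki : Integrable k := hhi.mono hkc.aestronglyMeasurable
    (Eventually.of_forall fun s => by rw [hkn, Real.norm_eq_abs, abs_of_pos (hhp s)])
  have hkci : Integrable (fun s => (starRingEnd ℂ) (k s)) := hki.mono
    (Complex.continuous_conj.comp hkc).aestronglyMeasurable
    (Eventually.of_forall fun s => by simp)
  set c : ℝ := ∫ s : V, Real.exp (-(4 * a) * ‖s‖ ^ 2) with hc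
  have hcpos : 0 < c := by
    rw [hc, integral_pos_iff_support_of_nonneg (fun s => (Real.exp_pos _).le)
      (integrable_gauss18 _ (by positivity))]
    have : Function.support (fun s : V => Real.exp (-(4 * a) * ‖s‖ ^ 2)) = Set.univ := by
      ext s; simp [Real.exp_ne_zero]
    rw [this]; exact isOpen_univ.measure_pos volume Set.univ_nonempty
  set Q : V × V → ℂ := fun p => r (p.2 - p.1) * ((starRingEnd ℂ) (k p.1) * k p.2) with hQ
  have hQi : Integrable Q (volume.prod volume) := by
    refine Integrable.bdd_mul (c := 1) (hkci.mul_prod hki)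
      (Continuous.aestronglyMeasurable (by fun_prop)) (Eventually.of_forall fun p => ?_)
    rw [Complex.norm_real]; exact hr1 _
  -- step one
  have step1 : ∫ p, Q p ∂(volume.prod volume) =
      c * 𝓕 (fun t : V => ((r t * Real.exp (-a * ‖t‖ ^ 2) : ℝ) : ℂ)) w := by
    have hmp := measurePreserving_prod_add (volume : Measure V) (volume : Measure V)
    have hemb : MeasurableEmbedding (fun z : V × V => (z.1, z.1 + z.2)) :=
      (MeasurableEquiv.shearAddRight V).measurableEmbedding
    rw [← hmp.integral_comp hemb, integral_prod_symm (fun z : V × V => Q (z.1, z.1 + z.2)) ((hmp.integrable_comp_emb hemb).2 hQi),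
      Real.fourier_eq', ← integral_const_mul]
    refine integral_congr_ae (Eventually.of_forall fun t => ?_)
    have e1 : ∀ s, Q (s, s + t) = (e t * (r t * Real.exp (-a * ‖t‖ ^ 2) : ℝ)) *
        ((Real.exp (-(4 * a) * ‖s + (1/2 : ℝ) • t‖ ^ 2) : ℝ) : ℂ) := by
      intro s
      have h1 : (starRingEnd ℂ) (e s) * e (s + t) = e t := by
        rw [he]; simp only
        rw [← Complex.exp_conj, ← Complex.exp_add, inner_add_left]
        congr 1
        simp only [map_mul, Complex.conj_ofReal, Complex.conj_I]
        push_cast; ring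
      have h2 : h s * h (s + t) = Real.exp (-a * ‖t‖ ^ 2) *
          Real.exp (-(4 * a) * ‖s + (1/2 : ℝ) • t‖ ^ 2) := by
        rw [hh]; simp only
        rw [← Real.exp_add, ← Real.exp_add]
        congr 1
        rw [norm_add_sq_real, norm_add_sq_real, norm_smul, inner_smul_right]
        simp only [one_div, norm_inv, Real.norm_ofNat]
        ring
      simp only [hQ, hk, add_sub_cancel_left, map_mul, Complex.conj_ofReal]
      calc _ = (r t : ℂ) * ((h s * h (s + t) : ℝ) : ℂ) * ((starRingEnd ℂ) (e s) * e (s + t)) := by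
            push_cast; ring
        _ = _ := by rw [h1, h2]; push_cast; ring
    simp only [Function.comp_def]
    simp_rw [e1]
    rw [integral_const_mul, integral_complex_ofReal,
      integral_add_right_eq_self (fun s : V => Real.exp (-(4 * a) * ‖s‖ ^ 2)), ← hc]
    simp only [he, smul_eq_mul]
    ring
  -- step two
  have hm1 : Measurable (fun q : (V × V) × Ω => Y q.1.1 q.2) :=
    hY.comp ((measurable_fst.comp measurable_fst).prodMk measurable_snd)
  have hm2 : Measurable (fun q : (V × V) × Ω => Y q.1.2 q.2) :=
    hY.comp ((measurable_snd.comp measurable_fst).prodMk measurable_snd)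
  have step2 : ∫ p, Q p ∂(volume.prod volume) =
      ((∫ ω, ‖∫ t, (Y t ω : ℂ) * k t‖ ^ 2 ∂P : ℝ) : ℂ) := by
    have e2 : ∀ p, Q p = ∫ ω, ((Y p.1 ω * Y p.2 ω : ℝ) : ℂ) * ((starRingEnd ℂ) (k p.1) * k p.2) ∂P := by
      intro p
      rw [integral_mul_const, integral_complex_ofReal, hcov]
    simp_rw [e2]
    rw [integral_integral_swap]
    · rw [← integral_complex_ofReal]
      refine integral_congr_ae (Eventually.of_forall fun ω => ?_)
      have e3 : ∀ p : V × V, ((Y p.1 ω * Y p.2 ω : ℝ) : ℂ) * ((starRingEnd ℂ) (k p.1) * k p.2) =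
         (starRingEnd ℂ) ((Y p.1 ω : ℂ) * k p.1) * ((Y p.2 ω : ℂ) * k p.2) := by
        intro p; simp only [map_mul, Complex.conj_ofReal]; push_cast; ring
      simp only
      simp_rw [e3]
      rw [integral_prod_mul (fun s => (starRingEnd ℂ) ((Y s ω : ℂ) * k s)) (fun s => (Y s ω : ℂ) * k s),
        integral_conj, Complex.conj_mul']
      push_cast; rfl
    · have hmeas : Measurable (Function.uncurry fun (p : V × V) ω =>
        ((Y p.1 ω * Y p.2 ω : ℝ) : ℂ) * ((starRingEnd ℂ) (k p.1) * k p.2)) := by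
        unfold Function.uncurry
        have := hkc.measurable
        have h3 : Measurable (fun q : (V × V) × Ω => (starRingEnd ℂ) (k q.1.1)) :=
          Complex.continuous_conj.measurable.comp (this.comp (measurable_fst.comp measurable_fst))
        have h4 : Measurable (fun q : (V × V) × Ω => (k q.1.2)) :=
          (this.comp (measurable_snd.comp measurable_fst))
        exact (Complex.measurable_ofReal.comp (hm1.mul hm2)).mul (h3.mul h4)
      refine (integrable_prod_iff hmeas.aestronglyMeasurable).2 ⟨Eventually.of_forall fun p => ?_, ?_⟩
      · exact ((hYY p.1 p.2).ofReal (𝕜 := ℂ)).mul_const ((starRingEnd ℂ) (k p.1) * k p.2)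
      · refine Integrable.mono (hhi.mul_prod hhi) ?_ (Eventually.of_forall fun p => ?_)
        · exact hmeas.norm.stronglyMeasurable.integral_prod_right.aestronglyMeasurable
        · simp only [Function.uncurry]
          have : ∀ ω, ‖((Y p.1 ω * Y p.2 ω : ℝ) : ℂ) * ((starRingEnd ℂ) (k p.1) * k p.2)‖ =
              ‖Y p.1 ω * Y p.2 ω‖ * (h p.1 * h p.2) := by
            intro ω
            rw [norm_mul, norm_mul, RCLike.norm_conj, hkn, hkn, Complex.norm_real]
          simp_rw [this]
          have hpp : 0 < h p.1 * h p.2 := mul_pos (hhp _) (hhp _)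
          rw [integral_mul_const, norm_mul, Real.norm_eq_abs, Real.norm_eq_abs, abs_of_pos hpp,
            abs_of_nonneg (integral_nonneg fun _ => norm_nonneg _)]
          exact mul_le_of_le_one_left hpp.le (hYabs _ _)
  refine ⟨c⁻¹ * (∫ ω, ‖∫ t, (Y t ω : ℂ) * k t‖ ^ 2 ∂P), ?_, ?_⟩
  · exact mul_nonneg (inv_pos.2 hcpos).le (integral_nonneg fun _ => by positivity)
  · rw [Complex.ofReal_mul, ← step2, step1, ← mul_assoc, ← Complex.ofReal_mul, inv_mul_cancel₀ hcpos.ne']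
    simp
end Bochner18

end

section
open MeasureTheory

section Bochner18
open Filter Complex Module Real
open scoped Topology FourierTransform RealInnerProductSpace

theorem bochner_step18 {V : Type*} [NormedAddCommGroup V] [InnerProductSpace ℝ V]
    [MeasurableSpace V] [BorelSpace V] [FiniteDimensional ℝ V] (f : V → ℝ) (hfc : Continuous f)
    (hfi : Integrable f) (hf0 : f 0 = 1)
    (hpos : ∀ w, ∃ x : ℝ, 0 ≤ x ∧ 𝓕 (fun t : V => (f t : ℂ)) w = x) :
    ∃ ν : ProbabilityMeasure V, ∀ t, charFun (ν : Measure V) t = f ((2 * π)⁻¹ • t) := by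
  choose F hF hFf using hpos
  have hci : Integrable (fun t : V => (f t : ℂ)) := hfi.ofReal
  have hcc : Continuous (fun t : V => (f t : ℂ)) := by fun_prop
  have hFi : Integrable F := integrable_fourier18 _ hci hcc.continuousAt F hF hFf
  have hFfun : 𝓕 (fun t : V => (f t : ℂ)) = fun w => (F w : ℂ) := funext hFf
  have hinv := hcc.fourierInv_fourier_eq hci (by rw [hFfun]; exact hFi.ofReal)
  have hinv' : ∀ v : V, ∫ w, cexp ((2 * π * ⟪w, v⟫ : ℝ) * I) * F w = f v := by
    intro v
    have := congrFun hinv v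
    rw [Real.fourierInv_eq', hFfun] at this
    exact this
  have hprob : IsProbabilityMeasure (volume.withDensity fun w => ENNReal.ofReal (F w)) := by
    constructor
    rw [withDensity_apply _ MeasurableSet.univ, Measure.restrict_univ,
      ← ofReal_integral_eq_lintegral_ofReal hFi (Eventually.of_forall hF)]
    have := hinv' 0
    simp only [inner_zero_right, mul_zero, Complex.ofReal_zero, zero_mul, Complex.exp_zero, one_mul, hf0] at this
    rw [integral_complex_ofReal] at this
    have h2 : ∫ w, F w = 1 := by exact_mod_cast this
    rw [h2]; simp
  refine ⟨⟨_, hprob⟩, fun t => ?_⟩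
  rw [← hinv', charFun_apply]
  simp only [ProbabilityMeasure.coe_mk]
  have hm : AEMeasurable (fun w => (F w).toNNReal) volume := hFi.1.aemeasurable.real_toNNReal
  have := integral_withDensity_eq_integral_smul₀ hm (fun x : V => cexp (⟪x, t⟫ * I))
  simp only [ENNReal.ofReal] at *
  rw [this]
  refine integral_congr_ae (Eventually.of_forall fun w => ?_)
  simp only [NNReal.smul_def, Real.coe_toNNReal _ (hF w), Complex.real_smul]
  rw [mul_comm, inner_smul_right]
  congr 4
  field_simp

theorem bochner18 {V : Type*} [NormedAddCommGroup V] [InnerProductSpace ℝ V]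
    [MeasurableSpace V] [BorelSpace V] [FiniteDimensional ℝ V]
    {Ω : Type*} [MeasurableSpace Ω] (P : Measure Ω) [IsProbabilityMeasure P]
    (Y : V → Ω → ℝ) (hY : Measurable (Function.uncurry Y)) (r : V → ℝ) (hr : Continuous r)
    (hY2 : ∀ s, MemLp (Y s) 2 P) (hY1 : ∀ s, ∫ ω, (Y s ω) ^ 2 ∂P = 1)
    (hcov : ∀ s t, ∫ ω, Y s ω * Y t ω ∂P = r (t - s)) :
    ∃ ν : Measure V, IsProbabilityMeasure ν ∧ ∀ t, charFun ν t = r t := by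
  have hr0 : r 0 = 1 := by
    have := hcov 0 0
    rw [sub_zero] at this
    rw [← this, ← hY1 0]
    congr 1; ext ω; ring
  have hr1 : ∀ t, ‖r t‖ ≤ 1 := fun t => by
    have := hcov 0 t; rw [sub_zero] at this
    rw [← this]
    have hY22 : ∀ s, Integrable (fun ω => Y s ω ^ 2) P := fun s => (hY2 s).integrable_sq
    calc ‖∫ ω, Y 0 ω * Y t ω ∂P‖ ≤ ∫ ω, ‖Y 0 ω * Y t ω‖ ∂P := norm_integral_le_integral_norm _
      _ ≤ ∫ ω, (Y 0 ω ^ 2 / 2 + Y t ω ^ 2 / 2) ∂P := by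
          refine integral_mono ((hY2 0).integrable_mul (hY2 t)).norm
            (((hY22 0).div_const 2).add ((hY22 t).div_const 2)) fun ω => ?_
          simp only [Pi.mul_apply, norm_mul, Real.norm_eq_abs]
          nlinarith [sq_nonneg (|Y 0 ω| - |Y t ω|), sq_abs (Y 0 ω), sq_abs (Y t ω)]
      _ = 1 := by
          rw [integral_add ((hY22 0).div_const 2) ((hY22 t).div_const 2), integral_div, integral_div,
            hY1, hY1]; norm_num
  have hstep : ∀ k : ℕ, ∃ ν : ProbabilityMeasure V, ∀ t, charFun (ν : Measure V) t =
      ((r ((2 * π)⁻¹ • t) * Real.exp (-((k:ℝ) + 1)⁻¹ * ‖(2 * π)⁻¹ • t‖ ^ 2) : ℝ) : ℂ) := by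
    intro k
    have ha : (0:ℝ) < ((k:ℝ) + 1)⁻¹ := by positivity
    refine bochner_step18 (fun t => r t * Real.exp (-((k:ℝ) + 1)⁻¹ * ‖t‖ ^ 2)) (by fun_prop) ?_
      (by simp [hr0]) ?_
    · exact Integrable.bdd_mul (c := 1) (integrable_gauss18 _ ha) hr.aestronglyMeasurable
        (Eventually.of_forall hr1)
    · intro w
      exact fourier_pos18 P Y hY r hr hY2 hY1 hcov _ ha w
  choose ν hν using hstep
  have hlim : ∀ t, Tendsto (fun k => charFun (ν k : Measure V) t) atTop
      (𝓝 ((r ((2 * π)⁻¹ • t) : ℝ) : ℂ)) := by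
    intro t
    simp_rw [hν]
    refine (Complex.continuous_ofReal.tendsto _).comp ?_
    have : Tendsto (fun k : ℕ => r ((2 * π)⁻¹ • t) * Real.exp (-((k:ℝ) + 1)⁻¹ * ‖(2 * π)⁻¹ • t‖ ^ 2))
       atTop (𝓝 (r ((2 * π)⁻¹ • t) * Real.exp (-0 * ‖(2 * π)⁻¹ • t‖ ^ 2))) := by
      refine Tendsto.const_mul _ ((Real.continuous_exp.tendsto _).comp (Tendsto.mul_const _ ?_))
      refine Tendsto.neg (tendsto_inv_atTop_zero.comp ?_)
      exact tendsto_atTop_add_const_right _ _ tendsto_natCast_atTop_atTop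
    simpa using this
  have htight : IsTightMeasureSet (Set.range fun k => (ν k : Measure V)) :=
    isTightMeasureSet_of_tendsto_charFun (f := fun t => ((r ((2 * π)⁻¹ • t) : ℝ) : ℂ))
      (Continuous.continuousAt (by fun_prop)) hlim
  have hcompact : IsCompact (closure (Set.range ν)) := by
    refine isCompact_closure_of_isTightMeasureSet ?_
    refine htight.subset ?_
    rintro _ ⟨μ, ⟨k, rfl⟩, rfl⟩
    exact ⟨k, rfl⟩
  obtain ⟨μ', -, hμ'⟩ := hcompact.ultrafilter_le_nhds ((hyperfilter ℕ).map ν)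
    (by
      rw [le_principal_iff]
      exact Filter.mem_map.2 (Filter.Eventually.of_forall fun k => subset_closure ⟨k, rfl⟩))
  have hμ'' : Tendsto ν (hyperfilter ℕ : Filter ℕ) (𝓝 μ') := hμ'
  have hU : (hyperfilter ℕ : Filter ℕ) ≤ atTop := by
    rw [← Nat.cofinite_eq_atTop]; exact hyperfilter_le_cofinite
  rw [ProbabilityMeasure.tendsto_iff_forall_integral_rclike_tendsto ℂ] at hμ''
  have hchar : ∀ t, charFun (μ' : Measure V) t = ((r ((2 * π)⁻¹ • t) : ℝ) : ℂ) := by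
    intro t
    have h1 := hμ'' (BoundedContinuousFunction.innerProbChar t)
    simp_rw [← charFun_eq_integral_innerProbChar] at h1
    exact tendsto_nhds_unique h1 ((hlim t).mono_left hU)
  refine ⟨(μ' : Measure V).map ((2 * π) • ·), ?_, fun t => ?_⟩
  · exact Measure.isProbabilityMeasure_map (by fun_prop)
  · rw [charFun_map_smul, hchar, smul_smul, inv_mul_cancel₀ (by positivity), one_smul]
end Bochner18

end

section
open MeasureTheory

theorem gauss_facts18 {Ω : Type*} [MeasurableSpace Ω] (P : Measure Ω) [IsProbabilityMeasure P]
    (Z : Ω → ℝ) (hZ : Measurable Z) (v : NNReal) (h : P.map Z = ProbabilityTheory.gaussianReal 0 v) :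
    MemLp Z 2 P ∧ ∫ ω, Z ω ^ 2 ∂P = v ∧ ∫ ω, Real.cos (Z ω) ∂P = Real.exp (-(1/2) * v) := by
  refine ⟨?_, ?_, ?_⟩
  · have := ProbabilityTheory.memLp_id_gaussianReal (μ := 0) (v := v) 2
    rw [← h, memLp_map_measure_iff (by fun_prop) hZ.aemeasurable] at this
    exact this
  · have h1 : ∫ ω, Z ω ^ 2 ∂P = ∫ x, x ^ 2 ∂(P.map Z) := by
      rw [integral_map hZ.aemeasurable (by fun_prop)]
    rw [h1, h]
    have := ProbabilityTheory.variance_of_integral_eq_zero (μ := ProbabilityTheory.gaussianReal 0 v)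
      (X := fun x : ℝ => x) (by fun_prop) (by simp)
    rw [← this, ProbabilityTheory.variance_fun_id_gaussianReal]
  · have h1 : ∫ ω, Real.cos (Z ω) ∂P = ∫ x, Real.cos x ∂(P.map Z) := by
      rw [integral_map hZ.aemeasurable (by fun_prop)]
    have h2 := ProbabilityTheory.charFun_gaussianReal (μ := 0) (v := v) 1
    rw [charFun_apply_real] at h2
    have h3 := congrArg Complex.re h2
    have h4 := integral_re (𝕜 := ℂ) (f := fun x : ℝ => Complex.exp ((1:ℝ) * x * Complex.I))
      (μ := ProbabilityTheory.gaussianReal 0 v) ?_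
    · simp only [RCLike.re_eq_complex_re] at h4
      rw [← h4] at h3
      rw [h1, h]
      calc _ = ∫ x : ℝ, (Complex.exp ((1:ℝ) * x * Complex.I)).re ∂(ProbabilityTheory.gaussianReal 0 v) := by
            congr 1; ext x
            rw [Complex.ofReal_one, one_mul, Complex.exp_ofReal_mul_I_re]
        _ = _ := h3
        _ = _ := by
            rw [← Complex.ofReal_re (Real.exp (-(1/2) * v))]
            congr 1
            push_cast; congr 1; push_cast; ring
    · refine Integrable.of_bound (by fun_prop) 1
        (Filter.Eventually.of_forall fun y => ?_)
      rw [Complex.ofReal_one, one_mul, Complex.norm_exp_ofReal_mul_I]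

theorem spectral18 {n : ℕ} {Ω : Type*} [MeasurableSpace Ω] (P : Measure Ω) [IsProbabilityMeasure P]
    (X : (Fin n → ℝ) → Ω → ℝ)
    (hcont : ∀ ω, Continuous fun s => X s ω) (hmeas : ∀ s, Measurable (X s))
    (hGauss : ∀ (k : ℕ) (t : Fin k → (Fin n → ℝ)) (c : Fin k → ℝ),
      ∃ v : NNReal, P.map (fun ω => ∑ i, c i * X (t i) ω) =
        ProbabilityTheory.gaussianReal 0 v)
    (hStat : ∀ (τ : Fin n → ℝ) (k : ℕ) (t : Fin k → (Fin n → ℝ)),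
      P.map (fun ω i => X (t i + τ) ω) = P.map (fun ω i => X (t i) ω))
    (hVar : ∀ t, ∫ ω, (X t ω) ^ 2 ∂P = 1) :
    ∃ ν : Measure (Fin n → ℝ), IsProbabilityMeasure ν ∧
      ∀ (k : ℕ) (t : Fin k → (Fin n → ℝ)) (c : Fin k → ℝ),
        ∫ ω, Real.cos (∑ i, c i * X (t i) ω) ∂P =
          Real.exp (-(1/2) * ∫ l, ((∑ i, c i * Real.cos (dotProduct l (t i))) ^ 2 +
            (∑ i, c i * Real.sin (dotProduct l (t i))) ^ 2) ∂ν) := by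
  have hL2 : ∀ s, MemLp (X s) 2 P := by
    intro s
    obtain ⟨v, hv⟩ := hGauss 1 (fun _ => s) (fun _ => 1)
    simp only [Finset.univ_unique, Finset.sum_singleton, one_mul] at hv
    exact (gauss_facts18 P _ (hmeas s) v hv).1
  have hYY : ∀ s t, Integrable (fun ω => X s ω * X t ω) P := fun s t => (hL2 s).integrable_mul (hL2 t)
  set r : (Fin n → ℝ) → ℝ := fun t => ∫ ω, X 0 ω * X t ω ∂P with hr
  have hcov : ∀ s t, ∫ ω, X s ω * X t ω ∂P = r (t - s) := by
    intro s t
    have h := hStat s 2 ![0, t - s]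
    have e1 : ∀ (a : Fin 2 → (Fin n → ℝ)), ∫ ω, X (a 0) ω * X (a 1) ω ∂P =
        ∫ y : Fin 2 → ℝ, y 0 * y 1 ∂(P.map (fun ω i => X (a i) ω)) := by
      intro a
      rw [integral_map (measurable_pi_lambda _ fun i => hmeas _).aemeasurable
        (Measurable.aestronglyMeasurable (by fun_prop))]
    have e2 := e1 (fun i => (![0, t - s] : Fin 2 → (Fin n → ℝ)) i + s)
    have e3 := e1 ![0, t - s]
    rw [h, ← e3] at e2
    simpa [hr] using e2
  have hvar2 : ∀ t, ∫ ω, (X t ω - X 0 ω) ^ 2 ∂P = 2 - 2 * r t := by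
    intro t
    have : ∀ ω, (X t ω - X 0 ω) ^ 2 = X t ω ^ 2 + X 0 ω ^ 2 - 2 * (X 0 ω * X t ω) := fun ω => by ring
    simp_rw [this]
    have i1 : Integrable (fun ω => X t ω ^ 2 + X 0 ω ^ 2) P := (hL2 t).integrable_sq.add (hL2 0).integrable_sq
    rw [integral_sub i1 ((hYY 0 t).const_mul 2),
      integral_add (hL2 t).integrable_sq (hL2 0).integrable_sq, hVar, hVar, integral_const_mul]
    norm_num
    rfl
  have hrc : Continuous r := by
    have e : ∀ t, r t = 1 + Real.log (∫ ω, Real.cos (X t ω - X 0 ω) ∂P) := by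
      intro t
      obtain ⟨v, hv⟩ := hGauss 2 ![t, 0] ![1, -1]
      have hfun : (fun ω => ∑ i, (![1, -1] : Fin 2 → ℝ) i * X ((![t, 0] : Fin 2 → (Fin n → ℝ)) i) ω) =
        fun ω => X t ω - X 0 ω := by ext ω; simp [Fin.sum_univ_two]; ring
      rw [hfun] at hv
      obtain ⟨_, h2, h3⟩ := gauss_facts18 P (fun ω => X t ω - X 0 ω) ((hmeas t).sub (hmeas 0)) v hv
      rw [hvar2] at h2
      rw [h3, Real.log_exp, ← h2]; ring
    have hpos : ∀ t, ∫ ω, Real.cos (X t ω - X 0 ω) ∂P ≠ 0 := by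
      intro t
      obtain ⟨v, hv⟩ := hGauss 2 ![t, 0] ![1, -1]
      have hfun : (fun ω => ∑ i, (![1, -1] : Fin 2 → ℝ) i * X ((![t, 0] : Fin 2 → (Fin n → ℝ)) i) ω) =
        fun ω => X t ω - X 0 ω := by ext ω; simp [Fin.sum_univ_two]; ring
      rw [hfun] at hv
      rw [(gauss_facts18 P (fun ω => X t ω - X 0 ω) ((hmeas t).sub (hmeas 0)) v hv).2.2]
      exact (Real.exp_pos _).ne'
    rw [show r = fun t => 1 + Real.log (∫ ω, Real.cos (X t ω - X 0 ω) ∂P) from funext e]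
    refine continuous_const.add (Continuous.log ?_ hpos)
    refine continuous_of_dominated (bound := fun _ => 1) (fun t => ?_) (fun t => ?_) (integrable_const _) ?_
    · have := hmeas t; have := hmeas 0
      exact Measurable.aestronglyMeasurable (by fun_prop)
    · exact Filter.Eventually.of_forall fun ω => by simpa using Real.abs_cos_le_one _
    · exact Filter.Eventually.of_forall fun ω => by have := hcont ω; fun_prop
  have hjoint : Measurable (Function.uncurry X) :=
    measurable_uncurry_of_continuous_of_measurable hcont hmeas
  obtain ⟨ν0, hν0, hν0c⟩ := bochner18 (V := EuclideanSpace ℝ (Fin n)) P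
    (fun s ω => X (WithLp.ofLp s) ω)
    (by
      have : Measurable (fun p : EuclideanSpace ℝ (Fin n) × Ω => ((WithLp.ofLp p.1 : Fin n → ℝ), p.2)) := by
        fun_prop
      exact hjoint.comp this)
    (fun s => r (WithLp.ofLp s)) (by fun_prop) (fun s => hL2 _) (fun s => hVar _)
    (fun s t => by simpa using hcov _ _)
  set φ : EuclideanSpace ℝ (Fin n) → (Fin n → ℝ) := fun s => WithLp.ofLp s with hφ
  have hφm : Measurable φ := by rw [hφ]; fun_prop
  refine ⟨ν0.map φ, Measure.isProbabilityMeasure_map hφm.aemeasurable, ?_⟩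
  have hrcos : ∀ t, r t = ∫ l, Real.cos (dotProduct l t) ∂(ν0.map φ) := by
    intro t
    rw [integral_map hφm.aemeasurable (Measurable.aestronglyMeasurable (by unfold dotProduct; fun_prop))]
    have h1 := congrArg Complex.re (hν0c (WithLp.toLp 2 t))
    rw [charFun_apply, Complex.ofReal_re] at h1
    rw [← h1]
    have h4 := integral_re (𝕜 := ℂ) (f := fun x : EuclideanSpace ℝ (Fin n) =>
      Complex.exp (inner ℝ x (WithLp.toLp 2 t) * Complex.I)) (μ := ν0) (by
        refine Integrable.of_bound (Continuous.aestronglyMeasurable (by fun_prop)) 1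
          (Filter.Eventually.of_forall fun y => ?_)
        rw [Complex.norm_exp_ofReal_mul_I])
    simp only [RCLike.re_eq_complex_re] at h4
    rw [← h4]
    refine integral_congr_ae (Filter.Eventually.of_forall fun x => ?_)
    simp only [Complex.exp_ofReal_mul_I_re]
    congr 1
    rw [PiLp.inner_apply]
    simp [dotProduct, hφ, mul_comm]
  intro k t c
  obtain ⟨v, hv⟩ := hGauss k t c
  have hZm : Measurable (fun ω => ∑ i, c i * X (t i) ω) := by
    have := hmeas; fun_prop
  obtain ⟨_, h2, h3⟩ := gauss_facts18 P _ hZm v hv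
  rw [h3, ← h2]
  congr 2
  have hp : IsProbabilityMeasure (ν0.map φ) := Measure.isProbabilityMeasure_map hφm.aemeasurable
  have hcosi : ∀ s : Fin n → ℝ, Integrable (fun l => Real.cos (dotProduct l s)) (ν0.map φ) := fun s => by
    refine Integrable.of_bound (Measurable.aestronglyMeasurable (by unfold dotProduct; fun_prop)) 1
          (Filter.Eventually.of_forall fun y => ?_)
    simpa using Real.abs_cos_le_one _
  calc ∫ ω, (∑ i, c i * X (t i) ω) ^ 2 ∂P
      = ∫ ω, ∑ i, ∑ j, (c i * c j) * (X (t i) ω * X (t j) ω) ∂P := by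
        congr 1; ext ω
        rw [sq, Finset.sum_mul_sum]
        exact Finset.sum_congr rfl fun i _ => Finset.sum_congr rfl fun j _ => by ring
    _ = ∑ i, ∑ j, (c i * c j) * r (t j - t i) := by
        rw [integral_finsetSum _ fun i _ => integrable_finset_sum _ fun j _ =>
          (hYY (t i) (t j)).const_mul _]
        refine Finset.sum_congr rfl fun i _ => ?_
        rw [integral_finsetSum _ fun j _ =>
          (hYY (t i) (t j)).const_mul _]
        refine Finset.sum_congr rfl fun j _ => ?_
        rw [integral_const_mul, hcov]
    _ = ∫ l, ∑ i, ∑ j, (c i * c j) * Real.cos (dotProduct l (t j - t i)) ∂(ν0.map φ) := by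
        rw [integral_finsetSum _ fun i _ => integrable_finset_sum _ fun j _ => (hcosi _).const_mul _]
        refine Finset.sum_congr rfl fun i _ => ?_
        rw [integral_finsetSum _ fun j _ => (hcosi _).const_mul _]
        refine Finset.sum_congr rfl fun j _ => ?_
        rw [integral_const_mul, hrcos]
    _ = _ := by
        congr 1; ext l
        rw [sq, sq, Finset.sum_mul_sum, Finset.sum_mul_sum, ← Finset.sum_add_distrib]
        refine Finset.sum_congr rfl fun i _ => ?_
        rw [← Finset.sum_add_distrib]
        refine Finset.sum_congr rfl fun j _ => ?_
        rw [dotProduct_sub, Real.cos_sub]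
        ring

end

section
open MeasureTheory

theorem trig_lower18 (a b θ : ℝ) (hθ : |θ| ≤ 1) :
    (1/8) * ((a + b) ^ 2 + (b * θ) ^ 2) ≤ (a + b * Real.cos θ) ^ 2 + (b * Real.sin θ) ^ 2 := by
  have h1 : Real.cos θ ≤ 1 - 2 / Real.pi ^ 2 * θ ^ 2 :=
    Real.cos_le_one_sub_mul_cos_sq (hθ.trans (by linarith [Real.pi_gt_three]))
  have h2 : 1 - θ ^ 2 / 2 ≤ Real.cos θ := Real.one_sub_sq_div_two_le_cos
  have hθ2 : θ ^ 2 ≤ 1 := (sq_le_one_iff_abs_le_one _).2 hθ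
  have hpi : (1:ℝ)/8 ≤ 2 / Real.pi ^ 2 := by
    rw [div_le_div_iff₀ (by norm_num) (by positivity)]
    nlinarith [Real.pi_le_four, Real.pi_pos]
  have hs := Real.sin_sq_add_cos_sq θ
  set p := 1 - Real.cos θ with hp
  have hp1 : (1/8) * θ ^ 2 ≤ p := by nlinarith [sq_nonneg θ]
  have hp2 : p ≤ 1/2 := by linarith
  have hp0 : 0 ≤ p := by nlinarith [sq_nonneg θ]
  have e : (a + b * Real.cos θ) ^ 2 + (b * Real.sin θ) ^ 2 =
      (a + b) ^ 2 + 2 * b ^ 2 * p - 2 * (a + b) * b * p := by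
    have : Real.cos θ = 1 - p := by rw [hp]; ring
    have h3 : Real.sin θ ^ 2 = 1 - (1 - p) ^ 2 := by rw [← this]; linarith
    rw [mul_pow b, h3, this]; ring
  rw [e]
  nlinarith [sq_nonneg ((a + b) - 2 * b * p), mul_nonneg hp0 (sq_nonneg b),
    mul_nonneg (sub_nonneg.2 hp2) (mul_nonneg hp0 (sq_nonneg b)), sq_nonneg (a+b),
    mul_nonneg (sub_nonneg.2 hp1) (sq_nonneg b)]

theorem eval_bound18 {E V : Type*} [MeasurableSpace E] (κ : Measure E) [AddCommGroup V] [Module ℝ V]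
    [Module.Finite ℝ V] (L : V →ₗ[ℝ] (E → ℝ)) (hL : ∀ x, MemLp (L x) 2 κ) :
    ∀ᵐ l ∂κ, ∃ C : ℝ, 0 < C ∧ ∀ x, (L x l) ^ 2 ≤ C * ∫ y, (L x y) ^ 2 ∂κ := by
  let T : V →ₗ[ℝ] Lp ℝ 2 κ :=
    { toFun := fun x => (hL x).toLp
      map_add' := fun x y => by
        rw [← MemLp.toLp_add]; congr 1; simp
      map_smul' := fun c x => by
        simp only [RingHom.id_apply]
        rw [← MemLp.toLp_const_smul]; congr 1; simp }
  have hTn : ∀ x, ‖T x‖ ^ 2 = ∫ y, (L x y) ^ 2 ∂κ := by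
    intro x
    rw [← real_inner_self_eq_norm_sq, L2.inner_def]
    refine integral_congr_ae ?_
    filter_upwards [(hL x).coeFn_toLp] with y hy
    change inner ℝ (((hL x).toLp : Lp ℝ 2 κ) y) (((hL x).toLp : Lp ℝ 2 κ) y) = _
    rw [hy]; simp
  have hfg : (LinearMap.ker T).FG := IsNoetherian.noetherian _
  obtain ⟨S, hS⟩ := hfg
  have hae : ∀ᵐ l ∂κ, ∀ x ∈ S, L x l = 0 := by
    refine (Finset.eventually_all S).2 ?_
    intro x hx
    have hxk : T x = 0 := by
      have : x ∈ LinearMap.ker T := by rw [← hS]; exact Submodule.subset_span hx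
      exact this
    have h0 : (hL x).toLp = (0 : Lp ℝ 2 κ) := hxk
    have h1 := (hL x).coeFn_toLp
    rw [h0] at h1
    filter_upwards [h1, Lp.coeFn_zero ℝ 2 κ] with l h2 h3
    rw [← h2, h3]; rfl
  filter_upwards [hae] with l hl
  let ev : V →ₗ[ℝ] ℝ := (LinearMap.proj l).comp L
  have hker : LinearMap.ker T ≤ LinearMap.ker ev := by
    rw [← hS, Submodule.span_le]
    intro x hx
    exact hl x hx
  let g : LinearMap.range T →ₗ[ℝ] ℝ := ((LinearMap.ker T).liftQ ev hker).comp
    (T.quotKerEquivRange.symm : LinearMap.range T →ₗ[ℝ] _)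
  have hg : ∀ x, g ⟨T x, LinearMap.mem_range_self T x⟩ = L x l := by
    intro x
    have : T.quotKerEquivRange.symm ⟨T x, LinearMap.mem_range_self T x⟩ = (LinearMap.ker T).mkQ x := by
      rw [LinearEquiv.symm_apply_eq]; ext1; simp
    simp [g, ev, this]
  let g' := LinearMap.toContinuousLinearMap g
  refine ⟨‖g'‖ ^ 2 + 1, by positivity, fun x => ?_⟩
  have h1 : |L x l| ≤ ‖g'‖ * ‖T x‖ := by
    rw [← hg x]
    exact g'.le_opNorm ⟨T x, LinearMap.mem_range_self T x⟩
  rw [← hTn, ← sq_abs]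
  calc |L x l| ^ 2 ≤ (‖g'‖ * ‖T x‖) ^ 2 := by gcongr
    _ ≤ _ := by nlinarith [sq_nonneg ‖T x‖]

theorem exists_ball18 {n : ℕ} (ν : Measure (Fin n → ℝ))
    (hB : ∀ v : Fin n → ℝ, v ≠ 0 → ¬ ∀ᵐ l ∂ν, dotProduct l v = 0) :
    ∃ R : ℕ, ∀ v : Fin n → ℝ, v ≠ 0 →
      ¬ ∀ᵐ l ∂(ν.restrict (Metric.closedBall 0 (R:ℝ))), dotProduct l v = 0 := by
  let K : ℕ → Submodule ℝ (Fin n → ℝ) := fun R =>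
    { carrier := {v | ∀ᵐ l ∂(ν.restrict (Metric.closedBall 0 (R:ℝ))), dotProduct l v = 0}
      add_mem' := fun {a b} ha hb => by
        have ha' : ∀ᵐ l ∂(ν.restrict (Metric.closedBall 0 (R:ℝ))), dotProduct l a = 0 := ha
        have hb' : ∀ᵐ l ∂(ν.restrict (Metric.closedBall 0 (R:ℝ))), dotProduct l b = 0 := hb
        show ∀ᵐ l ∂(ν.restrict (Metric.closedBall 0 (R:ℝ))), dotProduct l (a + b) = 0
        filter_upwards [ha', hb'] with l h1 h2; rw [dotProduct_add, h1, h2, add_zero]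
      zero_mem' := by simp
      smul_mem' := fun c x hx => by
        have hx' : ∀ᵐ l ∂(ν.restrict (Metric.closedBall 0 (R:ℝ))), dotProduct l x = 0 := hx
        show ∀ᵐ l ∂(ν.restrict (Metric.closedBall 0 (R:ℝ))), dotProduct l (c • x) = 0
        filter_upwards [hx'] with l h1; rw [dotProduct_smul, h1, smul_zero] }
  have hmono : Antitone K := by
    intro a b hab v hv
    have : ν.restrict (Metric.closedBall 0 (a:ℝ)) ≤ ν.restrict (Metric.closedBall 0 (b:ℝ)) :=
      Measure.restrict_mono (Metric.closedBall_subset_closedBall (by exact_mod_cast hab)) le_rfl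
    exact (Measure.absolutelyContinuous_of_le this).ae_le hv
  obtain ⟨R, hR⟩ := IsArtinian.monotone_stabilizes
    (⟨fun k => OrderDual.toDual (K k), fun a b hab => hmono hab⟩ : ℕ →o (Submodule ℝ (Fin n → ℝ))ᵒᵈ)
  refine ⟨R, fun v hv hcon => hB v hv ?_⟩
  have hall : ∀ k : ℕ, ∀ᵐ l ∂(ν.restrict (Metric.closedBall 0 (k:ℝ))), dotProduct l v = 0 := by
    intro k
    have hvR : v ∈ K R := hcon
    rcases le_total R k with h | h
    · have : K R = K k := hR k h
      rw [this] at hvR; exact hvR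
    · exact hmono h hvR
  have : ∀ᵐ l ∂ν, ∀ k : ℕ, l ∈ Metric.closedBall (0 : Fin n → ℝ) (k:ℝ) → dotProduct l v = 0 :=
    ae_all_iff.2 fun k => (ae_restrict_iff' Metric.isClosed_closedBall.measurableSet).1 (hall k)
  filter_upwards [this] with l hl
  obtain ⟨k, hk⟩ := exists_nat_ge ‖l‖
  exact hl k (by simpa using hk)

theorem spec_lower18 {n : ℕ} (ν : Measure (Fin n → ℝ)) [IsProbabilityMeasure ν]
    (hB : ∀ v : Fin n → ℝ, v ≠ 0 → ¬ ∀ᵐ l ∂ν, dotProduct l v = 0) :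
    ∃ (R : ℕ) (c : ℝ) (Λ : Matrix (Fin n) (Fin n) ℝ), 0 < c ∧ Λ.det ≠ 0 ∧
      ∀ v w t : Fin n → ℝ, (∀ l : Fin n → ℝ, ‖l‖ ≤ R → |dotProduct l t| ≤ 1) →
        c * ∑ i, ((dotProduct (Λ i) v + dotProduct (Λ i) w) ^ 2 +
          (dotProduct (Λ i) w * dotProduct (Λ i) t) ^ 2) ≤
        ∫ l in Metric.closedBall 0 (R:ℝ), ((dotProduct l v + dotProduct l w * Real.cos (dotProduct l t)) ^ 2 +
          (dotProduct l w * Real.sin (dotProduct l t)) ^ 2) ∂ν := by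
  obtain ⟨R, hR⟩ := exists_ball18 ν hB
  set κ := ν.restrict (Metric.closedBall (0 : Fin n → ℝ) (R:ℝ)) with hκ
  have hbdd : ∀ f : (Fin n → ℝ) → ℝ, Continuous f → ∀ p, MemLp f p κ := by
    intro f hf p
    obtain ⟨C, hC⟩ := (isCompact_closedBall (0 : Fin n → ℝ) (R:ℝ)).exists_bound_of_continuousOn hf.continuousOn
    refine MemLp.of_bound hf.aestronglyMeasurable C ?_
    exact (ae_restrict_iff' Metric.isClosed_closedBall.measurableSet).2 (Filter.Eventually.of_forall hC)
  have hIntg : ∀ f : (Fin n → ℝ) → ℝ, Continuous f → Integrable f κ := fun f hf =>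
    memLp_one_iff_integrable.1 (hbdd f hf 1)
  have hdc : ∀ v : Fin n → ℝ, Continuous (fun l : Fin n → ℝ => dotProduct l v) := fun v => by
    unfold dotProduct; fun_prop
  let L1 : (Fin n → ℝ) →ₗ[ℝ] ((Fin n → ℝ) → ℝ) :=
    { toFun := fun v l => dotProduct l v
      map_add' := fun a b => by ext l; simp [dotProduct_add]
      map_smul' := fun c a => by ext l; simp [dotProduct_smul] }
  let L2 : (Matrix (Fin n) (Fin n) ℝ) →ₗ[ℝ] ((Fin n → ℝ) → ℝ) :=
    { toFun := fun A l => dotProduct l (A.mulVec l)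
      map_add' := fun a b => by ext l; simp [Matrix.add_mulVec, dotProduct_add]
      map_smul' := fun c a => by ext l; simp [Matrix.smul_mulVec, dotProduct_smul] }
  have g1 := eval_bound18 κ L1 (fun v => hbdd _ (hdc v) 2)
  have g2 := eval_bound18 κ L2 (fun A => hbdd _ (by
    change Continuous fun l : Fin n → ℝ => dotProduct l (A.mulVec l)
    unfold Matrix.mulVec dotProduct; fun_prop) 2)
  set G : Set (Fin n → ℝ) := {l | (∃ C : ℝ, 0 < C ∧ ∀ x, (L1 x l) ^ 2 ≤ C * ∫ y, (L1 x y) ^ 2 ∂κ) ∧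
    (∃ C : ℝ, 0 < C ∧ ∀ x, (L2 x l) ^ 2 ≤ C * ∫ y, (L2 x y) ^ 2 ∂κ)} with hG
  have hGae : ∀ᵐ l ∂κ, l ∈ G := by filter_upwards [g1, g2] with l h1 h2 using ⟨h1, h2⟩
  have hspan : Submodule.span ℝ G = ⊤ := by
    by_contra hne
    obtain ⟨f, hf0, hf⟩ := Submodule.exists_le_ker_of_lt_top _ (lt_top_iff_ne_top.2 hne)
    set v : Fin n → ℝ := fun i => f (Pi.single i 1) with hv
    have hfv : ∀ l, f l = dotProduct l v := by
      intro l
      conv_lhs => rw [← Finset.univ_sum_single l]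
      rw [map_sum, dotProduct]
      refine Finset.sum_congr rfl fun i _ => ?_
      rw [hv, ← smul_eq_mul, ← map_smul]
      congr 1
      rw [← Pi.single_smul, smul_eq_mul, mul_one]
    refine hR v ?_ ?_
    · rintro h0
      refine hf0 (LinearMap.ext fun l => ?_)
      rw [hfv, h0]; simp
    · filter_upwards [hGae] with l hl
      rw [← hfv]
      exact hf (Submodule.subset_span hl)
  obtain ⟨b, hbG, hbs, hbi⟩ := exists_linearIndependent ℝ G
  have hbasis : Module.Basis b ℝ (Fin n → ℝ) := Module.Basis.mk hbi (by
    simp only [Subtype.range_coe_subtype, Set.setOf_mem_eq]; rw [hbs, hspan])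
  haveI : Fintype b := FiniteDimensional.fintypeBasisIndex hbasis
  have hcard : Fintype.card b = n := by
    have := Module.finrank_eq_card_basis hbasis
    simpa using this.symm
  let eqv : Fin n ≃ b := (Fintype.equivFinOfCardEq hcard).symm
  have hΛi : LinearIndependent ℝ (fun i : Fin n => ((eqv i : b) : Fin n → ℝ)) :=
    hbi.comp eqv eqv.injective
  set Λ : Matrix (Fin n) (Fin n) ℝ := Matrix.of (fun i => ((eqv i : b) : Fin n → ℝ)) with hΛ
  have hdet : Λ.det ≠ 0 := by
    have : IsUnit Λ := Matrix.linearIndependent_rows_iff_isUnit.1 hΛi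
    exact ((Matrix.isUnit_iff_isUnit_det _).1 this).ne_zero
  have hmem : ∀ i, Λ i ∈ G := fun i => hbG (eqv i).2
  choose C1 hC1 hb1 using fun i => (hmem i).1
  choose C2 hC2 hb2 using fun i => (hmem i).2
  set S : ℝ := 1 + ∑ i, (C1 i + C2 i) with hS
  have hSpos : 0 < S := by
    have : 0 ≤ ∑ i, (C1 i + C2 i) := Finset.sum_nonneg fun i _ => (add_pos (hC1 i) (hC2 i)).le
    linarith
  refine ⟨R, (1/8) / S, Λ, by positivity, hdet, fun v w t ht => ?_⟩
  have hA : ∀ l : Fin n → ℝ, L2 (Matrix.vecMulVec w t) l = dotProduct l w * dotProduct l t := by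
    intro l
    change dotProduct l ((Matrix.vecMulVec w t).mulVec l) = _
    rw [Matrix.vecMulVec_mulVec]
    simp [dotProduct_smul, dotProduct_comm t l, mul_comm]
  set I1 := ∫ y, (L1 (v + w) y) ^ 2 ∂κ with hI1
  set I2 := ∫ y, (L2 (Matrix.vecMulVec w t) y) ^ 2 ∂κ with hI2
  have hI1' : 0 ≤ I1 := integral_nonneg fun _ => sq_nonneg _
  have hI2' : 0 ≤ I2 := integral_nonneg fun _ => sq_nonneg _
  have hsum : ∑ i, ((dotProduct (Λ i) v + dotProduct (Λ i) w) ^ 2 +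
          (dotProduct (Λ i) w * dotProduct (Λ i) t) ^ 2) ≤ S * (I1 + I2) := by
    calc _ ≤ ∑ i, (C1 i + C2 i) * (I1 + I2) := by
          refine Finset.sum_le_sum fun i _ => ?_
          have h1 := hb1 i (v + w)
          have h2 := hb2 i (Matrix.vecMulVec w t)
          rw [hA (Λ i)] at h2
          have h1' : (dotProduct (Λ i) v + dotProduct (Λ i) w) ^ 2 ≤ C1 i * I1 := by
            rw [← dotProduct_add]; exact h1
          nlinarith [mul_nonneg (hC1 i).le hI2', mul_nonneg (hC2 i).le hI1']
      _ ≤ _ := by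
          rw [← Finset.sum_mul]
          refine mul_le_mul_of_nonneg_right ?_ (by positivity)
          rw [hS]; linarith
  calc _ ≤ (1/8) / S * (S * (I1 + I2)) := by gcongr
    _ = (1/8) * (I1 + I2) := by field_simp
    _ = ∫ l, (1/8) * ((dotProduct l v + dotProduct l w) ^ 2 + (dotProduct l w * dotProduct l t) ^ 2) ∂κ := by
        have hv := hdc v; have hw := hdc w; have htt := hdc t
        rw [integral_const_mul, integral_add (hIntg _ (by fun_prop)) (hIntg _ (by fun_prop)), hI1, hI2]
        simp_rw [hA]
        congr 2
        refine integral_congr_ae (Filter.Eventually.of_forall fun l => ?_)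
        change (dotProduct l (v + w)) ^ 2 = _
        simp only [dotProduct_add]
    _ ≤ _ := by
        have hv := hdc v; have hw := hdc w; have htt := hdc t
        refine integral_mono_ae (hIntg _ (by fun_prop)) (hIntg _ (by fun_prop)) ?_
        refine (ae_restrict_iff' Metric.isClosed_closedBall.measurableSet).2
          (Filter.Eventually.of_forall fun l hl => ?_)
        exact trig_lower18 _ _ _ (ht l (by simpa using hl))

end

section
open MeasureTheory Filter Topology

theorem map_limit18 {Ω E : Type*} [MeasurableSpace Ω] (P : Measure Ω) [IsProbabilityMeasure P]
    [TopologicalSpace E] [MeasurableSpace E] [BorelSpace E] [HasOuterApproxClosed E]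
    (Z Z' : ℕ → Ω → E) (W W' : Ω → E) (hZ : ∀ k, Measurable (Z k)) (hZ' : ∀ k, Measurable (Z' k))
    (hW : Measurable W) (hW' : Measurable W')
    (h1 : ∀ ω, Tendsto (fun k => Z k ω) atTop (𝓝 (W ω)))
    (h2 : ∀ ω, Tendsto (fun k => Z' k ω) atTop (𝓝 (W' ω)))
    (he : ∀ k, P.map (Z k) = P.map (Z' k)) : P.map W = P.map W' := by
  haveI := Measure.isProbabilityMeasure_map (μ := P) hW.aemeasurable
  haveI := Measure.isProbabilityMeasure_map (μ := P) hW'.aemeasurable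
  refine ext_of_forall_integral_eq_of_IsFiniteMeasure fun f => ?_
  have hm : AEStronglyMeasurable f (P.map W) := f.continuous.measurable.aestronglyMeasurable
  rw [integral_map hW.aemeasurable f.continuous.measurable.aestronglyMeasurable,
    integral_map hW'.aemeasurable f.continuous.measurable.aestronglyMeasurable]
  have lim : ∀ (Y : ℕ → Ω → E) (V : Ω → E), (∀ k, Measurable (Y k)) →
      (∀ ω, Tendsto (fun k => Y k ω) atTop (𝓝 (V ω))) →
      Tendsto (fun k => ∫ ω, f (Y k ω) ∂P) atTop (𝓝 (∫ ω, f (V ω) ∂P)) := by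
    intro Y V hY hlim
    refine tendsto_integral_of_dominated_convergence (fun _ => ‖f‖) ?_ (integrable_const _) ?_ ?_
    · intro k; exact (f.continuous.measurable.comp (hY k)).aestronglyMeasurable
    · intro k; exact Eventually.of_forall fun ω => f.norm_coe_le_norm _
    · exact Eventually.of_forall fun ω => (f.continuous.tendsto _).comp (hlim ω)
  refine tendsto_nhds_unique (lim Z W hZ h1) ?_
  have e : ∀ k, ∫ ω, f (Z k ω) ∂P = ∫ ω, f (Z' k ω) ∂P := by
    intro k
    rw [← integral_map (hZ k).aemeasurable f.continuous.measurable.aestronglyMeasurable,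
      ← integral_map (hZ' k).aemeasurable f.continuous.measurable.aestronglyMeasurable, he k]
  simp_rw [e]
  exact lim Z' W' hZ' h2

theorem cos_limit18 {Ω : Type*} [MeasurableSpace Ω] (P : Measure Ω) [IsProbabilityMeasure P]
    (Z : ℕ → Ω → ℝ) (W : Ω → ℝ) (hZ : ∀ k, Measurable (Z k))
    (h1 : ∀ ω, Tendsto (fun k => Z k ω) atTop (𝓝 (W ω))) :
    Tendsto (fun k => ∫ ω, Real.cos (Z k ω) ∂P) atTop (𝓝 (∫ ω, Real.cos (W ω) ∂P)) := by
  refine tendsto_integral_of_dominated_convergence (fun _ => 1) ?_ (integrable_const _) ?_ ?_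
  · intro k; exact (Real.continuous_cos.measurable.comp (hZ k)).aestronglyMeasurable
  · intro k; exact Eventually.of_forall fun ω => by simpa using Real.abs_cos_le_one _
  · exact Eventually.of_forall fun ω => (Real.continuous_cos.tendsto _).comp (h1 ω)

theorem gauss_limit18 {Ω : Type*} [MeasurableSpace Ω] (P : Measure Ω) [IsProbabilityMeasure P]
    (Z : ℕ → Ω → ℝ) (W : Ω → ℝ) (hZ : ∀ k, Measurable (Z k)) (hW : Measurable W)
    (h1 : ∀ ω, Tendsto (fun k => Z k ω) atTop (𝓝 (W ω)))
    (hG : ∀ k, ∃ v : NNReal, P.map (Z k) = ProbabilityTheory.gaussianReal 0 v) :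
    ∃ v : NNReal, P.map W = ProbabilityTheory.gaussianReal 0 v := by
  choose v hv using hG
  have hcf : ∀ k (x : ℝ), ∫ ω, Real.cos (x * Z k ω) ∂P = Real.exp (-(1/2) * (x ^ 2 * v k)) := by
    intro k x
    have h := ProbabilityTheory.gaussianReal_map_const_mul (μ := 0) (v := v k) x
    rw [← hv k, Measure.map_map (by fun_prop) (hZ k), mul_zero] at h
    have := (gauss_facts18 P (fun ω => x * Z k ω) ((hZ k).const_mul x) _ h).2.2
    rw [this]; simp
  obtain ⟨x, hx, hpos⟩ : ∃ x : ℝ, x ≠ 0 ∧ 0 < ∫ ω, Real.cos (x * W ω) ∂P := by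
    have ht : Tendsto (fun k : ℕ => ∫ ω, Real.cos ((1 / ((k:ℝ) + 1)) * W ω) ∂P) atTop
        (𝓝 (∫ ω, Real.cos ((0:ℝ)) ∂P)) := by
      refine cos_limit18 P _ (fun _ => 0) (fun k => by fun_prop) fun ω => ?_
      have := (tendsto_one_div_add_atTop_nhds_zero_nat (𝕜 := ℝ)).mul_const (W ω)
      simpa using this
    have h01 : (∫ ω, Real.cos ((0:ℝ)) ∂P) = 1 := by simp
    rw [h01] at ht
    obtain ⟨k, hk⟩ := (ht.eventually (lt_mem_nhds (show (0:ℝ) < 1 by norm_num))).exists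
    exact ⟨1 / ((k:ℝ) + 1), by positivity, hk⟩
  have hlimx : ∀ y : ℝ, Tendsto (fun k => Real.exp (-(1/2) * (y ^ 2 * v k))) atTop
      (𝓝 (∫ ω, Real.cos (y * W ω) ∂P)) := by
    intro y
    simp_rw [← hcf]
    exact cos_limit18 P _ _ (fun k => (hZ k).const_mul y) fun ω => (h1 ω).const_mul y
  have hvlim : Tendsto (fun k => (v k : ℝ)) atTop
      (𝓝 (-(2 / x ^ 2) * Real.log (∫ ω, Real.cos (x * W ω) ∂P))) := by
    have := ((Real.continuousAt_log hpos.ne').tendsto.comp (hlimx x)).const_mul (-(2 / x ^ 2))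
    refine this.congr fun k => ?_
    simp only [Function.comp, Real.log_exp]
    field_simp
  have hnn : 0 ≤ -(2 / x ^ 2) * Real.log (∫ ω, Real.cos (x * W ω) ∂P) :=
    ge_of_tendsto' hvlim fun k => (v k).2
  lift (-(2 / x ^ 2) * Real.log (∫ ω, Real.cos (x * W ω) ∂P)) to NNReal using hnn with u hu
  refine ⟨u, ?_⟩
  haveI := Measure.isProbabilityMeasure_map (μ := P) hW.aemeasurable
  refine Measure.ext_of_charFun ?_
  ext y
  have lim : Tendsto (fun k => charFun (P.map (Z k)) y) atTop (𝓝 (charFun (P.map W) y)) := by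
    simp only [charFun_apply_real]
    have e : ∀ (V : Ω → ℝ), Measurable V → ∫ x : ℝ, Complex.exp (y * x * Complex.I) ∂(P.map V) =
        ∫ ω, Complex.exp (y * V ω * Complex.I) ∂P := fun V hV => by
      rw [integral_map hV.aemeasurable (by fun_prop)]
    rw [e W hW]
    simp_rw [fun k => e (Z k) (hZ k)]
    refine tendsto_integral_of_dominated_convergence (fun _ => 1) ?_ (integrable_const _) ?_ ?_
    · intro k
      have := hZ k
      exact Measurable.aestronglyMeasurable (by fun_prop)
    · intro k; refine Eventually.of_forall fun ω => ?_
      have : ((y:ℂ) * (Z k ω : ℂ) * Complex.I) = ((y * Z k ω : ℝ) : ℂ) * Complex.I := by push_cast; ring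
      rw [this, Complex.norm_exp_ofReal_mul_I]
    · refine Eventually.of_forall fun ω => ?_
      have hc : Continuous fun z : ℝ => Complex.exp ((y:ℂ) * (z:ℂ) * Complex.I) := by fun_prop
      exact (hc.tendsto _).comp (h1 ω)
  refine tendsto_nhds_unique lim ?_
  simp_rw [hv, ProbabilityTheory.charFun_gaussianReal]
  have hc : Continuous fun z : ℝ => Complex.exp ((y:ℂ) * ((0:ℝ):ℂ) * Complex.I - (z:ℂ) * (y:ℂ) ^ 2 / 2) := by fun_prop
  exact (hc.tendsto (u:ℝ)).comp hvlim

/-- Difference quotients. -/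
theorem diffquot18 {E : Type*} [NormedAddCommGroup E] [NormedSpace ℝ E] (f : E → ℝ) (s v : E)
    (hf : DifferentiableAt ℝ f s) :
    Tendsto (fun k : ℕ => ((k:ℝ) + 1) * (f (s + (1 / ((k:ℝ) + 1)) • v) - f s)) atTop
      (𝓝 (fderiv ℝ f s v)) := by
  have h := hf.hasFDerivAt.lim v (c := fun k : ℕ => (k:ℝ) + 1) (l := atTop) (by
    refine tendsto_norm_atTop_atTop.comp ?_
    exact tendsto_atTop_add_const_right _ _ tendsto_natCast_atTop_atTop)
  simpa only [smul_eq_mul, one_div] using h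

/-- Measurable stationary centered Gaussian field. -/
def GF18 {n : ℕ} {Ω : Type*} [MeasurableSpace Ω] (P : Measure Ω) (X : (Fin n → ℝ) → Ω → ℝ) : Prop :=
  (∀ s, Measurable (X s)) ∧
  (∀ (k : ℕ) (t : Fin k → (Fin n → ℝ)) (c : Fin k → ℝ),
      ∃ v : NNReal, P.map (fun ω => ∑ i, c i * X (t i) ω) =
        ProbabilityTheory.gaussianReal 0 v) ∧
  (∀ (τ : Fin n → ℝ) (k : ℕ) (t : Fin k → (Fin n → ℝ)),
      P.map (fun ω i => X (t i + τ) ω) = P.map (fun ω i => X (t i) ω))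

theorem deriv_field18 {n : ℕ} {Ω : Type*} [MeasurableSpace Ω] (P : Measure Ω) [IsProbabilityMeasure P]
    (X : (Fin n → ℝ) → Ω → ℝ) (hX : GF18 P X) (hd : ∀ ω, Differentiable ℝ fun s => X s ω)
    (v : Fin n → ℝ) : GF18 P (fun s ω => fderiv ℝ (fun t => X t ω) s v) := by
  obtain ⟨hm, hG, hS⟩ := hX
  have hq : ∀ s ω, Tendsto (fun k : ℕ => ((k:ℝ) + 1) * (X (s + (1 / ((k:ℝ) + 1)) • v) ω - X s ω)) atTop
      (𝓝 (fderiv ℝ (fun t => X t ω) s v)) := fun s ω => diffquot18 _ s v (hd ω s)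
  have hqm : ∀ s (k : ℕ), Measurable fun ω => ((k:ℝ) + 1) * (X (s + (1 / ((k:ℝ) + 1)) • v) ω - X s ω) :=
    fun s k => ((hm _).sub (hm _)).const_mul _
  have hdm : ∀ s, Measurable fun ω => fderiv ℝ (fun t => X t ω) s v := fun s =>
    measurable_of_tendsto_metrizable (hqm s) (tendsto_pi_nhds.2 fun ω => hq s ω)
  refine ⟨hdm, ?_, ?_⟩
  · intro k t c
    refine gauss_limit18 P (fun K ω => ∑ i, c i * (((K:ℝ) + 1) * (X (t i + (1 / ((K:ℝ) + 1)) • v) ω - X (t i) ω)))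
      _ (fun K => Finset.measurable_sum _ fun i _ => (hqm _ _).const_mul _)
      (Finset.measurable_sum _ fun i _ => (hdm _).const_mul _)
      (fun ω => tendsto_finsetSum _ fun i _ => (hq _ ω).const_mul _) ?_
    intro K
    obtain ⟨u, hu⟩ := hG (k + k) (Fin.append (fun i => t i + (1 / ((K:ℝ) + 1)) • v) t)
      (Fin.append (fun i => c i * ((K:ℝ) + 1)) (fun i => - (c i * ((K:ℝ) + 1))))
    refine ⟨u, ?_⟩
    rw [← hu]
    congr 1
    ext ω
    rw [Fin.sum_univ_add]
    simp only [Fin.append_left, Fin.append_right]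
    rw [← Finset.sum_add_distrib]
    exact Finset.sum_congr rfl fun i _ => by ring
  · intro τ k t
    refine map_limit18 P
      (fun K ω i => ((K:ℝ) + 1) * (X (t i + τ + (1 / ((K:ℝ) + 1)) • v) ω - X (t i + τ) ω))
      (fun K ω i => ((K:ℝ) + 1) * (X (t i + (1 / ((K:ℝ) + 1)) • v) ω - X (t i) ω)) _ _
      (fun K => measurable_pi_lambda _ fun i => hqm _ _)
      (fun K => measurable_pi_lambda _ fun i => hqm _ _)
      (measurable_pi_lambda _ fun i => hdm _) (measurable_pi_lambda _ fun i => hdm _)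
      (fun ω => tendsto_pi_nhds.2 fun i => hq _ ω) (fun ω => tendsto_pi_nhds.2 fun i => hq _ ω) ?_
    intro K
    have h := hS τ (k + k) (Fin.append (fun i => t i + (1 / ((K:ℝ) + 1)) • v) t)
    have h2 := congrArg (Measure.map (fun (y : Fin (k + k) → ℝ) (i : Fin k) =>
      ((K:ℝ) + 1) * (y (Fin.castAdd k i) - y (Fin.natAdd k i)))) h
    have gm : Measurable (fun (y : Fin (k + k) → ℝ) (i : Fin k) =>
      ((K:ℝ) + 1) * (y (Fin.castAdd k i) - y (Fin.natAdd k i))) := by fun_prop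
    rw [Measure.map_map gm (measurable_pi_lambda _ fun i => hm _),
      Measure.map_map gm (measurable_pi_lambda _ fun i => hm _)] at h2
    convert h2 using 2
    · ext ω i
      simp only [Function.comp, Fin.append_left, Fin.append_right]
      rw [add_right_comm]
    · ext ω i
      simp only [Function.comp, Fin.append_left, Fin.append_right]

/-- Uniform moments. -/
theorem moment18 {n : ℕ} {Ω : Type*} [MeasurableSpace Ω] (P : Measure Ω) [IsProbabilityMeasure P]
    (X : (Fin n → ℝ) → Ω → ℝ) (hX : GF18 P X) (p : ℝ) (hp : 0 < p) :
    ∃ C : ENNReal, C ≠ ⊤ ∧ ∀ s, ∫⁻ ω, ENNReal.ofReal |X s ω| ^ p ∂P ≤ C := by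
  obtain ⟨hm, hG, hS⟩ := hX
  have hlaw : ∀ s, P.map (X s) = P.map (X 0) := by
    intro s
    have h := hS s 1 (fun _ => 0)
    have h2 := congrArg (Measure.map (fun y : Fin 1 → ℝ => y 0)) h
    rw [Measure.map_map (by fun_prop) (measurable_pi_lambda _ fun i => hm _),
      Measure.map_map (by fun_prop) (measurable_pi_lambda _ fun i => hm _)] at h2
    convert h2 using 2
    · ext ω; simp
    · rfl
  obtain ⟨v, hv⟩ := hG 1 (fun _ => 0) (fun _ => 1)
  simp only [Finset.univ_unique, Finset.sum_singleton, one_mul] at hv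
  refine ⟨∫⁻ ω, ENNReal.ofReal |X 0 ω| ^ p ∂P, ?_, fun s => ?_⟩
  · have hp' : ENNReal.ofReal p ≠ 0 := by simpa using hp
    have h := ProbabilityTheory.memLp_id_gaussianReal (μ := 0) (v := v) (Real.toNNReal p)
    rw [← hv] at h
    have h' := (memLp_map_measure_iff (by fun_prop) (hm 0).aemeasurable).1 h
    have := lintegral_rpow_enorm_lt_top_of_eLpNorm_lt_top (by simpa using hp) (by simp) h'.2
    refine (lt_of_eq_of_lt ?_ this).ne
    refine lintegral_congr fun ω => ?_
    simp [Real.enorm_eq_ofReal_abs, hp.le]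
  · have e : ∀ s, ∫⁻ ω, ENNReal.ofReal |X s ω| ^ p ∂P = ∫⁻ x, ENNReal.ofReal |x| ^ p ∂(P.map (X s)) := by
      intro s
      rw [lintegral_map (by fun_prop) (hm s)]
    rw [e, e 0, hlaw s]

end

section
open MeasureTheory Filter Topology

theorem cos_diff_bound18 (a b : ℝ) (k : ℕ) :
    |((k:ℝ) + 1) * (Real.cos (a + (1 / ((k:ℝ) + 1)) * b) - Real.cos a)| ≤ |b| := by
  have hk : (0:ℝ) < (k:ℝ) + 1 := by positivity
  have h := Real.abs_cos_sub_cos_le (a + (1 / ((k:ℝ) + 1)) * b) a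
  rw [abs_mul, abs_of_pos hk]
  rw [add_sub_cancel_left, abs_mul, abs_of_pos (show (0:ℝ) < 1 / ((k:ℝ) + 1) by positivity)] at h
  calc _ ≤ ((k:ℝ)+1) * (1 / ((k:ℝ) + 1) * |b|) := by gcongr
    _ = _ := by field_simp

theorem sin_diff_bound18 (a b : ℝ) (k : ℕ) :
    |((k:ℝ) + 1) * (Real.sin (a + (1 / ((k:ℝ) + 1)) * b) - Real.sin a)| ≤ |b| := by
  have := cos_diff_bound18 (a - Real.pi/2) b k
  rw [show a - Real.pi / 2 + 1 / ((k:ℝ) + 1) * b = (a + 1 / ((k:ℝ) + 1) * b) - Real.pi/2 by ring,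
    Real.cos_sub_pi_div_two, Real.cos_sub_pi_div_two] at this
  exact this

theorem grad_cf18 {n : ℕ} {Ω : Type*} [MeasurableSpace Ω] (P : Measure Ω) [IsProbabilityMeasure P]
    (X : (Fin n → ℝ) → Ω → ℝ) (hm : ∀ s, Measurable (X s)) (hd : ∀ ω, Differentiable ℝ fun s => X s ω)
    (ν : Measure (Fin n → ℝ)) [IsProbabilityMeasure ν]
    (hν : ∀ (k : ℕ) (t : Fin k → (Fin n → ℝ)) (c : Fin k → ℝ),
        ∫ ω, Real.cos (∑ i, c i * X (t i) ω) ∂P =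
          Real.exp (-(1/2) * ∫ l, ((∑ i, c i * Real.cos (dotProduct l (t i))) ^ 2 +
            (∑ i, c i * Real.sin (dotProduct l (t i))) ^ 2) ∂ν))
    (R : ℕ) (s s' v w : Fin n → ℝ) :
    ∫ ω, Real.cos (fderiv ℝ (fun t => X t ω) s v + fderiv ℝ (fun t => X t ω) s' w) ∂P ≤
      Real.exp (-(1/2) * ∫ l in Metric.closedBall 0 (R:ℝ),
        ((dotProduct l v + dotProduct l w * Real.cos (dotProduct l (s' - s))) ^ 2 +
          (dotProduct l w * Real.sin (dotProduct l (s' - s))) ^ 2) ∂ν) := by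
  have hdc : ∀ v : Fin n → ℝ, Continuous (fun l : Fin n → ℝ => dotProduct l v) := fun v => by
    unfold dotProduct; fun_prop
  have hdv := hdc v; have hdw := hdc w; have hds := hdc s; have hds' := hdc s'
  set C : ℕ → (Fin n → ℝ) → ℝ := fun k l =>
    ((k:ℝ) + 1) * (Real.cos (dotProduct l s + (1 / ((k:ℝ) + 1)) * dotProduct l v) - Real.cos (dotProduct l s)) +
    ((k:ℝ) + 1) * (Real.cos (dotProduct l s' + (1 / ((k:ℝ) + 1)) * dotProduct l w) - Real.cos (dotProduct l s')) with hC
  set S : ℕ → (Fin n → ℝ) → ℝ := fun k l =>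
    ((k:ℝ) + 1) * (Real.sin (dotProduct l s + (1 / ((k:ℝ) + 1)) * dotProduct l v) - Real.sin (dotProduct l s)) +
    ((k:ℝ) + 1) * (Real.sin (dotProduct l s' + (1 / ((k:ℝ) + 1)) * dotProduct l w) - Real.sin (dotProduct l s')) with hS
  have hCc : ∀ k, Continuous (C k) := fun k => by rw [hC]; fun_prop
  have hSc : ∀ k, Continuous (S k) := fun k => by rw [hS]; fun_prop
  have h1 : Tendsto (fun k : ℕ => ∫ ω, Real.cos (((k:ℝ) + 1) * (X (s + (1 / ((k:ℝ) + 1)) • v) ω - X s ω) +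
      ((k:ℝ) + 1) * (X (s' + (1 / ((k:ℝ) + 1)) • w) ω - X s' ω)) ∂P) atTop
      (𝓝 (∫ ω, Real.cos (fderiv ℝ (fun t => X t ω) s v + fderiv ℝ (fun t => X t ω) s' w) ∂P)) := by
    refine cos_limit18 P _ _ (fun k => ?_) fun ω =>
      (diffquot18 (fun t => X t ω) s v (hd ω s)).add (diffquot18 (fun t => X t ω) s' w (hd ω s'))
    exact (((hm _).sub (hm _)).const_mul _).add (((hm _).sub (hm _)).const_mul _)
  have h2 : ∀ k : ℕ, ∫ ω, Real.cos (((k:ℝ) + 1) * (X (s + (1 / ((k:ℝ) + 1)) • v) ω - X s ω) +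
      ((k:ℝ) + 1) * (X (s' + (1 / ((k:ℝ) + 1)) • w) ω - X s' ω)) ∂P =
      Real.exp (-(1/2) * ∫ l, ((C k l) ^ 2 + (S k l) ^ 2) ∂ν) := by
    intro k
    have := hν 4 ![s + (1 / ((k:ℝ) + 1)) • v, s, s' + (1 / ((k:ℝ) + 1)) • w, s']
      ![(k:ℝ) + 1, -((k:ℝ) + 1), (k:ℝ) + 1, -((k:ℝ) + 1)]
    refine (Eq.trans ?_ this).trans ?_
    · refine integral_congr_ae (Eventually.of_forall fun ω => ?_)
      simp only [Fin.sum_univ_four, Matrix.cons_val]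
      congr 1; ring
    · congr 2
      refine integral_congr_ae (Eventually.of_forall fun l => ?_)
      simp only [Fin.sum_univ_four, Matrix.cons_val, hC, hS, dotProduct_add, dotProduct_smul, smul_eq_mul]
      ring
  have hbd : ∀ k l, (C k l) ^ 2 + (S k l) ^ 2 ≤ 2 * (|dotProduct l v| + |dotProduct l w|) ^ 2 := by
    intro k l
    have a1 : |C k l| ≤ |dotProduct l v| + |dotProduct l w| :=
      (abs_add_le _ _).trans (add_le_add (cos_diff_bound18 _ _ _) (cos_diff_bound18 _ _ _))
    have a2 : |S k l| ≤ |dotProduct l v| + |dotProduct l w| :=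
      (abs_add_le _ _).trans (add_le_add (sin_diff_bound18 _ _ _) (sin_diff_bound18 _ _ _))
    rw [← sq_abs (C k l), ← sq_abs (S k l)]
    have := pow_le_pow_left₀ (abs_nonneg _) a1 2
    have := pow_le_pow_left₀ (abs_nonneg _) a2 2
    linarith
  have hIntg : ∀ k, Integrable (fun l => (C k l) ^ 2 + (S k l) ^ 2) ν := by
    intro k
    refine Integrable.of_bound (C := 2 * (4 * ((k:ℝ)+1)) ^ 2) ((hCc k).pow 2 |>.add ((hSc k).pow 2)).aestronglyMeasurable
      (Eventually.of_forall fun l => ?_)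
    have key : ∀ x y z u : ℝ, |x| ≤ 1 → |y| ≤ 1 → |z| ≤ 1 → |u| ≤ 1 →
        (((k:ℝ) + 1) * (x - y) + ((k:ℝ) + 1) * (z - u)) ^ 2 ≤ (4 * ((k:ℝ)+1)) ^ 2 := by
      intro x y z u hx hy hz hu
      have hk : (0:ℝ) ≤ (k:ℝ) + 1 := by positivity
      rw [abs_le] at hx hy hz hu
      refine sq_le_sq' ?_ ?_ <;> nlinarith
    rw [Real.norm_of_nonneg (by positivity)]
    have := key _ _ _ _ (Real.abs_cos_le_one (dotProduct l s + (1 / ((k:ℝ) + 1)) * dotProduct l v))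
      (Real.abs_cos_le_one (dotProduct l s)) (Real.abs_cos_le_one (dotProduct l s' + (1 / ((k:ℝ) + 1)) * dotProduct l w))
      (Real.abs_cos_le_one (dotProduct l s'))
    have := key _ _ _ _ (Real.abs_sin_le_one (dotProduct l s + (1 / ((k:ℝ) + 1)) * dotProduct l v))
      (Real.abs_sin_le_one (dotProduct l s)) (Real.abs_sin_le_one (dotProduct l s' + (1 / ((k:ℝ) + 1)) * dotProduct l w))
      (Real.abs_sin_le_one (dotProduct l s'))
    linarith
  have h3 : ∀ k : ℕ, ∫ ω, Real.cos (((k:ℝ) + 1) * (X (s + (1 / ((k:ℝ) + 1)) • v) ω - X s ω) +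
      ((k:ℝ) + 1) * (X (s' + (1 / ((k:ℝ) + 1)) • w) ω - X s' ω)) ∂P ≤
      Real.exp (-(1/2) * ∫ l in Metric.closedBall 0 (R:ℝ), ((C k l) ^ 2 + (S k l) ^ 2) ∂ν) := by
    intro k
    rw [h2 k]
    refine Real.exp_le_exp.2 ?_
    have := setIntegral_le_integral (s := Metric.closedBall (0 : Fin n → ℝ) (R:ℝ)) (hIntg k)
      (Eventually.of_forall fun l => by positivity)
    linarith
  have h4 : Tendsto (fun k : ℕ => ∫ l in Metric.closedBall 0 (R:ℝ), ((C k l) ^ 2 + (S k l) ^ 2) ∂ν) atTop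
      (𝓝 (∫ l in Metric.closedBall 0 (R:ℝ),
        ((dotProduct l v + dotProduct l w * Real.cos (dotProduct l (s' - s))) ^ 2 +
          (dotProduct l w * Real.sin (dotProduct l (s' - s))) ^ 2) ∂ν)) := by
    refine tendsto_integral_of_dominated_convergence
      (fun l => 2 * (|dotProduct l v| + |dotProduct l w|) ^ 2) ?_ ?_ ?_ ?_
    · exact fun k => ((hCc k).pow 2 |>.add ((hSc k).pow 2)).aestronglyMeasurable
    · exact ContinuousOn.integrableOn_compact (isCompact_closedBall _ _) (by fun_prop)
    · refine fun k => Eventually.of_forall fun l => ?_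
      rw [Real.norm_of_nonneg (by positivity)]; exact hbd k l
    · refine Eventually.of_forall fun l => ?_
      have dc : ∀ a b : ℝ, Tendsto (fun k : ℕ => ((k:ℝ) + 1) * (Real.cos (a + (1 / ((k:ℝ) + 1)) * b) - Real.cos a))
          atTop (𝓝 (-(b * Real.sin a))) := by
        intro a b
        have := diffquot18 Real.cos a b Real.differentiableAt_cos
        rw [fderiv_eq_smul_deriv, Real.deriv_cos] at this
        simpa using this
      have ds : ∀ a b : ℝ, Tendsto (fun k : ℕ => ((k:ℝ) + 1) * (Real.sin (a + (1 / ((k:ℝ) + 1)) * b) - Real.sin a))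
          atTop (𝓝 (b * Real.cos a)) := by
        intro a b
        have := diffquot18 Real.sin a b Real.differentiableAt_sin
        rw [fderiv_eq_smul_deriv, Real.deriv_sin] at this
        simpa using this
      have := ((((dc (dotProduct l s) (dotProduct l v)).add (dc (dotProduct l s') (dotProduct l w))).pow 2).add
        (((ds (dotProduct l s) (dotProduct l v)).add (ds (dotProduct l s') (dotProduct l w))).pow 2))
      convert this using 2
      rw [dotProduct_sub, Real.cos_sub, Real.sin_sub]
      have e1 := Real.sin_sq_add_cos_sq (dotProduct l s)
      have e2 := Real.sin_sq_add_cos_sq (dotProduct l s')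
      generalize Real.sin (dotProduct l s) = x1 at *
      generalize Real.cos (dotProduct l s) = y1 at *
      generalize Real.sin (dotProduct l s') = x2 at *
      generalize Real.cos (dotProduct l s') = y2 at *
      generalize dotProduct l v = a
      generalize dotProduct l w = b
      linear_combination (b ^ 2 * (x2 ^ 2 + y2 ^ 2) - a ^ 2) * e1
  have h5 := ((h4.const_mul (-(1/2))).rexp)
  exact le_of_tendsto_of_tendsto' h1 h5 h3

theorem neg_field18 {n : ℕ} {Ω : Type*} [MeasurableSpace Ω] (P : Measure Ω) [IsProbabilityMeasure P]
    (X : (Fin n → ℝ) → Ω → ℝ) (hm : ∀ s, Measurable (X s)) (hd : ∀ ω, Differentiable ℝ fun s => X s ω)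
    (ν : Measure (Fin n → ℝ)) [IsProbabilityMeasure ν]
    (hν : ∀ (k : ℕ) (t : Fin k → (Fin n → ℝ)) (c : Fin k → ℝ),
        ∫ ω, Real.cos (∑ i, c i * X (t i) ω) ∂P =
          Real.exp (-(1/2) * ∫ l, ((∑ i, c i * Real.cos (dotProduct l (t i))) ^ 2 +
            (∑ i, c i * Real.sin (dotProduct l (t i))) ^ 2) ∂ν))
    (hB : ∀ v : Fin n → ℝ, v ≠ 0 → ¬ ∀ᵐ l ∂ν, dotProduct l v = 0) :
    ∃ (R : ℕ) (Λ : Matrix (Fin n) (Fin n) ℝ), Λ.det ≠ 0 ∧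
      ∀ (b b' : Fin n → ℝ) (_ : ∀ i, 0 ≤ b i ∧ b i < 1) (_ : ∀ i, 0 ≤ b' i ∧ b' i < 1),
      ∃ C : ENNReal, C ≠ ⊤ ∧ ∀ s s' : Fin n → ℝ,
        (∀ l : Fin n → ℝ, ‖l‖ ≤ R → |dotProduct l (s' - s)| ≤ 1) →
        ∫⁻ ω, ∏ i, (ENNReal.ofReal |fderiv ℝ (fun t => X t ω) s (fun j => Λ⁻¹ j i)| ^ (-(b i)) *
          ENNReal.ofReal |fderiv ℝ (fun t => X t ω) s' (fun j => Λ⁻¹ j i)| ^ (-(b' i))) ∂P ≤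
        C * ∏ i, ENNReal.ofReal |dotProduct (Λ i) (s' - s)| ^ (-(b' i)) := by
  obtain ⟨R, c, Λ, hc, hΛ, hlow⟩ := spec_lower18 ν hB
  refine ⟨R, Λ, hΛ, fun b b' hb hb' => ?_⟩
  obtain ⟨C, hC, hCb⟩ := neg_moment18 P b b' hb hb' (Real.sqrt c) (Real.sqrt_pos.2 hc)
  refine ⟨C, hC, fun s s' hss => ?_⟩
  have hdm : ∀ s v, Measurable fun ω => fderiv ℝ (fun t => X t ω) s v := fun s v =>
    measurable_of_tendsto_metrizable (f := fun (k : ℕ) ω => ((k:ℝ) + 1) * (X (s + (1 / ((k:ℝ) + 1)) • v) ω - X s ω))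
      (fun k => ((hm _).sub (hm _)).const_mul _)
      (tendsto_pi_nhds.2 fun ω => diffquot18 (fun t => X t ω) s v (hd ω s))
  refine hCb (fun i ω => fderiv ℝ (fun t => X t ω) s (fun j => Λ⁻¹ j i))
    (fun i ω => fderiv ℝ (fun t => X t ω) s' (fun j => Λ⁻¹ j i)) (fun i => hdm _ _) (fun i => hdm _ _)
    (fun i => dotProduct (Λ i) (s' - s)) fun v w => ?_
  have hinv : Λ * Λ⁻¹ = 1 := Matrix.mul_nonsing_inv _ (isUnit_iff_ne_zero.2 hΛ)
  have hdual : ∀ (x : Fin n → ℝ) i, dotProduct (Λ i) (Λ⁻¹.mulVec x) = x i := by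
    intro x i
    have : Λ.mulVec (Λ⁻¹.mulVec x) = x := by rw [Matrix.mulVec_mulVec, hinv, Matrix.one_mulVec]
    exact congrFun this i
  have hlin : ∀ (L : (Fin n → ℝ) →L[ℝ] ℝ) (x : Fin n → ℝ), ∑ i, x i * L (fun j => Λ⁻¹ j i) = L (Λ⁻¹.mulVec x) := by
    intro L x
    have : Λ⁻¹.mulVec x = ∑ i, x i • (fun j => Λ⁻¹ j i) := by
      ext j; simp [Matrix.mulVec, dotProduct, mul_comm]
    rw [this, map_sum]; simp
  have h1 := grad_cf18 P X hm hd ν hν R s s' (Λ⁻¹.mulVec v) (Λ⁻¹.mulVec w)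
  have h2 := hlow (Λ⁻¹.mulVec v) (Λ⁻¹.mulVec w) (s' - s) hss
  simp only [hdual] at h2
  simp only [Finset.sum_add_distrib (f := fun i => v i * _), hlin]
  refine h1.trans (Real.exp_le_exp.2 ?_)
  rw [Real.sq_sqrt hc.le]
  simp only [mul_pow] at h2
  simp only [mul_pow]
  linarith

theorem caseA18 {n : ℕ} {Ω : Type*} [MeasurableSpace Ω] (P : Measure Ω) [IsProbabilityMeasure P]
    (X : (Fin n → ℝ) → Ω → ℝ) (hX : GF18 P X) (hd : ∀ ω, ContDiff ℝ 2 fun s => X s ω)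
    (ν : Measure (Fin n → ℝ)) [IsProbabilityMeasure ν]
    (hν : ∀ (k : ℕ) (t : Fin k → (Fin n → ℝ)) (c : Fin k → ℝ),
        ∫ ω, Real.cos (∑ i, c i * X (t i) ω) ∂P =
          Real.exp (-(1/2) * ∫ l, ((∑ i, c i * Real.cos (dotProduct l (t i))) ^ 2 +
            (∑ i, c i * Real.sin (dotProduct l (t i))) ^ 2) ∂ν))
    (v : Fin n → ℝ) (hv : v ≠ 0) (hA : ∀ᵐ l ∂ν, dotProduct l v = 0) :
    ∀ᵐ ω ∂P, ∀ s, (hessian18 (fun t => X t ω) s).det = 0 := by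
  obtain ⟨hm, hG, hS⟩ := hX
  have h1 : ∀ (s : Fin n → ℝ) (h : ℝ), ∀ᵐ ω ∂P, X (s + h • v) ω = X s ω := by
    intro s h
    have hc := hν 2 ![s + h • v, s] ![1, -1]
    obtain ⟨u, hu⟩ := hG 2 ![s + h • v, s] ![1, -1]
    obtain ⟨f1, f2, f3⟩ := gauss_facts18 P _ (Finset.measurable_sum _ fun i _ => (hm _).const_mul _) u hu
    rw [f3] at hc
    have hz : ∫ l, ((∑ i, (![1, -1] : Fin 2 → ℝ) i * Real.cos (dotProduct l ((![s + h • v, s] : Fin 2 → Fin n → ℝ) i))) ^ 2 +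
            (∑ i, (![1, -1] : Fin 2 → ℝ) i * Real.sin (dotProduct l ((![s + h • v, s] : Fin 2 → Fin n → ℝ) i))) ^ 2) ∂ν = 0 := by
      rw [← integral_zero (Fin n → ℝ) ℝ (μ := ν)]
      refine integral_congr_ae ?_
      filter_upwards [hA] with l hl
      simp [Fin.sum_univ_two, dotProduct_add, dotProduct_smul, hl]
    rw [hz] at hc
    have hu0 : (u:ℝ) = 0 := by
      have := Real.exp_injective hc; linarith
    rw [hu0] at f2
    have := (integral_eq_zero_iff_of_nonneg (fun ω => sq_nonneg _) f1.integrable_sq).1 f2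
    filter_upwards [this] with ω hω
    have h0 := pow_eq_zero_iff (two_ne_zero) |>.1 hω
    simp [Fin.sum_univ_two] at h0
    linarith
  have h2 : ∀ᵐ ω ∂P, ∀ (p : ℕ) (q : ℚ), X (TopologicalSpace.denseSeq (Fin n → ℝ) p + (q:ℝ) • v) ω =
      X (TopologicalSpace.denseSeq (Fin n → ℝ) p) ω :=
    ae_all_iff.2 fun p => ae_all_iff.2 fun q => h1 _ _
  filter_upwards [h2] with ω hω
  have hc : Continuous fun s => X s ω := (hd ω).continuous
  have h3 : ∀ (s : Fin n → ℝ) (h : ℝ), X (s + h • v) ω = X s ω := by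
    have hdr : DenseRange (Prod.map (TopologicalSpace.denseSeq (Fin n → ℝ)) (fun q : ℚ => (q:ℝ))) :=
      (TopologicalSpace.denseRange_denseSeq _).prodMap Rat.denseRange_cast
    have he : (fun z : (Fin n → ℝ) × ℝ => X (z.1 + z.2 • v) ω) = fun z => X z.1 ω := by
      refine hdr.equalizer (hc.comp (by fun_prop)) (hc.comp (by fun_prop)) ?_
      ext z; exact hω z.1 z.2
    intro s h; exact congrFun he (s, h)
  have hdiff : Differentiable ℝ fun s => X s ω := (hd ω).differentiable (by norm_num)
  have h4 : ∀ t, fderiv ℝ (fun s => X s ω) t v = 0 := by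
    intro t
    refine tendsto_nhds_unique (diffquot18 _ t v (hdiff t)) ?_
    simp [h3]
  intro s
  have hpd : ∀ j, Differentiable ℝ fun t => fderiv ℝ (fun s => X s ω) t (Pi.single j 1) := by
    intro j
    have : ContDiff ℝ 1 (fderiv ℝ fun s => X s ω) := (hd ω).fderiv_right (by norm_num)
    exact (this.differentiable (by norm_num)).clm_apply (differentiable_const _)
  rw [← Matrix.exists_mulVec_eq_zero_iff]
  refine ⟨v, hv, ?_⟩
  ext i
  have e : (fun t => ∑ j, fderiv ℝ (fun s => X s ω) t (Pi.single j 1) * v j) = fun _ => 0 := by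
    ext t
    rw [← h4 t]
    conv_rhs => rw [← Finset.univ_sum_single v]
    rw [map_sum]
    refine Finset.sum_congr rfl fun j _ => ?_
    rw [mul_comm, ← smul_eq_mul, ← map_smul, ← Pi.single_smul, smul_eq_mul, mul_one]
  have e2 := congrArg (fun g => fderiv ℝ g s (Pi.single i 1)) e
  simp only [fderiv_fun_const, Pi.zero_apply, ContinuousLinearMap.zero_apply] at e2
  rw [fderiv_fun_sum (fun j _ => ((hpd j) s).mul_const _)] at e2
  rw [ContinuousLinearMap.sum_apply] at e2
  simp only [Matrix.mulVec, dotProduct, hessian18, Matrix.of_apply, Pi.zero_apply]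
  rw [← e2]
  refine Finset.sum_congr rfl fun j _ => ?_
  rw [fderiv_mul_const ((hpd j) s)]
  simp [mul_comm]

end

section
open MeasureTheory Filter Topology

noncomputable def detC18 (n : ℕ) : ContinuousMultilinearMap ℝ (fun _ : Fin n => Fin n → ℝ) ℝ :=
  { (Matrix.detRowAlternating (n := Fin n) (R := ℝ)).toMultilinearMap with
    cont := by
      have : Continuous fun M : Matrix (Fin n) (Fin n) ℝ => M.det := Continuous.matrix_det continuous_id
      exact this }

theorem detC18_apply {n : ℕ} (M : Fin n → Fin n → ℝ) : detC18 n M = Matrix.det (Matrix.of M) := rfl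

theorem sum_det18 {n : ℕ} (J A : Matrix (Fin n) (Fin n) ℝ) :
    ∑ j, (J.updateRow j (A.mulVec (J j))).det = A.trace * J.det := by
  have h : ∀ j, (J.updateRow j (A.mulVec (J j))).det = ∑ k, J.adjugate k j * (J * A.transpose) j k := by
    intro j
    rw [← Matrix.cramer_transpose_apply, Matrix.cramer_eq_adjugate_mulVec, ← Matrix.adjugate_transpose]
    simp only [Matrix.mulVec, dotProduct, Matrix.transpose_apply, Matrix.mul_apply]
    exact Finset.sum_congr rfl fun k _ => by
      congr 1; exact Finset.sum_congr rfl fun l _ => mul_comm _ _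
  simp_rw [h]
  rw [Finset.sum_comm]
  have : (J.adjugate * (J * A.transpose)).trace = ∑ k, ∑ j, J.adjugate k j * (J * A.transpose) j k := by
    simp only [Matrix.trace, Matrix.diag, Matrix.mul_apply (M := J.adjugate)]
  rw [← this, ← Matrix.mul_assoc, Matrix.adjugate_mul, Matrix.smul_mul, Matrix.one_mul,
    Matrix.trace_smul, Matrix.trace_transpose, smul_eq_mul, mul_comm]

theorem antisymm18 {n : ℕ} (J : Fin n → Fin n → ℝ) (w : Fin n → ℝ) (Q : Fin n → Fin n → Fin n → ℝ)
    (hQ : ∀ j k, Q j k = Q k j) :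
    ∑ j, ∑ k ∈ Finset.univ.erase j, detC18 n (Function.update (Function.update J j w) k (Q k j)) = 0 := by
  have hs : ∀ j k, j ≠ k → detC18 n (Function.update (Function.update J j w) k (Q k j)) =
      - detC18 n (Function.update (Function.update J k w) j (Q j k)) := by
    intro j k hjk
    have := (Matrix.detRowAlternating (n := Fin n) (R := ℝ)).map_swap
      (Function.update (Function.update J k w) j (Q j k)) hjk
    have e : (Function.update (Function.update J k w) j (Q j k)) ∘ (Equiv.swap j k) =
        Function.update (Function.update J j w) k (Q k j) := by
      ext i
      simp only [Function.comp]
      by_cases hij : i = j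
      · subst hij
        rw [Equiv.swap_apply_left]
        simp [Function.update_apply, hjk, hjk.symm]
      · by_cases hik : i = k
        · subst hik
          rw [Equiv.swap_apply_right]
          simp [Function.update_apply, hQ]
        · rw [Equiv.swap_apply_of_ne_of_ne hij hik]
          simp [Function.update_apply, hij, hik]
    rw [e] at this
    exact this
  have h1 : ∀ j, ∑ k ∈ Finset.univ.erase j, detC18 n (Function.update (Function.update J j w) k (Q k j)) =
      ∑ k, if j = k then 0 else detC18 n (Function.update (Function.update J j w) k (Q k j)) := by
    intro j
    rw [← Finset.add_sum_erase Finset.univ _ (Finset.mem_univ j)]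
    simp only [if_true, zero_add]
    refine Finset.sum_congr rfl fun k hk => ?_
    rw [if_neg (Finset.ne_of_mem_erase hk).symm]
  simp_rw [h1]
  set S := ∑ j, ∑ k, if j = k then (0:ℝ) else detC18 n (Function.update (Function.update J j w) k (Q k j)) with hS
  have h2 : S = -S := by
    conv_lhs => rw [hS, Finset.sum_comm]
    rw [hS, ← Finset.sum_neg_distrib]
    refine Finset.sum_congr rfl fun j _ => ?_
    rw [← Finset.sum_neg_distrib]
    refine Finset.sum_congr rfl fun k _ => ?_
    by_cases h : j = k
    · simp [h]
    · rw [if_neg h, if_neg (Ne.symm h), hs k j (Ne.symm h)]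
  linarith

theorem piola18 {n : ℕ} (f : (Fin n → ℝ) → ℝ) (f' : (Fin n → ℝ) →L[ℝ] ℝ) (x : Fin n → ℝ)
    (hf : HasFDerivAt f f' x)
    (J : Fin n → (Fin n → ℝ) → Fin n → ℝ) (J' : Fin n → (Fin n → ℝ) →L[ℝ] (Fin n → ℝ))
    (hJ : ∀ i, HasFDerivAt (J i) (J' i) x)
    (hsym : ∀ i j, J' i (Pi.single j 1) = J' j (Pi.single i 1))
    (W : (Fin n → ℝ) → Fin n → ℝ) (W' : (Fin n → ℝ) →L[ℝ] (Fin n → ℝ)) (hW : HasFDerivAt W W' x)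
    (A : Matrix (Fin n) (Fin n) ℝ) (hA : ∀ j, W' (Pi.single j 1) = A.mulVec (J j x)) :
    ∃ T' : Fin n → (Fin n → ℝ) →L[ℝ] ℝ,
      (∀ j, HasFDerivAt (fun y => f y * ((Matrix.of fun i => J i y).updateRow j (W y)).det) (T' j) x) ∧
      ∑ j, T' j (Pi.single j 1) =
        ∑ j, f' (Pi.single j 1) * ((Matrix.of fun i => J i x).updateRow j (W x)).det +
          f x * (A.trace * (Matrix.of fun i => J i x).det) := by
  have hg : ∀ j i, HasFDerivAt (fun y => Function.update (fun i => J i y) j (W y) i)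
      (Function.update J' j W' i) x := by
    intro j i
    by_cases h : i = j
    · subst h; simpa using hW
    · simpa [Function.update_apply, h] using hJ i
  have hD : ∀ j, HasFDerivAt (fun y => ((Matrix.of fun i => J i y).updateRow j (W y)).det) _ x :=
    fun j => HasFDerivAt.multilinear_comp (detC18 n) (hg j)
  refine ⟨_, fun j => hf.mul (hD j), ?_⟩
  have key : ∀ j, (∑ i, (detC18 n).toContinuousLinearMap (fun k => Function.update (fun i => J i x) j (W x) k) i ∘L
      Function.update J' j W' i) (Pi.single j 1) =
      ((Matrix.of fun i => J i x).updateRow j (A.mulVec (J j x))).det +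
      ∑ k ∈ Finset.univ.erase j, detC18 n (Function.update (Function.update (fun i => J i x) j (W x)) k (J' k (Pi.single j 1))) := by
    intro j
    rw [ContinuousLinearMap.sum_apply, ← Finset.add_sum_erase Finset.univ _ (Finset.mem_univ j)]
    congr 1
    · simp only [ContinuousLinearMap.comp_apply, Function.update_self, hA]
      change detC18 n (Function.update (Function.update (fun i => J i x) j (W x)) j _) = _
      rw [Function.update_idem]; rfl
    · refine Finset.sum_congr rfl fun k hk => ?_
      rw [ContinuousLinearMap.comp_apply, Function.update_of_ne (Finset.ne_of_mem_erase hk)]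
      rfl
  have hsp : ∀ (a b : ℝ) (L M : (Fin n → ℝ) →L[ℝ] ℝ) (v : Fin n → ℝ), (a • L + b • M) v = a * L v + b * M v :=
    fun a b L M v => rfl
  simp only [hsp]
  rw [Finset.sum_add_distrib, add_comm]
  congr 1
  · exact Finset.sum_congr rfl fun j _ => mul_comm _ _
  · rw [← Finset.mul_sum]
    congr 1
    refine (Finset.sum_congr rfl fun j _ => key j).trans ?_
    rw [Finset.sum_add_distrib, antisymm18 (fun i => J i x) (W x) (fun k j => J' k (Pi.single j 1)) (fun j k => hsym j k),
      add_zero]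
    exact sum_det18 (Matrix.of fun i => J i x) A

end

section
open MeasureTheory Filter Topology

noncomputable def rg18 (N : ℕ) (b : ℝ) : ℝ := ∫ r in (0:ℝ)..1, r ^ N * Real.exp (-b * r ^ 2)
noncomputable def rgd18 (N : ℕ) (b : ℝ) : ℝ := ∫ r in (0:ℝ)..1, r ^ N * (-(r ^ 2) * Real.exp (-b * r ^ 2))

theorem rg18_deriv (N : ℕ) (b : ℝ) : HasDerivAt (rg18 N) (rgd18 N b) b := by
  refine (intervalIntegral.hasDerivAt_integral_of_dominated_loc_of_deriv_le
    (F := fun b r => r ^ N * Real.exp (-b * r ^ 2))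
    (F' := fun b r => r ^ N * (-(r ^ 2) * Real.exp (-b * r ^ 2))) (s := Metric.ball b 1)
    (bound := fun _ => Real.exp (|b| + 1)) (Metric.ball_mem_nhds _ one_pos) ?_ ?_ ?_ ?_ ?_ ?_).2
  · exact Eventually.of_forall fun x => Continuous.aestronglyMeasurable (by fun_prop)
  · exact Continuous.intervalIntegrable (by fun_prop) _ _
  · exact Continuous.aestronglyMeasurable (by fun_prop)
  · refine Eventually.of_forall fun r hr x hx => ?_
    rw [Set.uIoc_of_le zero_le_one] at hr
    have hr0 := hr.1.le
    have hx' : |x| ≤ |b| + 1 := by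
      have : |x - b| < 1 := hx
      have := abs_sub_abs_le_abs_sub x b
      linarith
    have hr2 : r ^ 2 ≤ 1 := pow_le_one₀ hr0 hr.2
    rw [norm_mul, norm_mul, norm_neg, Real.norm_of_nonneg (by positivity), Real.norm_of_nonneg (by positivity),
      Real.norm_of_nonneg (by positivity)]
    calc r ^ N * (r ^ 2 * Real.exp (-x * r ^ 2)) ≤ 1 * (1 * Real.exp (|b| + 1)) := by
          gcongr
          · exact pow_le_one₀ hr0 hr.2
          · have := neg_abs_le x
            nlinarith [abs_nonneg x, sq_nonneg r]
      _ = _ := by ring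
  · simp
  · refine Eventually.of_forall fun r hr x hx => ?_
    have : HasDerivAt (fun x : ℝ => -x * r ^ 2) (-(r ^ 2)) x := by
      simpa using ((hasDerivAt_id x).neg.mul_const (r ^ 2))
    have := (this.exp).const_mul (r ^ N)
    refine this.congr_deriv ?_; ring

theorem rg18_ode (N : ℕ) (b : ℝ) : ((N:ℝ) + 1) * rg18 N b + 2 * b * rgd18 N b = Real.exp (-b) := by
  have h : ∀ r ∈ Set.uIcc (0:ℝ) 1, HasDerivAt (fun r : ℝ => r ^ (N + 1) * Real.exp (-b * r ^ 2))
      (((N:ℝ) + 1) * (r ^ N * Real.exp (-b * r ^ 2)) +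
        2 * b * (r ^ N * (-(r ^ 2) * Real.exp (-b * r ^ 2)))) r := by
    intro r _
    have h1 := (hasDerivAt_pow (N + 1) r)
    have h2 : HasDerivAt (fun r : ℝ => -b * r ^ 2) (-b * (2 * r)) r := by
      simpa using (hasDerivAt_pow 2 r).const_mul (-b)
    have := h1.mul h2.exp
    refine this.congr_deriv ?_
    have e : N + 1 - 1 = N := by omega
    rw [e]; push_cast; ring
  have h2 := intervalIntegral.integral_eq_sub_of_hasDerivAt h (Continuous.intervalIntegrable (by fun_prop) _ _)
  rw [intervalIntegral.integral_add (Continuous.intervalIntegrable (by fun_prop) _ _)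
    (Continuous.intervalIntegrable (by fun_prop) _ _), intervalIntegral.integral_const_mul,
    intervalIntegral.integral_const_mul] at h2
  rw [rg18, rgd18, h2]
  simp

theorem rg18_nonneg (N : ℕ) (b : ℝ) : 0 ≤ rg18 N b :=
  intervalIntegral.integral_nonneg zero_le_one fun r hr => by
    have := hr.1; positivity

theorem rg18_bound (N : ℕ) (b : ℝ) (hb : 0 < b) :
    rg18 N b ≤ Real.Gamma (((N:ℝ) + 1) / 2) * b ^ (-((N:ℝ) + 1) / 2) := by
  have h := integral_rpow_mul_exp_neg_mul_rpow (p := 2) (q := N) (b := b) two_pos (by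
    have : (0:ℝ) ≤ N := by positivity
    linarith) hb
  have hG : 0 < Real.Gamma (((N:ℝ) + 1) / 2) := Real.Gamma_pos_of_pos (by positivity)
  have hbp : 0 < b ^ (-((N:ℝ) + 1) / 2) := by positivity
  have hne : ∫ x in Set.Ioi (0 : ℝ), x ^ (N:ℝ) * Real.exp (-b * x ^ (2:ℝ)) ≠ 0 := by
    rw [h]; positivity
  have hIntg : IntegrableOn (fun x : ℝ => x ^ (N:ℝ) * Real.exp (-b * x ^ (2:ℝ))) (Set.Ioi 0) :=
    Integrable.of_integral_ne_zero hne
  have h1 : rg18 N b = ∫ x in Set.Ioc (0:ℝ) 1, x ^ (N:ℝ) * Real.exp (-b * x ^ (2:ℝ)) := by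
    rw [rg18, intervalIntegral.integral_of_le zero_le_one]
    refine setIntegral_congr_fun measurableSet_Ioc fun x hx => ?_
    simp [Real.rpow_natCast]
  rw [h1]
  calc _ ≤ ∫ x in Set.Ioi (0 : ℝ), x ^ (N:ℝ) * Real.exp (-b * x ^ (2:ℝ)) := by
        refine setIntegral_mono_set hIntg ?_ (Set.Ioc_subset_Ioi_self.eventuallyLE)
        refine (ae_restrict_iff' measurableSet_Ioi).2 (Eventually.of_forall fun x hx => ?_)
        have : (0:ℝ) < x := hx
        positivity
    _ = _ := h
    _ ≤ _ := by nlinarith [mul_pos hbp hG]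

theorem vfield18 (N : ℕ) : ∃ C : ℝ, 0 ≤ C ∧ ∀ σ : ℝ, 0 < σ →
    ∃ (V : (Fin (N+1) → ℝ) → Fin (N+1) → ℝ) (A : (Fin (N+1) → ℝ) → Matrix (Fin (N+1)) (Fin (N+1)) ℝ),
      Continuous V ∧ (∀ u, HasFDerivAt V (LinearMap.toContinuousLinearMap (Matrix.toLin' (A u))) u) ∧
      (∀ u, (A u).trace = gaussKernel18 σ u) ∧
      (∀ u i, |V u i| ≤ C * (∑ i, u i ^ 2) ^ (-(N:ℝ) / 2)) := by
  refine ⟨Real.Gamma (((N:ℝ) + 1) / 2) * Real.pi ^ (-((N:ℝ) + 1) / 2), ?_, fun σ hσ => ?_⟩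
  · have hG : 0 < Real.Gamma (((N:ℝ) + 1) / 2) := Real.Gamma_pos_of_pos (by positivity)
    positivity
  set K : ℝ := (2 * Real.pi * σ ^ 2) ^ (-((N + 1 : ℕ) : ℝ) / 2) with hK
  set c : ℝ := 1 / (2 * σ ^ 2) with hc
  have hc0 : 0 < c := by positivity
  have hK0 : 0 < K := by positivity
  set q : (Fin (N+1) → ℝ) → ℝ := fun u => ∑ i, u i ^ 2 with hq
  have hqd : ∀ u, HasFDerivAt q (∑ i, (2 * u i) • ContinuousLinearMap.proj (R := ℝ) (φ := fun _ : Fin (N+1) => ℝ) i) u := by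
    intro u
    have : ∀ i : Fin (N+1), HasFDerivAt (fun u : Fin (N+1) → ℝ => u i ^ 2)
        ((2 * u i) • ContinuousLinearMap.proj (R := ℝ) (φ := fun _ : Fin (N+1) => ℝ) i) u := by
      intro i
      have h := (hasFDerivAt_apply (𝕜 := ℝ) i u).pow 2
      simpa using h
    exact HasFDerivAt.fun_sum fun i _ => this i
  set V : (Fin (N+1) → ℝ) → Fin (N+1) → ℝ := fun u i => K * rg18 N (c * q u) * u i with hV
  set A : (Fin (N+1) → ℝ) → Matrix (Fin (N+1)) (Fin (N+1)) ℝ := fun u =>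
    (K * rg18 N (c * q u)) • 1 + (K * rgd18 N (c * q u) * (2 * c)) • Matrix.vecMulVec u u with hA
  have hVd : ∀ u, HasFDerivAt V (LinearMap.toContinuousLinearMap (Matrix.toLin' (A u))) u := by
    intro u
    rw [hasFDerivAt_pi']
    intro i
    have h0 : HasFDerivAt (fun u => rg18 N (c * q u)) _ u :=
      HasDerivAt.comp_hasFDerivAt (h₂ := rg18 N) u (rg18_deriv N (c * q u)) ((hqd u).const_mul c)
    have h1 := h0.const_mul K
    have h2 := h1.mul (hasFDerivAt_apply (𝕜 := ℝ) i u)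
    refine h2.congr_fderiv ?_
    ext v
    simp [hA, Matrix.add_mulVec, Matrix.smul_mulVec, Matrix.vecMulVec_mulVec, dotProduct, Finset.mul_sum]
    refine Finset.sum_congr rfl fun j _ => by ring
  refine ⟨V, A, ?_, hVd, ?_, ?_⟩
  · exact continuous_iff_continuousAt.2 fun u => (hVd u).continuousAt
  · intro u
    have ode := rg18_ode N (c * q u)
    have ht : (Matrix.vecMulVec u u).trace = q u := by
      simp [Matrix.trace, Matrix.vecMulVec_apply, hq, sq]
    simp only [hA, Matrix.trace_add, Matrix.trace_smul, Matrix.trace_one, ht, smul_eq_mul, Fintype.card_fin]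
    rw [gaussKernel18]
    have : Real.exp (-(∑ i, u i ^ 2) / (2 * σ ^ 2)) = Real.exp (-(c * q u)) := by
      congr 1; rw [hc, hq]; ring
    rw [this, ← ode, ← hK]; push_cast; ring
  · intro u i
    have hq0 : 0 ≤ q u := Finset.sum_nonneg fun i _ => sq_nonneg _
    rcases hq0.eq_or_lt with h0 | hpos
    · have : u i = 0 := by
        have := (Finset.sum_eq_zero_iff_of_nonneg (fun i _ => sq_nonneg (u i))).1 h0.symm i (Finset.mem_univ _)
        simpa using this
      have hG : 0 < Real.Gamma (((N:ℝ) + 1) / 2) := Real.Gamma_pos_of_pos (by positivity)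
      have : V u i = 0 := by simp [hV, this]
      rw [this, abs_zero]; positivity
    · have hG : 0 < Real.Gamma (((N:ℝ) + 1) / 2) := Real.Gamma_pos_of_pos (by positivity)
      have hui : |u i| ≤ (q u) ^ ((1:ℝ)/2) := by
        rw [← Real.sqrt_eq_rpow]
        refine Real.abs_le_sqrt ?_
        exact Finset.single_le_sum (f := fun i => u i ^ 2) (fun i _ => sq_nonneg _) (Finset.mem_univ i)
      have hb := rg18_bound N (c * q u) (by positivity)
      have hn := rg18_nonneg N (c * q u)
      change |K * rg18 N (c * q u) * u i| ≤ _ * (q u) ^ _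
      rw [abs_mul, abs_of_nonneg (by positivity)]
      calc _ ≤ K * (Real.Gamma (((N:ℝ) + 1) / 2) * (c * q u) ^ (-((N:ℝ) + 1) / 2)) * (q u) ^ ((1:ℝ)/2) := by gcongr
        _ = _ := by
          have e1 : (c * q u) ^ (-((N:ℝ) + 1) / 2) = c ^ (-((N:ℝ) + 1) / 2) * (q u) ^ (-((N:ℝ) + 1) / 2) :=
            Real.mul_rpow hc0.le hq0
          have e2 : (q u) ^ (-((N:ℝ) + 1) / 2) * (q u) ^ ((1:ℝ)/2) = (q u) ^ (-(N:ℝ) / 2) := by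
            rw [← Real.rpow_add hpos]; congr 1; ring
          have e3 : K * c ^ (-((N:ℝ) + 1) / 2) = Real.pi ^ (-((N:ℝ) + 1) / 2) := by
            rw [hK]; push_cast
            rw [← Real.mul_rpow (by positivity) (by positivity)]
            congr 1; rw [hc]; field_simp
          rw [e1, ← e2, ← e3]; ring

end

section
open MeasureTheory Filter Topology

theorem contDiff_grad18 {n : ℕ} {f : (Fin n → ℝ) → ℝ} {k : ℕ} (hf : ContDiff ℝ (k + 1 : ℕ) f) (v : Fin n → ℝ) :
    ContDiff ℝ k (fun t => fderiv ℝ f t v) := by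
  have h : ContDiff ℝ k (fderiv ℝ f) := hf.fderiv_right (by push_cast; exact le_rfl)
  exact h.clm_apply contDiff_const

theorem continuous_hess18 {n : ℕ} {f : (Fin n → ℝ) → ℝ} (hf : ContDiff ℝ 2 f) :
    Continuous (gradient18 f) ∧ Continuous (hessian18 f) := by
  have hf' : ContDiff ℝ ((1 + 1 : ℕ)) f := by simpa using hf
  constructor
  · exact continuous_pi fun i => (contDiff_grad18 hf' _).continuous
  · refine continuous_matrix fun i j => ?_
    have := contDiff_grad18 hf' (Pi.single j 1)
    exact (contDiff_grad18 (k := 0) (by simpa using this) _).continuous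

theorem symm18 {n : ℕ} {g : (Fin n → ℝ) → ℝ} (hg : ContDiff ℝ 2 g) (x v w : Fin n → ℝ) :
    fderiv ℝ (fun y => fderiv ℝ g y v) x w = fderiv ℝ (fun y => fderiv ℝ g y w) x v := by
  have h : ContDiff ℝ 1 (fderiv ℝ g) := hg.fderiv_right (by norm_num)
  have hd : DifferentiableAt ℝ (fderiv ℝ g) x := h.differentiable (by norm_num) x
  have e : ∀ v w, fderiv ℝ (fun y => fderiv ℝ g y v) x w = fderiv ℝ (fderiv ℝ g) x w v := by
    intro v w
    rw [fderiv_clm_apply hd (differentiableAt_const _)]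
    simp
  rw [e, e]
  have hs : IsSymmSndFDerivAt ℝ g x := hg.contDiffAt.isSymmSndFDerivAt (by simp)
  exact hs.eq w v

theorem stokes_smooth18 {N : ℕ} (f : (Fin (N+1) → ℝ) → ℝ) (hf : ContDiff ℝ 3 f) (m : ℝ) (hm : 0 < m)
    (V : (Fin (N+1) → ℝ) → Fin (N+1) → ℝ) (A : (Fin (N+1) → ℝ) → Matrix (Fin (N+1)) (Fin (N+1)) ℝ)
    (hVc : Continuous V) (hVd : ∀ u, HasFDerivAt V (LinearMap.toContinuousLinearMap (Matrix.toLin' (A u))) u)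
    (hAc : Continuous fun u => (A u).trace) :
    ∫ x in Set.Icc (fun _ : Fin (N+1) => (0:ℝ)) (fun _ => m),
      (∑ j, gradient18 f x j * ((hessian18 f x).updateRow j (V (gradient18 f x))).det +
        f x * ((A (gradient18 f x)).trace * (hessian18 f x).det)) =
    ∑ j : Fin (N+1), ((∫ y in Set.Icc (fun _ : Fin N => (0:ℝ)) (fun _ => m),
        f (Fin.insertNth j m y) * ((hessian18 f (Fin.insertNth j m y)).updateRow j
          (V (gradient18 f (Fin.insertNth j m y)))).det) -
      ∫ y in Set.Icc (fun _ : Fin N => (0:ℝ)) (fun _ => m),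
        f (Fin.insertNth j 0 y) * ((hessian18 f (Fin.insertNth j 0 y)).updateRow j
          (V (gradient18 f (Fin.insertNth j 0 y)))).det) := by
  have hf2 : ContDiff ℝ 2 f := hf.of_le (by norm_num)
  have hg2 : ∀ v, ContDiff ℝ 2 (fun t => fderiv ℝ f t v) := fun v =>
    contDiff_grad18 (k := 2) (by simpa using hf) v
  have hg1 : ∀ v w, ContDiff ℝ 1 (fun t => fderiv ℝ (fun t => fderiv ℝ f t v) t w) := fun v w =>
    contDiff_grad18 (k := 1) (by simpa using hg2 v) w
  have hex : ∀ x, ∃ T' : Fin (N+1) → (Fin (N+1) → ℝ) →L[ℝ] ℝ,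
      (∀ j, HasFDerivAt (fun y => f y * ((hessian18 f y).updateRow j (V (gradient18 f y))).det) (T' j) x) ∧
      ∑ j, T' j (Pi.single j 1) =
        ∑ j, gradient18 f x j * ((hessian18 f x).updateRow j (V (gradient18 f x))).det +
          f x * ((A (gradient18 f x)).trace * (hessian18 f x).det) := by
    intro x
    have hgr : HasFDerivAt (gradient18 f) (ContinuousLinearMap.pi fun j =>
        fderiv ℝ (fun t => fderiv ℝ f t (Pi.single j 1)) x) x := by
      rw [hasFDerivAt_pi]
      exact fun j => ((hg2 _).differentiable (by norm_num) x).hasFDerivAt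
    exact piola18 f (fderiv ℝ f x) x ((hf.differentiable (by norm_num)) x).hasFDerivAt
      (fun i y => hessian18 f y i)
      (fun i => ContinuousLinearMap.pi fun j =>
        fderiv ℝ (fun y => fderiv ℝ (fun t => fderiv ℝ f t (Pi.single j 1)) y (Pi.single i 1)) x)
      (fun i => by
        rw [hasFDerivAt_pi]
        exact fun j => ((hg1 _ _).differentiable (by norm_num) x).hasFDerivAt)
      (fun i k => by
        ext j
        exact symm18 (hg2 (Pi.single j 1)) x _ _)
      (fun y => V (gradient18 f y)) _ ((hVd (gradient18 f x)).comp x hgr) (A (gradient18 f x))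
      (fun j => by
        rfl)
  choose T' hT' hsum using hex
  obtain ⟨cg, ch⟩ := continuous_hess18 hf2
  have cd : ∀ j, Continuous fun x => ((hessian18 f x).updateRow j (V (gradient18 f x))).det := fun j =>
    Continuous.matrix_det (ch.matrix_updateRow j (hVc.comp cg))
  have hc : Continuous f := hf.continuous
  have := integral_divergence_of_hasFDerivAt_off_countable' (fun _ : Fin (N+1) => (0:ℝ)) (fun _ => m)
    (fun _ => hm.le) (fun j y => f y * ((hessian18 f y).updateRow j (V (gradient18 f y))).det)
    (fun j x => T' x j) ∅ Set.countable_empty (fun j => (hc.mul (cd j)).continuousOn)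
    (fun x _ j => hT' x j) (by
      simp_rw [hsum]
      refine ContinuousOn.integrableOn_compact isCompact_Icc (Continuous.continuousOn ?_)
      have hcd : Continuous fun x => (hessian18 f x).det := Continuous.matrix_det ch
      have := hAc.comp cg
      refine (continuous_finset_sum _ fun j _ => ((continuous_apply j).comp cg).mul (cd j)).add (hc.mul ?_)
      exact this.mul hcd)
  simp_rw [hsum] at this
  exact this

end

section
open MeasureTheory Filter Topology
open scoped Convolution

theorem conv_fderiv18 {n : ℕ} (φ : ContDiffBump (0 : Fin n → ℝ)) (g : (Fin n → ℝ) → ℝ)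
    (hg : ContDiff ℝ 1 g) (hc : HasCompactSupport g) (x v : Fin n → ℝ) :
    fderiv ℝ (φ.normed volume ⋆[ContinuousLinearMap.lsmul ℝ ℝ, volume] g) x v =
      (φ.normed volume ⋆[ContinuousLinearMap.lsmul ℝ ℝ, volume] (fun y => fderiv ℝ g y v)) x := by
  have hl : LocallyIntegrable (φ.normed volume) (volume : Measure (Fin n → ℝ)) :=
    φ.continuous_normed.locallyIntegrable
  have h := hc.hasFDerivAt_convolution_right (ContinuousLinearMap.lsmul ℝ ℝ) hl hg x
  rw [h.fderiv]
  rw [convolution_precompR_apply (ContinuousLinearMap.lsmul ℝ ℝ) hl (hc.fderiv ℝ) (hg.continuous_fderiv (by norm_num)) x v]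

theorem conv_bound18 {n : ℕ} (φ : ContDiffBump (0 : Fin n → ℝ)) (g : (Fin n → ℝ) → ℝ)
    (hg : Continuous g) (M : ℝ) (hM : ∀ x, |g x| ≤ M) (x : Fin n → ℝ) :
    |(φ.normed volume ⋆[ContinuousLinearMap.lsmul ℝ ℝ, volume] g) x| ≤ 3 * M := by
  have := φ.dist_normed_convolution_le (μ := volume) (g := g) (x₀ := x) (ε := 2 * M) hg.aestronglyMeasurable
    (fun y _ => by
      rw [Real.dist_eq]
      have h1 := abs_sub (g y) (g x)
      have := hM y; have := hM x; linarith)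
  rw [Real.dist_eq] at this
  have h1 := hM x
  rw [abs_le] at *
  constructor <;> linarith

theorem bdd18 {n : ℕ} (g : (Fin n → ℝ) → ℝ) (hg : Continuous g) (hc : HasCompactSupport g) :
    ∃ M, ∀ x, |g x| ≤ M := by
  obtain ⟨M, hM⟩ := hc.exists_bound_of_continuous hg
  exact ⟨M, hM⟩

theorem moll18 {n : ℕ} (h : (Fin n → ℝ) → ℝ) (hh : ContDiff ℝ 2 h) (hc : HasCompactSupport h) :
    ∃ (hk : ℕ → (Fin n → ℝ) → ℝ) (M : ℝ), (∀ k, ContDiff ℝ 3 (hk k)) ∧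
      (∀ k x, |hk k x| ≤ M ∧ (∀ i, |gradient18 (hk k) x i| ≤ M) ∧ ∀ i j, |hessian18 (hk k) x i j| ≤ M) ∧
      (∀ x, Tendsto (fun k => hk k x) atTop (𝓝 (h x)) ∧
        Tendsto (fun k => gradient18 (hk k) x) atTop (𝓝 (gradient18 h x)) ∧
        Tendsto (fun k => hessian18 (hk k) x) atTop (𝓝 (hessian18 h x))) := by
  have hg1 : ∀ v, ContDiff ℝ 1 (fun t => fderiv ℝ h t v) := fun v =>
    contDiff_grad18 (k := 1) (by simpa using hh) v
  have hg0 : ∀ v w, Continuous (fun t => fderiv ℝ (fun t => fderiv ℝ h t v) t w) := fun v w =>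
    (contDiff_grad18 (k := 0) (by simpa using hg1 v) w).continuous
  have cap : ∀ g : (Fin n → ℝ) → ℝ, HasCompactSupport g → ∀ v, HasCompactSupport (fun t => fderiv ℝ g t v) := by
    intro g hg v
    exact hg.fderiv_apply ℝ v
  have hc1 := fun v => cap h hc v
  have hc2 := fun v w => cap _ (hc1 v) w
  obtain ⟨M0, hM0⟩ := bdd18 h hh.continuous hc
  choose M1 hM1 using fun i : Fin n => bdd18 _ (hg1 (Pi.single i 1)).continuous (hc1 (Pi.single i 1))
  choose M2 hM2 using fun i j : Fin n => bdd18 _ (hg0 (Pi.single j 1) (Pi.single i 1)) (hc2 (Pi.single j 1) (Pi.single i 1))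
  have p0 : 0 ≤ M0 := (abs_nonneg _).trans (hM0 0)
  have p1 : ∀ i, 0 ≤ M1 i := fun i => (abs_nonneg _).trans (hM1 i 0)
  have p2 : ∀ i j, 0 ≤ M2 i j := fun i j => (abs_nonneg _).trans (hM2 i j 0)
  let φ : ℕ → ContDiffBump (0 : Fin n → ℝ) := fun k =>
    ⟨1 / (2 * ((k:ℝ) + 1)), 1 / ((k:ℝ) + 1), by positivity, by
      have : (0:ℝ) ≤ k := by positivity
      apply one_div_lt_one_div_of_lt (by positivity)
      linarith⟩
  have hφ : Tendsto (fun k => (φ k).rOut) atTop (𝓝 0) := tendsto_one_div_add_atTop_nhds_zero_nat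
  let S := M0 + ∑ i, M1 i + ∑ i, ∑ j, M2 i j
  let hk : ℕ → (Fin n → ℝ) → ℝ := fun k => (φ k).normed volume ⋆[ContinuousLinearMap.lsmul ℝ ℝ, volume] h
  have d1 : ∀ k v, (fun x => fderiv ℝ (hk k) x v) =
      (φ k).normed volume ⋆[ContinuousLinearMap.lsmul ℝ ℝ, volume] (fun y => fderiv ℝ h y v) := by
    intro k v; ext x; exact conv_fderiv18 _ _ (hh.of_le (by norm_num)) hc x v
  have d2 : ∀ k v w, (fun x => fderiv ℝ (fun t => fderiv ℝ (hk k) t v) x w) =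
      (φ k).normed volume ⋆[ContinuousLinearMap.lsmul ℝ ℝ, volume]
        (fun y => fderiv ℝ (fun t => fderiv ℝ h t v) y w) := by
    intro k v w; ext x; rw [d1]; exact conv_fderiv18 _ _ (hg1 v) (hc1 v) x w
  have b1 : ∀ i, M1 i ≤ ∑ i, M1 i := fun i => Finset.single_le_sum (fun i _ => p1 i) (Finset.mem_univ i)
  have b2 : ∀ i j, M2 i j ≤ ∑ i, ∑ j, M2 i j := fun i j =>
    (Finset.single_le_sum (fun j _ => p2 i j) (Finset.mem_univ j)).trans
      (Finset.single_le_sum (f := fun i => ∑ j, M2 i j) (fun i _ => Finset.sum_nonneg fun j _ => p2 i j) (Finset.mem_univ i))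
  have s1 : 0 ≤ ∑ i, M1 i := Finset.sum_nonneg fun i _ => p1 i
  have s2 : 0 ≤ ∑ i, ∑ j, M2 i j := Finset.sum_nonneg fun i _ => Finset.sum_nonneg fun j _ => p2 i j
  refine ⟨hk, 3 * S, fun k => ?_, fun k x => ⟨?_, fun i => ?_, fun i j => ?_⟩, fun x => ⟨?_, ?_, ?_⟩⟩
  · have := (φ k).hasCompactSupport_normed (μ := (volume : Measure (Fin n → ℝ))).contDiff_convolution_left (n := 3)
      (ContinuousLinearMap.lsmul ℝ ℝ) ((φ k).contDiff_normed) hh.continuous.locallyIntegrable (μ := volume)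
    exact this
  · refine (conv_bound18 _ _ hh.continuous M0 hM0 x).trans ?_
    simp only [S]; linarith
  · have := congrFun (d1 k (Pi.single i 1)) x
    simp only [gradient18]; rw [this]
    refine (conv_bound18 _ _ (hg1 _).continuous _ (hM1 i) x).trans ?_
    simp only [S]; linarith [b1 i]
  · have := congrFun (d2 k (Pi.single j 1) (Pi.single i 1)) x
    simp only [hessian18, Matrix.of_apply]; rw [this]
    refine (conv_bound18 _ _ (hg0 _ _) _ (hM2 i j) x).trans ?_
    simp only [S]; linarith [b2 i j]
  · exact ContDiffBump.convolution_tendsto_right_of_continuous hφ hh.continuous x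
  · rw [tendsto_pi_nhds]
    intro i
    have := fun k => congrFun (d1 k (Pi.single i 1)) x
    simp only [gradient18]; simp only [this]
    exact ContDiffBump.convolution_tendsto_right_of_continuous hφ (hg1 _).continuous x
  · refine tendsto_pi_nhds.2 fun i => tendsto_pi_nhds.2 fun j => ?_
    have := fun k => congrFun (d2 k (Pi.single j 1) (Pi.single i 1)) x
    simp only [hessian18, Matrix.of_apply]; simp only [this]
    exact ContDiffBump.convolution_tendsto_right_of_continuous hφ (hg0 _ _) x

end

section
open MeasureTheory Filter Topology

theorem dct18 {n d : ℕ} (h : (Fin n → ℝ) → ℝ) (hh : ContDiff ℝ 2 h) (hk : ℕ → (Fin n → ℝ) → ℝ) (M : ℝ)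
    (h3 : ∀ k, ContDiff ℝ 3 (hk k))
    (hb : ∀ k x, |hk k x| ≤ M ∧ (∀ i, |gradient18 (hk k) x i| ≤ M) ∧ ∀ i j, |hessian18 (hk k) x i j| ≤ M)
    (hl : ∀ x, Tendsto (fun k => hk k x) atTop (𝓝 (h x)) ∧
        Tendsto (fun k => gradient18 (hk k) x) atTop (𝓝 (gradient18 h x)) ∧
        Tendsto (fun k => hessian18 (hk k) x) atTop (𝓝 (hessian18 h x)))
    (Φ : ℝ × (Fin n → ℝ) × Matrix (Fin n) (Fin n) ℝ → ℝ) (hΦ : Continuous Φ)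
    (p : (Fin d → ℝ) → (Fin n → ℝ)) (hp : Continuous p) (m : ℝ) :
    Tendsto (fun k => ∫ y in Set.Icc (fun _ : Fin d => (0:ℝ)) (fun _ => m),
        Φ (hk k (p y), gradient18 (hk k) (p y), hessian18 (hk k) (p y))) atTop
      (𝓝 (∫ y in Set.Icc (fun _ : Fin d => (0:ℝ)) (fun _ => m), Φ (h (p y), gradient18 h (p y), hessian18 h (p y)))) := by
  let K : Set (ℝ × (Fin n → ℝ) × Matrix (Fin n) (Fin n) ℝ) :=
    Set.Icc (-M) M ×ˢ ((Set.univ.pi fun _ => Set.Icc (-M) M) ×ˢ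
      (Set.univ.pi fun _ => Set.univ.pi fun _ => Set.Icc (-M) M : Set (Fin n → Fin n → ℝ)))
  have hK : IsCompact K := isCompact_Icc.prod ((isCompact_univ_pi fun _ => isCompact_Icc).prod
    (isCompact_univ_pi fun _ => isCompact_univ_pi fun _ => isCompact_Icc))
  obtain ⟨B, hB⟩ := hK.exists_bound_of_continuousOn hΦ.continuousOn
  refine tendsto_integral_of_dominated_convergence (fun _ => B) ?_ ?_ ?_ ?_
  · intro k
    obtain ⟨cg, ch⟩ := continuous_hess18 ((h3 k).of_le (by norm_num : (2 : WithTop ℕ∞) ≤ 3))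
    refine Continuous.aestronglyMeasurable ?_
    exact hΦ.comp (((h3 k).continuous.comp hp).prodMk ((cg.comp hp).prodMk (ch.comp hp)))
  · exact integrableOn_const (isCompact_Icc.measure_lt_top.ne)
  · intro k
    refine ae_of_all _ fun y => hB _ ?_
    obtain ⟨a, b, c⟩ := hb k (p y)
    refine ⟨abs_le.1 a, ?_, ?_⟩
    · exact fun i _ => abs_le.1 (b i)
    · exact fun i _ j _ => abs_le.1 (c i j)
  · refine ae_of_all _ fun y => ?_
    obtain ⟨a, b, c⟩ := hl (p y)
    exact (hΦ.tendsto _).comp (a.prodMk_nhds (b.prodMk_nhds c))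

theorem stokes_cpt18 {N : ℕ} (f : (Fin (N+1) → ℝ) → ℝ) (hf : ContDiff ℝ 2 f) (hc : HasCompactSupport f)
    (m : ℝ) (hm : 0 < m)
    (V : (Fin (N+1) → ℝ) → Fin (N+1) → ℝ) (A : (Fin (N+1) → ℝ) → Matrix (Fin (N+1)) (Fin (N+1)) ℝ)
    (hVc : Continuous V) (hVd : ∀ u, HasFDerivAt V (LinearMap.toContinuousLinearMap (Matrix.toLin' (A u))) u)
    (hAc : Continuous fun u => (A u).trace) :
    ∫ x in Set.Icc (fun _ : Fin (N+1) => (0:ℝ)) (fun _ => m),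
      (∑ j, gradient18 f x j * ((hessian18 f x).updateRow j (V (gradient18 f x))).det +
        f x * ((A (gradient18 f x)).trace * (hessian18 f x).det)) =
    ∑ j : Fin (N+1), ((∫ y in Set.Icc (fun _ : Fin N => (0:ℝ)) (fun _ => m),
        f (Fin.insertNth j m y) * ((hessian18 f (Fin.insertNth j m y)).updateRow j
          (V (gradient18 f (Fin.insertNth j m y)))).det) -
      ∫ y in Set.Icc (fun _ : Fin N => (0:ℝ)) (fun _ => m),
        f (Fin.insertNth j 0 y) * ((hessian18 f (Fin.insertNth j 0 y)).updateRow j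
          (V (gradient18 f (Fin.insertNth j 0 y)))).det) := by
  obtain ⟨hk, M, h3, hb, hl⟩ := moll18 f hf hc
  let Φ0 : ℝ × (Fin (N+1) → ℝ) × Matrix (Fin (N+1)) (Fin (N+1)) ℝ → ℝ := fun z =>
    ∑ j, z.2.1 j * (z.2.2.updateRow j (V z.2.1)).det + z.1 * ((A z.2.1).trace * z.2.2.det)
  let Φ1 : Fin (N+1) → ℝ × (Fin (N+1) → ℝ) × Matrix (Fin (N+1)) (Fin (N+1)) ℝ → ℝ := fun j z =>
    z.1 * (z.2.2.updateRow j (V z.2.1)).det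
  have cd : ∀ j, Continuous fun z : ℝ × (Fin (N+1) → ℝ) × Matrix (Fin (N+1)) (Fin (N+1)) ℝ =>
      (z.2.2.updateRow j (V z.2.1)).det := fun j =>
    Continuous.matrix_det ((continuous_snd.comp continuous_snd).matrix_updateRow j
      (hVc.comp (continuous_fst.comp continuous_snd)))
  have c0 : Continuous Φ0 := by
    refine (continuous_finset_sum _ fun j _ => Continuous.mul ?_ (cd j)).add (continuous_fst.mul ?_)
    · exact (continuous_apply j).comp (continuous_fst.comp continuous_snd)
    · exact (hAc.comp (continuous_fst.comp continuous_snd)).mul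
        (Continuous.matrix_det (continuous_snd.comp continuous_snd))
  have c1 : ∀ j, Continuous (Φ1 j) := fun j => continuous_fst.mul (cd j)
  have t0 := dct18 f hf hk M h3 hb hl Φ0 c0 id continuous_id m
  have ci : ∀ (j : Fin (N+1)) (c : ℝ), Continuous fun y : Fin N → ℝ => (Fin.insertNth j c y : Fin (N+1) → ℝ) := by
    intro j c
    exact Continuous.finInsertNth j continuous_const continuous_id
  have t1 := fun j c => dct18 f hf hk M h3 hb hl (Φ1 j) (c1 j) (fun y : Fin N → ℝ => Fin.insertNth j c y) (ci j c) m
  have t2 := tendsto_finset_sum Finset.univ fun j (_ : j ∈ Finset.univ) => (t1 j m).sub (t1 j 0)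
  have he := fun k => stokes_smooth18 (hk k) (h3 k) m hm V A hVc hVd hAc
  refine tendsto_nhds_unique t0 (t2.congr fun k => ?_)
  exact (he k).symm

noncomputable def S18 {n : ℕ} (f : (Fin n → ℝ) → ℝ) (x : Fin n → ℝ) : ℝ :=
  |f x| + ∑ i, |gradient18 f x i| + ∑ i, ∑ j, |hessian18 f x i j|

noncomputable def Psi18 {N : ℕ} (f : (Fin (N+1) → ℝ) → ℝ) (x : Fin (N+1) → ℝ) : ENNReal :=
  ENNReal.ofReal (1 + S18 f x) ^ (N + 2) *
    ENNReal.ofReal (∑ i, gradient18 f x i ^ 2) ^ (-(N:ℝ)/2)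

theorem det_bound18 {N : ℕ} (H : Matrix (Fin (N+1)) (Fin (N+1)) ℝ) (v : Fin (N+1) → ℝ) (W h : ℝ)
    (hW : ∀ i, |v i| ≤ W) (hH : ∀ i j, |H i j| ≤ h) (j : Fin (N+1)) :
    |(H.updateRow j v).det| ≤ (N+1).factorial * (W * h ^ N) := by
  rw [Matrix.det_apply]
  refine (Finset.abs_sum_le_sum_abs _ _).trans ?_
  have : ∀ σ ∈ (Finset.univ : Finset (Equiv.Perm (Fin (N+1)))),
      |Equiv.Perm.sign σ • ∏ i, H.updateRow j v (σ i) i| ≤ W * h ^ N := by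
    intro σ _
    have e1 : |Equiv.Perm.sign σ • ∏ i, H.updateRow j v (σ i) i| = ∏ i, |H.updateRow j v (σ i) i| := by
      rw [← Finset.abs_prod]
      rcases Int.units_eq_one_or (Equiv.Perm.sign σ) with h | h <;> simp [h]
    rw [e1]
    calc ∏ i, |H.updateRow j v (σ i) i| ≤ ∏ i, (if σ i = j then W else h) := by
          refine Finset.prod_le_prod (fun _ _ => abs_nonneg _) fun i _ => ?_
          by_cases hi : σ i = j
          · simp [hi, hW]
          · simp [hi, hH]
      _ = ∏ i, (if i = j then W else h) := Equiv.prod_comp σ (fun i => if i = j then W else h)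
      _ = W * h ^ N := by
          rw [Fin.prod_univ_succAbove _ j]
          simp [Fin.succAbove_ne]
  refine (Finset.sum_le_sum this).trans ?_
  simp [Fintype.card_perm]

theorem S18_nonneg {n : ℕ} (f : (Fin n → ℝ) → ℝ) (x : Fin n → ℝ) : 0 ≤ S18 f x := by
  unfold S18; positivity

theorem S18_f {n : ℕ} (f : (Fin n → ℝ) → ℝ) (x : Fin n → ℝ) : |f x| ≤ S18 f x := by
  unfold S18
  have : 0 ≤ ∑ i, |gradient18 f x i| := by positivity
  have : 0 ≤ ∑ i, ∑ j, |hessian18 f x i j| := by positivity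
  linarith

theorem S18_g {n : ℕ} (f : (Fin n → ℝ) → ℝ) (x : Fin n → ℝ) (i : Fin n) : |gradient18 f x i| ≤ S18 f x := by
  unfold S18
  have : |gradient18 f x i| ≤ ∑ i, |gradient18 f x i| :=
    Finset.single_le_sum (f := fun i => |gradient18 f x i|) (fun i _ => abs_nonneg _) (Finset.mem_univ i)
  have : 0 ≤ ∑ i, ∑ j, |hessian18 f x i j| := by positivity
  have := abs_nonneg (f x)
  linarith

theorem S18_h {n : ℕ} (f : (Fin n → ℝ) → ℝ) (x : Fin n → ℝ) (i j : Fin n) : |hessian18 f x i j| ≤ S18 f x := by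
  unfold S18
  have : 0 ≤ ∑ i, |gradient18 f x i| := by positivity
  have h1 : |hessian18 f x i j| ≤ ∑ j, |hessian18 f x i j| :=
    Finset.single_le_sum (f := fun j => |hessian18 f x i j|) (fun i _ => abs_nonneg _) (Finset.mem_univ j)
  have h2 : ∑ j, |hessian18 f x i j| ≤ ∑ i, ∑ j, |hessian18 f x i j| :=
    Finset.single_le_sum (f := fun i => ∑ j, |hessian18 f x i j|) (fun i _ => by positivity) (Finset.mem_univ i)
  have := abs_nonneg (f x)
  linarith

theorem psi_bound18 {N : ℕ} (f : (Fin (N+1) → ℝ) → ℝ) (x : Fin (N+1) → ℝ) (C : ℝ) (hC : 0 ≤ C)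
    (v : Fin (N+1) → ℝ) (hv : ∀ i, |v i| ≤ C * (∑ i, gradient18 f x i ^ 2) ^ (-(N:ℝ)/2))
    (a : ℝ) (ha : |a| ≤ S18 f x) (j : Fin (N+1)) :
    ENNReal.ofReal |a * ((hessian18 f x).updateRow j v).det| ≤
      ENNReal.ofReal ((N+1).factorial * C) * Psi18 f x := by
  have hS := S18_nonneg f x
  have h1 := det_bound18 (hessian18 f x) v _ (1 + S18 f x) hv (fun i j => (S18_h f x i j).trans (by linarith)) j
  have q0 : 0 ≤ ∑ i, gradient18 f x i ^ 2 := by positivity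
  set q := ∑ i, gradient18 f x i ^ 2 with hq
  have h2 : |a * ((hessian18 f x).updateRow j v).det| ≤
      ((N+1).factorial * C) * ((1 + S18 f x) ^ (N + 2) * q ^ (-(N:ℝ)/2)) := by
    rw [abs_mul]
    calc _ ≤ (1 + S18 f x)^2 * ((N+1).factorial * (C * q ^ (-(N:ℝ)/2) * (1 + S18 f x) ^ N)) := by
          refine mul_le_mul ?_ h1 (abs_nonneg _) (by positivity)
          nlinarith
      _ = _ := by ring
  refine (ENNReal.ofReal_le_ofReal h2).trans ?_
  rw [ENNReal.ofReal_mul (p := (N+1).factorial * C) (by positivity), ENNReal.ofReal_mul (p := (1 + S18 f x) ^ (N + 2)) (by positivity), ENNReal.ofReal_pow (by positivity)]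
  unfold Psi18
  gcongr
  rcases q0.eq_or_lt with h | h
  · rw [← hq, ← h]
    rcases Nat.eq_zero_or_pos N with h0 | h0
    · subst h0; simp
    · rw [ENNReal.ofReal_zero, ENNReal.zero_rpow_of_neg]
      · exact le_top
      · have : (0:ℝ) < N := by exact_mod_cast h0
        linarith
  · rw [ENNReal.ofReal_rpow_of_pos h]

theorem continuous_kernel18 {n : ℕ} (σ : ℝ) : Continuous (gaussKernel18 (n := n) σ) := by
  unfold gaussKernel18
  fun_prop

end

section
open MeasureTheory Filter Topology

theorem jet_eq18 {n : ℕ} {f g : (Fin n → ℝ) → ℝ} {U : Set (Fin n → ℝ)} (hU : IsOpen U) (h : Set.EqOn f g U)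
    {x : Fin n → ℝ} (hx : x ∈ U) : f x = g x ∧ gradient18 f x = gradient18 g x ∧ hessian18 f x = hessian18 g x := by
  have e1 : ∀ y ∈ U, fderiv ℝ f y = fderiv ℝ g y := fun y hy =>
    Filter.EventuallyEq.fderiv_eq (h.eventuallyEq_of_mem (hU.mem_nhds hy))
  refine ⟨h hx, ?_, ?_⟩
  · ext i; simp [gradient18, e1 x hx]
  · ext i j
    simp only [hessian18, Matrix.of_apply]
    have : (fun t => fderiv ℝ f t (Pi.single j 1)) =ᶠ[𝓝 x] (fun t => fderiv ℝ g t (Pi.single j 1)) := by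
      filter_upwards [hU.mem_nhds hx] with y hy
      rw [e1 y hy]
    rw [this.fderiv_eq]

theorem stokes_c2_18 {N : ℕ} (f : (Fin (N+1) → ℝ) → ℝ) (hf : ContDiff ℝ 2 f)
    (m : ℝ) (hm : 0 < m)
    (V : (Fin (N+1) → ℝ) → Fin (N+1) → ℝ) (A : (Fin (N+1) → ℝ) → Matrix (Fin (N+1)) (Fin (N+1)) ℝ)
    (hVc : Continuous V) (hVd : ∀ u, HasFDerivAt V (LinearMap.toContinuousLinearMap (Matrix.toLin' (A u))) u)
    (hAc : Continuous fun u => (A u).trace) :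
    ∫ x in Set.Icc (fun _ : Fin (N+1) => (0:ℝ)) (fun _ => m),
      (∑ j, gradient18 f x j * ((hessian18 f x).updateRow j (V (gradient18 f x))).det +
        f x * ((A (gradient18 f x)).trace * (hessian18 f x).det)) =
    ∑ j : Fin (N+1), ((∫ y in Set.Icc (fun _ : Fin N => (0:ℝ)) (fun _ => m),
        f (Fin.insertNth j m y) * ((hessian18 f (Fin.insertNth j m y)).updateRow j
          (V (gradient18 f (Fin.insertNth j m y)))).det) -
      ∫ y in Set.Icc (fun _ : Fin N => (0:ℝ)) (fun _ => m),
        f (Fin.insertNth j 0 y) * ((hessian18 f (Fin.insertNth j 0 y)).updateRow j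
          (V (gradient18 f (Fin.insertNth j 0 y)))).det) := by
  let χ : ContDiffBump (0 : Fin (N+1) → ℝ) := ⟨m + 1, m + 2, by linarith, by linarith⟩
  let g : (Fin (N+1) → ℝ) → ℝ := fun x => χ x * f x
  have hg : ContDiff ℝ 2 g := χ.contDiff.mul hf
  have hgc : HasCompactSupport g := χ.hasCompactSupport.mul_right
  have hE : Set.EqOn f g (Metric.ball 0 (m+1)) := by
    intro x hx
    simp only [g]
    rw [χ.one_of_mem_closedBall (Metric.ball_subset_closedBall hx), one_mul]
  have hj := fun x (hx : x ∈ Metric.ball (0 : Fin (N+1) → ℝ) (m+1)) => jet_eq18 Metric.isOpen_ball hE hx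
  have hbox : ∀ x : Fin (N+1) → ℝ, (∀ i, 0 ≤ x i ∧ x i ≤ m) → x ∈ Metric.ball (0 : Fin (N+1) → ℝ) (m+1) := by
    intro x hx
    rw [mem_ball_zero_iff]
    refine lt_of_le_of_lt ((pi_norm_le_iff_of_nonneg hm.le).2 fun i => ?_) (by linarith : m < m + 1)
    rw [Real.norm_eq_abs, abs_of_nonneg (hx i).1]; exact (hx i).2
  have hins : ∀ (j : Fin (N+1)) (c : ℝ), 0 ≤ c → c ≤ m → ∀ y ∈ Set.Icc (fun _ : Fin N => (0:ℝ)) (fun _ => m),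
      (Fin.insertNth j c y : Fin (N+1) → ℝ) ∈ Metric.ball (0 : Fin (N+1) → ℝ) (m+1) := by
    intro j c h0 h1 y hy
    refine hbox _ ?_
    rw [Fin.forall_iff_succAbove j]
    refine ⟨by simp [h0, h1], fun i => ?_⟩
    simpa using ⟨hy.1 i, hy.2 i⟩
  have key := stokes_cpt18 g hg hgc m hm V A hVc hVd hAc
  have l : ∫ x in Set.Icc (fun _ : Fin (N+1) => (0:ℝ)) (fun _ => m),
      (∑ j, gradient18 f x j * ((hessian18 f x).updateRow j (V (gradient18 f x))).det +
        f x * ((A (gradient18 f x)).trace * (hessian18 f x).det)) =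
      ∫ x in Set.Icc (fun _ : Fin (N+1) => (0:ℝ)) (fun _ => m),
      (∑ j, gradient18 g x j * ((hessian18 g x).updateRow j (V (gradient18 g x))).det +
        g x * ((A (gradient18 g x)).trace * (hessian18 g x).det)) := by
    refine setIntegral_congr_fun measurableSet_Icc fun x hx => ?_
    obtain ⟨a, b, c⟩ := hj x (hbox x fun i => ⟨hx.1 i, hx.2 i⟩)
    simp only [a, b, c]
  have r : ∀ (j : Fin (N+1)) (c : ℝ), 0 ≤ c → c ≤ m → ∫ y in Set.Icc (fun _ : Fin N => (0:ℝ)) (fun _ => m),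
        f (Fin.insertNth j c y) * ((hessian18 f (Fin.insertNth j c y)).updateRow j
          (V (gradient18 f (Fin.insertNth j c y)))).det =
      ∫ y in Set.Icc (fun _ : Fin N => (0:ℝ)) (fun _ => m),
        g (Fin.insertNth j c y) * ((hessian18 g (Fin.insertNth j c y)).updateRow j
          (V (gradient18 g (Fin.insertNth j c y)))).det := by
    intro j c h0 h1
    refine setIntegral_congr_fun measurableSet_Icc fun x hx => ?_
    obtain ⟨a, b, c⟩ := hj _ (hins j c h0 h1 x hx)
    simp only [a, b, c]
  rw [l, key]
  refine Finset.sum_congr rfl fun j _ => ?_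
  rw [r j m hm.le le_rfl, r j 0 le_rfl hm.le]

theorem stokes_bound18 (N : ℕ) : ∃ C : ENNReal, C ≠ ⊤ ∧ ∀ σ > 0, ∀ (f : (Fin (N+1) → ℝ) → ℝ), ContDiff ℝ 2 f →
    ∀ m > 0, ENNReal.ofReal |∫ s in Set.univ.pi fun _ : Fin (N+1) => Set.Ioo (0:ℝ) m,
        gaussKernel18 σ (gradient18 f s) * (hessian18 f s).det * f s| ≤
      C * ((∫⁻ x in Set.Icc (fun _ : Fin (N+1) => (0:ℝ)) (fun _ => m), Psi18 f x) +
        ∑ j : Fin (N+1), ((∫⁻ y in Set.Icc (fun _ : Fin N => (0:ℝ)) (fun _ => m), Psi18 f (Fin.insertNth j m y)) +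
          ∫⁻ y in Set.Icc (fun _ : Fin N => (0:ℝ)) (fun _ => m), Psi18 f (Fin.insertNth j 0 y))) := by
  obtain ⟨C, hC, hV⟩ := vfield18 N
  refine ⟨(N+1) * ENNReal.ofReal ((N+1).factorial * C), ENNReal.mul_ne_top (by finiteness) ENNReal.ofReal_ne_top, ?_⟩
  intro σ hσ f hf m hm
  obtain ⟨V, A, hVc, hVd, hA, hVb⟩ := hV σ hσ
  have hAc : Continuous fun u => (A u).trace := by
    simp_rw [hA]; exact continuous_kernel18 σ
  have st := stokes_c2_18 f hf m hm V A hVc hVd hAc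
  obtain ⟨cg, ch⟩ := continuous_hess18 hf
  have cd : ∀ j, Continuous fun x => ((hessian18 f x).updateRow j (V (gradient18 f x))).det := fun j =>
    Continuous.matrix_det (ch.matrix_updateRow j (hVc.comp cg))
  have hc : Continuous f := hf.continuous
  have hcd : Continuous fun x => (hessian18 f x).det := Continuous.matrix_det ch
  rw [integral_add] at st
  rotate_left
  · refine ContinuousOn.integrableOn_compact isCompact_Icc (Continuous.continuousOn ?_)
    exact continuous_finset_sum _ fun j _ => ((continuous_apply j).comp cg).mul (cd j)
  · refine ContinuousOn.integrableOn_compact isCompact_Icc (Continuous.continuousOn ?_)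
    exact hc.mul ((hAc.comp cg).mul hcd)
  have e0 : ∫ s in Set.univ.pi fun _ : Fin (N+1) => Set.Ioo (0:ℝ) m,
        gaussKernel18 σ (gradient18 f s) * (hessian18 f s).det * f s =
      ∫ x in Set.Icc (fun _ : Fin (N+1) => (0:ℝ)) (fun _ => m),
        f x * ((A (gradient18 f x)).trace * (hessian18 f x).det) := by
    have hae : (Set.univ.pi fun _ : Fin (N+1) => Set.Ioo (0:ℝ) m) =ᵐ[volume]
        Set.Icc (fun _ : Fin (N+1) => (0:ℝ)) (fun _ => m) :=
      Measure.univ_pi_Ioo_ae_eq_Icc (μ := fun _ : Fin (N+1) => (volume : Measure ℝ)) (f := fun _ => 0) (g := fun _ => m)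
    rw [setIntegral_congr_set hae]
    congr 1
    ext x
    rw [hA]; ring
  rw [e0]
  set K := ENNReal.ofReal ((N+1).factorial * C) with hK
  set I0 := ∫ x in Set.Icc (fun _ : Fin (N+1) => (0:ℝ)) (fun _ => m),
      ∑ j, gradient18 f x j * ((hessian18 f x).updateRow j (V (gradient18 f x))).det with hI0
  have bI0 : ENNReal.ofReal |I0| ≤ (N+1) * K * ∫⁻ x in Set.Icc (fun _ : Fin (N+1) => (0:ℝ)) (fun _ => m), Psi18 f x := by
    have h := enorm_integral_le_lintegral_enorm (μ := volume.restrict (Set.Icc (fun _ : Fin (N+1) => (0:ℝ)) (fun _ => m)))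
      (fun x => ∑ j, gradient18 f x j * ((hessian18 f x).updateRow j (V (gradient18 f x))).det)
    rw [Real.enorm_eq_ofReal_abs] at h
    refine h.trans ?_
    rw [← lintegral_const_mul' _ _ (ENNReal.mul_ne_top (by finiteness) ENNReal.ofReal_ne_top)]
    refine lintegral_mono fun x => ?_
    rw [Real.enorm_eq_ofReal_abs]
    refine (ENNReal.ofReal_le_ofReal (Finset.abs_sum_le_sum_abs _ _)).trans ?_
    rw [ENNReal.ofReal_sum_of_nonneg (fun _ _ => abs_nonneg _)]
    refine (Finset.sum_le_sum fun j _ => psi_bound18 f x C hC _ (hVb _) _ (S18_g f x j) j).trans ?_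
    simp [mul_assoc, hK]
  have bI1 : ∀ (j : Fin (N+1)) (c : ℝ), ENNReal.ofReal |∫ y in Set.Icc (fun _ : Fin N => (0:ℝ)) (fun _ => m),
        f (Fin.insertNth j c y) * ((hessian18 f (Fin.insertNth j c y)).updateRow j
          (V (gradient18 f (Fin.insertNth j c y)))).det| ≤
      (N+1) * K * ∫⁻ y in Set.Icc (fun _ : Fin N => (0:ℝ)) (fun _ => m), Psi18 f (Fin.insertNth j c y) := by
    intro j c
    have h := enorm_integral_le_lintegral_enorm (μ := volume.restrict (Set.Icc (fun _ : Fin N => (0:ℝ)) (fun _ => m)))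
      (fun y => f (Fin.insertNth j c y) * ((hessian18 f (Fin.insertNth j c y)).updateRow j
          (V (gradient18 f (Fin.insertNth j c y)))).det)
    rw [Real.enorm_eq_ofReal_abs] at h
    refine h.trans ?_
    rw [← lintegral_const_mul' _ _ (ENNReal.mul_ne_top (by finiteness) ENNReal.ofReal_ne_top)]
    refine lintegral_mono fun x => ?_
    rw [Real.enorm_eq_ofReal_abs]
    refine (psi_bound18 f _ C hC _ (hVb _) _ (S18_f f _) j).trans ?_
    rw [mul_assoc]
    nth_rw 1 [← one_mul (ENNReal.ofReal _ * _)]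
    gcongr
    simp
  have e1 := eq_sub_of_add_eq' st
  rw [e1]
  have tri : ∀ (a : Fin (N+1) → ℝ) (b : Fin (N+1) → ℝ), |∑ j, (a j - b j) - I0| ≤ |I0| + ∑ j, (|a j| + |b j|) := by
    intro a b
    have h1 := abs_sub (∑ j, (a j - b j)) I0
    have h2 := Finset.abs_sum_le_sum_abs (fun j => a j - b j) Finset.univ
    have h3 : ∑ j, |a j - b j| ≤ ∑ j, (|a j| + |b j|) := Finset.sum_le_sum fun j _ => abs_sub _ _
    linarith
  refine (ENNReal.ofReal_le_ofReal (tri _ _)).trans ?_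
  rw [ENNReal.ofReal_add (by positivity) (Finset.sum_nonneg fun j _ => by positivity),
    ENNReal.ofReal_sum_of_nonneg (fun _ _ => by positivity), mul_add, Finset.mul_sum]
  refine add_le_add bI0 (Finset.sum_le_sum fun j _ => ?_)
  rw [ENNReal.ofReal_add (by positivity) (by positivity), mul_add]
  exact add_le_add (bI1 j m) (bI1 j 0)

end

section
open MeasureTheory Filter Topology

theorem jensen18 {α : Type*} [MeasurableSpace α] (ρ : Measure α) (f : α → ENNReal) (hf : AEMeasurable f ρ)
    (κ : ℝ) (hκ : 1 ≤ κ) :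
    (∫⁻ x, f x ∂ρ) ^ κ ≤ (ρ Set.univ) ^ (κ - 1) * ∫⁻ x, f x ^ κ ∂ρ := by
  rcases hκ.eq_or_lt with h1 | h1
  · subst h1; simp
  have hc : κ.HolderConjugate (κ / (κ - 1)) := Real.HolderConjugate.conjExponent h1
  have h := ENNReal.lintegral_mul_le_Lp_mul_Lq ρ hc hf (aemeasurable_const (b := (1 : ENNReal)))
  simp only [Pi.mul_apply, mul_one, ENNReal.one_rpow, lintegral_const, one_mul] at h
  have hk0 : 0 < κ := by linarith
  have h2 := ENNReal.rpow_le_rpow h hk0.le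
  refine h2.trans (le_of_eq ?_)
  rw [ENNReal.mul_rpow_of_nonneg _ _ hk0.le, ← ENNReal.rpow_mul, ← ENNReal.rpow_mul, mul_comm]
  have : κ - 1 ≠ 0 := by linarith
  congr 2
  · field_simp
  · rw [one_div_mul_cancel hk0.ne', ENNReal.rpow_one]

theorem young18 (a b : ENNReal) (p q : ℝ) (h : p.HolderConjugate q) : a * b ≤ a ^ p + b ^ q := by
  refine (ENNReal.young_inequality a b h).trans (add_le_add ?_ ?_)
  · refine ENNReal.div_le_of_le_mul ?_
    refine le_mul_of_one_le_right' ?_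
    rw [← ENNReal.ofReal_one]; exact ENNReal.ofReal_le_ofReal h.lt.le
  · refine ENNReal.div_le_of_le_mul ?_
    refine le_mul_of_one_le_right' ?_
    rw [← ENNReal.ofReal_one]; exact ENNReal.ofReal_le_ofReal h.symm.lt.le

theorem mul_le_sq18 (a b : ENNReal) (p : ℝ) (hp : 0 ≤ p) : (a * b) ^ p ≤ a ^ (2 * p) + b ^ (2 * p) := by
  have e : ∀ c : ENNReal, c ^ (2 * p) = (c * c) ^ p := by
    intro c
    rw [ENNReal.rpow_mul, show (2:ℝ) = ((2:ℕ):ℝ) by norm_num, ENNReal.rpow_natCast, sq]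
  rw [e, e]
  rcases le_total a b with h | h
  · exact (ENNReal.rpow_le_rpow (mul_le_mul_left h b) hp).trans le_add_self
  · exact (ENNReal.rpow_le_rpow (mul_le_mul_right h a) hp).trans le_self_add

theorem slice_abs18 {Ω : Type*} [MeasurableSpace Ω] (P : Measure Ω) [IsProbabilityMeasure P]
    {Y : Type*} [MeasurableSpace Y] (ρ : Measure Y) [IsFiniteMeasure ρ] (A B : Y → Ω → ENNReal)
    (hA : Measurable (Function.uncurry A)) (hB : Measurable (Function.uncurry B))
    (κ q : ℝ) (hκq : q.HolderConjugate κ) (CA : ENNReal)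
    (hCA : ∀ y, ∫⁻ ω, A y ω ^ (2 * (κ * q)) ∂P ≤ CA)
    (CG : ENNReal) (hCG : ∫⁻ z, (∫⁻ ω, (B z.1 ω * B z.2 ω) ^ (κ * κ) ∂P) ∂(ρ.prod ρ) ≤ CG) :
    ∫⁻ ω, (∫⁻ y, A y ω * B y ω ∂ρ) ^ (2 * κ) ∂P ≤
      (ρ Set.univ * ρ Set.univ) ^ (κ - 1) * ((CA + CA) * (ρ Set.univ * ρ Set.univ) + CG) := by
  have hκ : 1 < κ := hκq.symm.lt
  have hq : 1 < q := hκq.lt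
  have mA : ∀ ω, Measurable fun y => A y ω := fun ω => hA.comp (measurable_id.prodMk measurable_const)
  have mB : ∀ ω, Measurable fun y => B y ω := fun ω => hB.comp (measurable_id.prodMk measurable_const)
  have mA' : ∀ y, Measurable fun ω => A y ω := fun ω => hA.comp (measurable_const.prodMk measurable_id)
  have step : ∀ ω, (∫⁻ y, A y ω * B y ω ∂ρ) ^ (2 * κ) ≤ (ρ Set.univ * ρ Set.univ) ^ (κ - 1) *
      ∫⁻ z, ((A z.1 ω * A z.2 ω) ^ (κ * q) + (B z.1 ω * B z.2 ω) ^ (κ * κ)) ∂(ρ.prod ρ) := by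
    intro ω
    have mf : Measurable fun y => A y ω * B y ω := (mA ω).mul (mB ω)
    have e : (∫⁻ y, A y ω * B y ω ∂ρ) ^ (2 * κ) =
        (∫⁻ z, (A z.1 ω * B z.1 ω) * (A z.2 ω * B z.2 ω) ∂(ρ.prod ρ)) ^ κ := by
      rw [lintegral_prod_mul mf.aemeasurable mf.aemeasurable, ENNReal.rpow_mul]
      congr 1
      rw [show (2:ℝ) = ((2:ℕ):ℝ) by norm_num, ENNReal.rpow_natCast, sq]
    rw [e]
    refine (jensen18 _ _ ?_ κ hκ.le).trans ?_
    · exact ((mf.comp measurable_fst).mul (mf.comp measurable_snd)).aemeasurable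
    · rw [← Set.univ_prod_univ, Measure.prod_prod]
      refine mul_le_mul_right ?_ _
      refine lintegral_mono fun z => ?_
      have := young18 ((A z.1 ω * A z.2 ω) ^ κ) ((B z.1 ω * B z.2 ω) ^ κ) q κ hκq
      rw [← ENNReal.mul_rpow_of_nonneg _ _ (by linarith), ← ENNReal.rpow_mul, ← ENNReal.rpow_mul] at this
      refine le_trans (le_of_eq ?_) this
      congr 1; ring
  have m1 : Measurable fun p : Ω × Y × Y => (A p.2.1 p.1 * A p.2.2 p.1) ^ (κ * q) := by
    refine Measurable.pow_const (Measurable.mul ?_ ?_) _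
    · exact hA.comp (((measurable_fst.comp measurable_snd)).prodMk measurable_fst)
    · exact hA.comp (((measurable_snd.comp measurable_snd)).prodMk measurable_fst)
  have m2 : Measurable fun p : Ω × Y × Y => (B p.2.1 p.1 * B p.2.2 p.1) ^ (κ * κ) := by
    refine Measurable.pow_const (Measurable.mul ?_ ?_) _
    · exact hB.comp (((measurable_fst.comp measurable_snd)).prodMk measurable_fst)
    · exact hB.comp (((measurable_snd.comp measurable_snd)).prodMk measurable_fst)
  have hfin : (ρ Set.univ * ρ Set.univ) ^ (κ - 1) ≠ ⊤ :=
    ENNReal.rpow_ne_top_of_nonneg (by linarith) (ENNReal.mul_ne_top (measure_ne_top _ _) (measure_ne_top _ _))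
  refine (lintegral_mono step).trans ?_
  rw [lintegral_const_mul' _ _ hfin]
  refine mul_le_mul_right ?_ _
  rw [lintegral_lintegral_swap (f := fun ω (z : Y × Y) => (A z.1 ω * A z.2 ω) ^ (κ * q) + (B z.1 ω * B z.2 ω) ^ (κ * κ)) (m1.add m2).aemeasurable]
  have hs : ∀ z : Y × Y, ∫⁻ ω, ((A z.1 ω * A z.2 ω) ^ (κ * q) + (B z.1 ω * B z.2 ω) ^ (κ * κ)) ∂P ≤
      (CA + CA) + ∫⁻ ω, (B z.1 ω * B z.2 ω) ^ (κ * κ) ∂P := by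
    intro z
    rw [lintegral_add_left (f := fun ω => (A z.1 ω * A z.2 ω) ^ (κ * q)) (((mA' _).mul (mA' _)).pow_const _)]
    refine add_le_add ?_ le_rfl
    refine (lintegral_mono fun ω => mul_le_sq18 (A z.1 ω) (A z.2 ω) (κ * q) (by positivity)).trans ?_
    rw [lintegral_add_left ((mA' _).pow_const _)]
    exact add_le_add (hCA _) (hCA _)
  refine (lintegral_mono hs).trans ?_
  rw [lintegral_add_left measurable_const, lintegral_const, ← Set.univ_prod_univ, Measure.prod_prod]
  exact add_le_add le_rfl hCG

end

section
open MeasureTheory Filter Topology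

theorem prod_rpow18 {ι : Type*} (s : Finset ι) (z : ENNReal) (h0 : z ≠ 0) (ht : z ≠ ⊤) (α : ι → ℝ) :
    ∏ i ∈ s, z ^ (-(α i)) = z ^ (-(∑ i ∈ s, α i)) := by
  classical
  induction s using Finset.induction_on with
  | empty => simp
  | insert a s ha ih => rw [Finset.prod_insert ha, Finset.sum_insert ha, ih, neg_add, ENNReal.rpow_add _ _ h0 ht]

theorem rpow_anti18 {a b : ENNReal} (h : a ≤ b) {p : ℝ} (hp : 0 ≤ p) : b ^ (-p) ≤ a ^ (-p) := by
  rw [ENNReal.rpow_neg, ENNReal.rpow_neg]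
  exact ENNReal.inv_le_inv.2 (ENNReal.rpow_le_rpow h hp)

theorem psi_le18 {N : ℕ} (w : Fin (N+1) → (Fin (N+1) → ℝ)) (α : Fin (N+1) → ℝ) (hα : ∀ i, 0 < α i)
    (h1 : N ≤ ∑ i, α i) (h2 : ∑ i, α i ≤ N + 1) :
    ∃ C : ENNReal, C ≠ ⊤ ∧ ∀ (f : (Fin (N+1) → ℝ) → ℝ) (x : Fin (N+1) → ℝ),
      Psi18 f x ≤ (C * ENNReal.ofReal (1 + S18 f x) ^ (N + 3)) *
        ∏ i, ENNReal.ofReal |fderiv ℝ f x (w i)| ^ (-(α i)) := by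
  set K0 : ℝ := 1 + ∑ i, ∑ k, |w i k| with hK0
  have hK1 : 1 ≤ K0 := by
    have : 0 ≤ ∑ i, ∑ k, |w i k| := by positivity
    linarith
  set K := ENNReal.ofReal K0 with hK
  have hKp : K ≠ 0 := by
    rw [hK]; simp; linarith
  have hKt : K ≠ ⊤ := ENNReal.ofReal_ne_top
  set T := ∑ i, α i with hT
  have hT0 : 0 ≤ T := Finset.sum_nonneg fun i _ => (hα i).le
  have hK1' : 1 ≤ K ^ T := by
    have : (1 : ENNReal) ≤ K := by
      rw [hK, ← ENNReal.ofReal_one]; exact ENNReal.ofReal_le_ofReal hK1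
    simpa using ENNReal.rpow_le_rpow this hT0
  refine ⟨K ^ T, ENNReal.rpow_ne_top_of_nonneg hT0 hKt, fun f x => ?_⟩
  set q := ∑ i, gradient18 f x i ^ 2 with hq
  have q0 : 0 ≤ q := by positivity
  set r := ENNReal.ofReal (Real.sqrt q) with hr
  have hqr : ENNReal.ofReal q ^ (-(N:ℝ)/2) = r ^ (-(N:ℝ)) := by
    rw [hr, ← Real.sq_sqrt q0, ENNReal.ofReal_pow (Real.sqrt_nonneg _), Real.sq_sqrt q0, ← ENNReal.rpow_natCast,
      ← ENNReal.rpow_mul]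
    congr 1; push_cast; ring
  have hgr : ∀ k, |gradient18 f x k| ≤ Real.sqrt q := fun k => by
    refine Real.abs_le_sqrt ?_
    exact Finset.single_le_sum (f := fun k => gradient18 f x k ^ 2) (fun _ _ => by positivity) (Finset.mem_univ k)
  have hU : ∀ i, ENNReal.ofReal |fderiv ℝ f x (w i)| ≤ K * r := by
    intro i
    rw [hK, hr, ← ENNReal.ofReal_mul (by linarith)]
    refine ENNReal.ofReal_le_ofReal ?_
    have e : fderiv ℝ f x (w i) = ∑ k, w i k * gradient18 f x k := by
      have := LinearMap.pi_apply_eq_sum_univ (fderiv ℝ f x : (Fin (N+1) → ℝ) →ₗ[ℝ] ℝ) (w i)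
      simp only [ContinuousLinearMap.coe_coe, smul_eq_mul] at this
      rw [this]
      refine Finset.sum_congr rfl fun k _ => ?_
      simp only [gradient18]
      congr 2
      ext l; simp [Pi.single_apply, eq_comm]
    rw [e]
    calc _ ≤ ∑ k, |w i k * gradient18 f x k| := Finset.abs_sum_le_sum_abs _ _
      _ ≤ ∑ k, |w i k| * Real.sqrt q := Finset.sum_le_sum fun k _ => by
          rw [abs_mul]; exact mul_le_mul_of_nonneg_left (hgr k) (abs_nonneg _)
      _ = (∑ k, |w i k|) * Real.sqrt q := by rw [Finset.sum_mul]
      _ ≤ _ := by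
          refine mul_le_mul_of_nonneg_right ?_ (Real.sqrt_nonneg _)
          have : ∑ k, |w i k| ≤ ∑ i, ∑ k, |w i k| :=
            Finset.single_le_sum (f := fun i => ∑ k, |w i k|) (fun _ _ => by positivity) (Finset.mem_univ i)
          linarith
  have hrS : 1 + r ≤ ENNReal.ofReal (1 + S18 f x) := by
    rw [hr, ← ENNReal.ofReal_one, ← ENNReal.ofReal_add (by norm_num) (Real.sqrt_nonneg _)]
    refine ENNReal.ofReal_le_ofReal ?_
    have a1 : Real.sqrt q ≤ ∑ i, |gradient18 f x i| := by
      refine Real.sqrt_le_iff.2 ⟨by positivity, ?_⟩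
      have := Finset.sum_sq_le_sq_sum_of_nonneg (s := Finset.univ) (f := fun i => |gradient18 f x i|) (fun _ _ => abs_nonneg _)
      simpa [sq_abs] using this
    have a2 : 0 ≤ ∑ i, ∑ j, |hessian18 f x i j| := by positivity
    have a3 := abs_nonneg (f x)
    unfold S18; linarith
  have main : r ^ (-(N:ℝ)) ≤ (K ^ T * (1 + r)) * ∏ i, ENNReal.ofReal |fderiv ℝ f x (w i)| ^ (-(α i)) := by
    by_cases hr0 : r = 0
    · have : ∏ i, ENNReal.ofReal |fderiv ℝ f x (w i)| ^ (-(α i)) = ⊤ := by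
        have hz : ∀ i, ENNReal.ofReal |fderiv ℝ f x (w i)| ^ (-(α i)) = ⊤ := fun i => by
          have := hU i
          rw [hr0, mul_zero, nonpos_iff_eq_zero] at this
          rw [this, ENNReal.zero_rpow_of_neg (by linarith [hα i])]
        simp only [hz]
        simp
      rw [this, ENNReal.mul_top]
      · exact le_top
      · rw [hr0, add_zero, mul_one]
        exact (lt_of_lt_of_le one_pos hK1').ne'
    · have hrt : r ≠ ⊤ := ENNReal.ofReal_ne_top
      have hz0 : K * r ≠ 0 := mul_ne_zero hKp hr0
      have hzt : K * r ≠ ⊤ := ENNReal.mul_ne_top hKt hrt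
      have b1 : (K * r) ^ (-T) ≤ ∏ i, ENNReal.ofReal |fderiv ℝ f x (w i)| ^ (-(α i)) := by
        rw [hT, ← prod_rpow18 _ _ hz0 hzt]
        exact Finset.prod_le_prod' fun i _ => rpow_anti18 (hU i) (hα i).le
      have b2 : K ^ T * (K * r) ^ (-T) = r ^ (-T) := by
        rw [ENNReal.mul_rpow_of_ne_top hKt hrt, ← mul_assoc, ← ENNReal.rpow_add _ _ hKp hKt]
        simp
      have b3 : r ^ (-(N:ℝ)) ≤ (1 + r) * r ^ (-T) := by
        rcases le_total r 1 with h | h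
        · calc _ ≤ r ^ (-T) := ENNReal.rpow_le_rpow_of_exponent_ge h (by linarith)
            _ ≤ _ := le_mul_of_one_le_left' le_self_add
        · calc r ^ (-(N:ℝ)) ≤ r ^ (1 + -T) := ENNReal.rpow_le_rpow_of_exponent_le h (by linarith)
            _ = r * r ^ (-T) := by rw [ENNReal.rpow_add _ _ hr0 hrt, ENNReal.rpow_one]
            _ ≤ _ := by gcongr; exact le_add_self
      calc _ ≤ (1 + r) * r ^ (-T) := b3
        _ = K ^ T * (1 + r) * (K * r) ^ (-T) := by rw [← b2]; ring
        _ ≤ _ := by gcongr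
  unfold Psi18
  rw [← hq, hqr]
  calc _ ≤ ENNReal.ofReal (1 + S18 f x) ^ (N + 2) * ((K ^ T * ENNReal.ofReal (1 + S18 f x)) *
        ∏ i, ENNReal.ofReal |fderiv ℝ f x (w i)| ^ (-(α i))) := by
        gcongr
        exact main.trans (by gcongr)
    _ = _ := by ring

end

section
open MeasureTheory Filter Topology

def Mom18 {Y Ω : Type*} [MeasurableSpace Ω] (P : Measure Ω) (f : Y → Ω → ENNReal) : Prop :=
  (∀ s, Measurable (f s)) ∧ ∀ p > (0:ℝ), ∃ C : ENNReal, C ≠ ⊤ ∧ ∀ s, ∫⁻ ω, f s ω ^ p ∂P ≤ C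

theorem Mom18.plus {Y Ω : Type*} [MeasurableSpace Ω] {P : Measure Ω} {f g : Y → Ω → ENNReal}
    (hf : Mom18 P f) (hg : Mom18 P g) : Mom18 P (fun s ω => f s ω + g s ω) := by
  refine ⟨fun s => (hf.1 s).add (hg.1 s), fun p hp => ?_⟩
  obtain ⟨C, hC, h1⟩ := hf.2 p hp
  obtain ⟨D, hD, h2⟩ := hg.2 p hp
  have h2p : (2:ENNReal) ^ p ≠ ⊤ := ENNReal.rpow_ne_top_of_nonneg hp.le (by norm_num)
  refine ⟨2 ^ p * (C + D), ENNReal.mul_ne_top h2p (by finiteness), fun s => ?_⟩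
  have hle : ∀ ω, (f s ω + g s ω) ^ p ≤ 2 ^ p * (f s ω ^ p + g s ω ^ p) := by
    intro ω
    rcases le_total (f s ω) (g s ω) with h | h
    · calc _ ≤ (2 * g s ω) ^ p := ENNReal.rpow_le_rpow (by rw [two_mul]; gcongr) hp.le
        _ = 2 ^ p * g s ω ^ p := ENNReal.mul_rpow_of_nonneg _ _ hp.le
        _ ≤ _ := by gcongr; exact le_add_self
    · calc _ ≤ (2 * f s ω) ^ p := ENNReal.rpow_le_rpow (by rw [two_mul]; gcongr) hp.le
        _ = 2 ^ p * f s ω ^ p := ENNReal.mul_rpow_of_nonneg _ _ hp.le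
        _ ≤ _ := by gcongr; exact le_self_add
  refine (lintegral_mono hle).trans ?_
  rw [lintegral_const_mul' _ _ h2p, lintegral_add_left ((hf.1 s).pow_const _)]
  gcongr
  · exact h1 s
  · exact h2 s

theorem Mom18.const {Y Ω : Type*} [MeasurableSpace Ω] {P : Measure Ω} [IsProbabilityMeasure P] (c : ENNReal) (hc : c ≠ ⊤) :
    Mom18 P (fun (_ : Y) _ => c) := by
  refine ⟨fun s => measurable_const, fun p hp => ⟨c ^ p, ENNReal.rpow_ne_top_of_nonneg hp.le hc, fun s => by simp⟩⟩

theorem Mom18.finsum {Y Ω ι : Type*} [MeasurableSpace Ω] {P : Measure Ω} [IsProbabilityMeasure P] (s : Finset ι)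
    {f : ι → Y → Ω → ENNReal} (hf : ∀ i, Mom18 P (f i)) : Mom18 P (fun y ω => ∑ i ∈ s, f i y ω) := by
  classical
  induction s using Finset.induction_on with
  | empty => simpa using Mom18.const 0 (by simp)
  | insert a s ha ih =>
    simp_rw [Finset.sum_insert ha]
    exact (hf a).plus ih

theorem gf_hess18 {n : ℕ} {Ω : Type*} [MeasurableSpace Ω] (P : Measure Ω) [IsProbabilityMeasure P]
    (X : (Fin n → ℝ) → Ω → ℝ) (hX : GF18 P X) (hd : ∀ ω, ContDiff ℝ 2 fun s => X s ω) (v w : Fin n → ℝ) :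
    GF18 P (fun s ω => fderiv ℝ (fun t => X t ω) s v) ∧
    GF18 P (fun s ω => fderiv ℝ (fun t => fderiv ℝ (fun t => X t ω) t v) s w) := by
  have h1 := deriv_field18 P X hX (fun ω => (hd ω).differentiable (by norm_num)) v
  refine ⟨h1, deriv_field18 P _ h1 (fun ω => ?_) w⟩
  exact (contDiff_grad18 (k := 1) (by simpa using hd ω) v).differentiable (by norm_num)

theorem ofReal_S18 {n : ℕ} (f : (Fin n → ℝ) → ℝ) (x : Fin n → ℝ) :
    ENNReal.ofReal (1 + S18 f x) = 1 + (ENNReal.ofReal |f x| + ∑ i, ENNReal.ofReal |gradient18 f x i| +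
      ∑ i, ∑ j, ENNReal.ofReal |hessian18 f x i j|) := by
  rw [ENNReal.ofReal_add (by norm_num) (S18_nonneg f x), ENNReal.ofReal_one]
  unfold S18
  rw [ENNReal.ofReal_add (by positivity) (by positivity), ENNReal.ofReal_add (by positivity) (by positivity),
    ENNReal.ofReal_sum_of_nonneg (fun _ _ => abs_nonneg _), ENNReal.ofReal_sum_of_nonneg (fun _ _ => by positivity)]
  congr 3
  ext i
  rw [ENNReal.ofReal_sum_of_nonneg (fun _ _ => abs_nonneg _)]

theorem mom_S18 {n : ℕ} {Ω : Type*} [MeasurableSpace Ω] (P : Measure Ω) [IsProbabilityMeasure P]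
    (X : (Fin n → ℝ) → Ω → ℝ) (hX : GF18 P X) (hd : ∀ ω, ContDiff ℝ 2 fun s => X s ω) :
    Mom18 P (fun s ω => ENNReal.ofReal (1 + S18 (fun t => X t ω) s)) := by
  simp_rw [ofReal_S18]
  have base : ∀ Z : (Fin n → ℝ) → Ω → ℝ, GF18 P Z → Mom18 P (fun s ω => ENNReal.ofReal |Z s ω|) := fun Z hZ =>
    ⟨fun s => (hZ.1 s).abs.ennreal_ofReal, fun p hp => moment18 P Z hZ p hp⟩
  refine (Mom18.const 1 (by simp)).plus (((base X hX).plus ?_).plus ?_)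
  · exact Mom18.finsum _ fun i => base _ (gf_hess18 P X hX hd (Pi.single i 1) 0).1
  · exact Mom18.finsum _ fun i => Mom18.finsum _ fun j => base _ (gf_hess18 P X hX hd (Pi.single j 1) (Pi.single i 1)).2

theorem meas_fd18 {n : ℕ} {Ω : Type*} [MeasurableSpace Ω] (P : Measure Ω) [IsProbabilityMeasure P]
    (X : (Fin n → ℝ) → Ω → ℝ) (hX : GF18 P X) (hd : ∀ ω, ContDiff ℝ 2 fun s => X s ω) (v w : Fin n → ℝ) :
    Measurable (fun p : (Fin n → ℝ) × Ω => X p.1 p.2) ∧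
    Measurable (fun p : (Fin n → ℝ) × Ω => fderiv ℝ (fun t => X t p.2) p.1 v) ∧
    Measurable (fun p : (Fin n → ℝ) × Ω => fderiv ℝ (fun t => fderiv ℝ (fun t => X t p.2) t v) p.1 w) := by
  obtain ⟨h1, h2⟩ := gf_hess18 P X hX hd v w
  have c1 : ∀ ω, ContDiff ℝ 1 fun s => fderiv ℝ (fun t => X t ω) s v := fun ω =>
    contDiff_grad18 (k := 1) (by simpa using hd ω) v
  have c2 : ∀ ω, Continuous fun s => fderiv ℝ (fun t => fderiv ℝ (fun t => X t ω) t v) s w := fun ω =>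
    (contDiff_grad18 (k := 0) (by simpa using c1 ω) w).continuous
  exact ⟨measurable_uncurry_of_continuous_of_measurable (fun ω => (hd ω).continuous) hX.1,
    measurable_uncurry_of_continuous_of_measurable (u := fun s ω => fderiv ℝ (fun t => X t ω) s v)
      (fun ω => (c1 ω).continuous) h1.1,
    measurable_uncurry_of_continuous_of_measurable
      (u := fun s ω => fderiv ℝ (fun t => fderiv ℝ (fun t => X t ω) t v) s w) c2 h2.1⟩

theorem meas_S18 {n : ℕ} {Ω : Type*} [MeasurableSpace Ω] (P : Measure Ω) [IsProbabilityMeasure P]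
    (X : (Fin n → ℝ) → Ω → ℝ) (hX : GF18 P X) (hd : ∀ ω, ContDiff ℝ 2 fun s => X s ω) :
    Measurable (fun p : (Fin n → ℝ) × Ω => S18 (fun t => X t p.2) p.1) := by
  unfold S18
  refine ((meas_fd18 P X hX hd 0 0).1.abs.add ?_).add ?_
  · exact Finset.measurable_fun_sum _ fun i _ => (meas_fd18 P X hX hd (Pi.single i 1) 0).2.1.abs
  · exact Finset.measurable_fun_sum _ fun i _ => Finset.measurable_fun_sum _ fun j _ =>
      (meas_fd18 P X hX hd (Pi.single j 1) (Pi.single i 1)).2.2.abs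

theorem meas_Psi18 {N : ℕ} {Ω : Type*} [MeasurableSpace Ω] (P : Measure Ω) [IsProbabilityMeasure P]
    (X : (Fin (N+1) → ℝ) → Ω → ℝ) (hX : GF18 P X) (hd : ∀ ω, ContDiff ℝ 2 fun s => X s ω) :
    Measurable (fun p : (Fin (N+1) → ℝ) × Ω => Psi18 (fun t => X t p.2) p.1) := by
  unfold Psi18
  refine Measurable.mul ?_ ?_
  · exact ((meas_S18 P X hX hd).const_add 1).ennreal_ofReal.pow_const _
  · refine Measurable.pow_const (Measurable.ennreal_ofReal ?_) _
    exact Finset.measurable_fun_sum _ fun i _ => (meas_fd18 P X hX hd (Pi.single i 1) 0).2.1.pow_const 2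

/-- pairing bound for the negative part -/
theorem neg_pair18 {N : ℕ} {Ω : Type*} [MeasurableSpace Ω] (P : Measure Ω)
    (U : (Fin (N+1) → ℝ) → Fin (N+1) → Ω → ENNReal) (hU : ∀ s i, Measurable (U s i)) (γ a : ℝ) (hγ : 0 ≤ γ)
    (l : Fin (N+1)) (α b b' : Fin (N+1) → ℝ) (hαl : α l = 1/4) (hα : ∀ i, i ≠ l → α i = a)
    (hbl : b l = γ / 2) (hb : ∀ i, i ≠ l → b i = γ * a) (hbl' : b' l = 0) (hb' : ∀ i, i ≠ l → b' i = γ * a)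
    (s s' : Fin (N+1) → ℝ) (D : ENNReal)
    (h1 : ∫⁻ ω, ∏ i, (U s i ω ^ (-(b i)) * U s' i ω ^ (-(b' i))) ∂P ≤ D)
    (h2 : ∫⁻ ω, ∏ i, (U s' i ω ^ (-(b i)) * U s i ω ^ (-(b' i))) ∂P ≤ D) :
    ∫⁻ ω, ((∏ i, U s i ω ^ (-(α i))) * ∏ i, U s' i ω ^ (-(α i))) ^ γ ∂P ≤ D + D := by
  refine le_trans ?_ (add_le_add h1 h2)
  rw [← lintegral_add_left]
  swap
  · exact Finset.measurable_fun_prod _ fun i _ => ((hU s i).pow_const _).mul ((hU s' i).pow_const _)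
  refine lintegral_mono fun ω => ?_
  rw [← Finset.prod_mul_distrib, ← ENNReal.prod_rpow_of_nonneg hγ]
  rw [Fin.prod_univ_succAbove _ l, Fin.prod_univ_succAbove _ l, Fin.prod_univ_succAbove _ l]
  have e1 : ∀ k, (U s (l.succAbove k) ω ^ (-(α (l.succAbove k))) * U s' (l.succAbove k) ω ^ (-(α (l.succAbove k)))) ^ γ =
      U s (l.succAbove k) ω ^ (-(γ * a)) * U s' (l.succAbove k) ω ^ (-(γ * a)) := by
    intro k
    rw [hα _ (Fin.succAbove_ne _ _), ENNReal.mul_rpow_of_nonneg _ _ hγ, ← ENNReal.rpow_mul, ← ENNReal.rpow_mul]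
    ring_nf
  have e2 : ∀ k, b (l.succAbove k) = γ * a := fun k => hb _ (Fin.succAbove_ne _ _)
  have e3 : ∀ k, b' (l.succAbove k) = γ * a := fun k => hb' _ (Fin.succAbove_ne _ _)
  simp only [e1, e2, e3, hαl, hbl, hbl', neg_zero, ENNReal.rpow_zero, mul_one]
  have e4 : ∏ k, (U s' (l.succAbove k) ω ^ (-(γ * a)) * U s (l.succAbove k) ω ^ (-(γ * a))) =
    ∏ k, (U s (l.succAbove k) ω ^ (-(γ * a)) * U s' (l.succAbove k) ω ^ (-(γ * a))) :=
      Finset.prod_congr rfl fun k _ => mul_comm _ _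
  rw [e4, ← add_mul]
  gcongr
  refine (mul_le_sq18 _ _ γ hγ).trans (le_of_eq ?_)
  rw [← ENNReal.rpow_mul, ← ENNReal.rpow_mul]
  ring_nf

end

section
open MeasureTheory Filter Topology

theorem lint_abs18 (β : ℝ) (h1 : β < 1) (K : ℝ) (hK : 0 < K) :
    ∫⁻ w in Set.Icc (-K) K, ENNReal.ofReal |w| ^ (-β) ≠ ⊤ := by
  have hp : ∫⁻ w in Set.Ioc 0 K, ENNReal.ofReal |w| ^ (-β) = ENNReal.ofReal (K ^ (1 - β) / (1 - β)) := by
    rw [← lint_low18 (1 - β) (by linarith) K hK]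
    refine setLIntegral_congr_fun measurableSet_Ioc fun w hw => ?_
    rw [abs_of_pos hw.1, ENNReal.ofReal_rpow_of_pos hw.1]
    congr 2; ring
  have hn : ∫⁻ w in Set.Ico (-K) 0, ENNReal.ofReal |w| ^ (-β) = ENNReal.ofReal (K ^ (1 - β) / (1 - β)) := by
    rw [← hp, ← (Measure.measurePreserving_neg (volume : Measure ℝ)).setLIntegral_comp_preimage measurableSet_Ioc
      (by fun_prop)]
    simp
  have hs : Set.Icc (-K) K ⊆ (Set.Ico (-K) 0 ∪ {0}) ∪ Set.Ioc 0 K := by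
    intro w hw
    rcases lt_trichotomy w 0 with h | h | h
    · exact Or.inl (Or.inl ⟨hw.1, h⟩)
    · exact Or.inl (Or.inr h)
    · exact Or.inr ⟨h, hw.2⟩
  refine ne_top_of_le_ne_top ?_ (lintegral_mono_set hs)
  refine ne_top_of_le_ne_top ?_ (lintegral_union_le _ _ _)
  refine ENNReal.add_ne_top.2 ⟨ne_top_of_le_ne_top ?_ (lintegral_union_le _ _ _), ?_⟩
  · refine ENNReal.add_ne_top.2 ⟨by rw [hn]; exact ENNReal.ofReal_ne_top, ?_⟩
    simp
  · rw [hp]; exact ENNReal.ofReal_ne_top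

theorem sing_int18 {N : ℕ} (M : Matrix (Fin N) (Fin N) ℝ) (hM : M.det ≠ 0) (β : ℝ) (h1 : β < 1) (m : ℝ) (hm : 0 < m) :
    ∃ C : ENNReal, C ≠ ⊤ ∧ ∀ y ∈ Set.Icc (fun _ : Fin N => (0:ℝ)) (fun _ => m),
      ∫⁻ y' in Set.Icc (fun _ : Fin N => (0:ℝ)) (fun _ => m),
        ∏ i, ENNReal.ofReal |dotProduct (M i) (y' - y)| ^ (-β) ≤ C := by
  set K : ℝ := 1 + (∑ i, ∑ k, |M i k|) * m with hK
  have hKp : 0 < K := by positivity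
  let g : ℝ → ENNReal := (Set.Icc (-K) K).indicator fun w => ENNReal.ofReal |w| ^ (-β)
  have hg : Measurable g := Measurable.indicator (by fun_prop) measurableSet_Icc
  have hG : Measurable fun w : Fin N → ℝ => ∏ i, g (w i) :=
    Finset.measurable_fun_prod _ fun i _ => hg.comp (measurable_pi_apply i)
  have hlin : Measurable (Matrix.toLin' M) := (Matrix.toLin' M).continuous_of_finiteDimensional.measurable
  have hIntg : ∫⁻ z : Fin N → ℝ, ∏ i, g ((Matrix.toLin' M z) i) =
      ENNReal.ofReal (abs (M.det)⁻¹) * ∏ _i : Fin N, ∫⁻ w in Set.Icc (-K) K, ENNReal.ofReal |w| ^ (-β) := by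
    rw [← lintegral_map hG hlin, Real.map_matrix_volume_pi_eq_smul_volume_pi hM, lintegral_smul_measure, smul_eq_mul]
    congr 1
    rw [volume_pi, lintegral_fin_prod18 _ fun _ => hg]
    refine Finset.prod_congr rfl fun i _ => ?_
    exact lintegral_indicator measurableSet_Icc _
  refine ⟨ENNReal.ofReal (abs (M.det)⁻¹) * ∏ _i : Fin N, ∫⁻ w in Set.Icc (-K) K, ENNReal.ofReal |w| ^ (-β), ?_, fun y hy => ?_⟩
  rotate_left
  · calc _ ≤ ∫⁻ y' in Set.Icc (fun _ : Fin N => (0:ℝ)) (fun _ => m), ∏ i, g ((Matrix.toLin' M (y' - y)) i) := by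
          refine setLIntegral_mono' measurableSet_Icc fun y' hy' => ?_
          refine Finset.prod_le_prod' fun i _ => le_of_eq ?_
          have e : (Matrix.toLin' M (y' - y)) i = dotProduct (M i) (y' - y) := rfl
          rw [e]
          simp only [g]
          rw [Set.indicator_of_mem]
          rw [Set.mem_Icc, ← abs_le]
          calc |dotProduct (M i) (y' - y)| ≤ ∑ k, |M i k * (y' - y) k| := Finset.abs_sum_le_sum_abs _ _
            _ ≤ ∑ k, |M i k| * m := Finset.sum_le_sum fun k _ => by
                rw [abs_mul]
                refine mul_le_mul_of_nonneg_left ?_ (abs_nonneg _)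
                have := hy.1 k; have := hy.2 k; have := hy'.1 k; have := hy'.2 k
                simp only [Pi.sub_apply]
                rw [abs_le]; constructor <;> linarith
            _ = (∑ k, |M i k|) * m := by rw [Finset.sum_mul]
            _ ≤ K := by
                have : ∑ k, |M i k| ≤ ∑ i, ∑ k, |M i k| :=
                  Finset.single_le_sum (f := fun i => ∑ k, |M i k|) (fun _ _ => by positivity) (Finset.mem_univ i)
                nlinarith
      _ ≤ ∫⁻ y', ∏ i, g ((Matrix.toLin' M (y' - y)) i) := setLIntegral_le_lintegral _ _
      _ = ∫⁻ z, ∏ i, g ((Matrix.toLin' M z) i) :=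
          lintegral_sub_right_eq_self (fun z => ∏ i, g ((Matrix.toLin' M z) i)) y
      _ = _ := hIntg
  · exact ENNReal.mul_ne_top ENNReal.ofReal_ne_top (ENNReal.prod_ne_top fun _ _ => lint_abs18 β h1 K hKp)

end

section
open MeasureTheory Filter Topology

theorem minor18 {N : ℕ} (Λ : Matrix (Fin (N+1)) (Fin (N+1)) ℝ) (h : Λ.det ≠ 0) (j : Fin (N+1)) :
    ∃ l : Fin (N+1), (Λ.submatrix l.succAbove j.succAbove).det ≠ 0 := by
  by_contra hc
  push Not at hc
  apply h
  rw [Matrix.det_succ_column Λ j]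
  simp [hc]

theorem dot_ins18 {N : ℕ} (Λi : Fin (N+1) → ℝ) (j : Fin (N+1)) (c : ℝ) (y y' : Fin N → ℝ) :
    dotProduct Λi ((Fin.insertNth j c y' : Fin (N+1) → ℝ) - (Fin.insertNth j c y : Fin (N+1) → ℝ)) =
      dotProduct (fun k => Λi (j.succAbove k)) (y' - y) := by
  unfold dotProduct
  rw [Fin.sum_univ_succAbove _ j]
  simp

theorem dot_small18 {N : ℕ} (R : ℕ) (l t : Fin N → ℝ) (hl : ∀ i, |l i| ≤ R) (ht : ‖t‖ ≤ 1 / ((N:ℝ) * R + 1)) :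
    |dotProduct l t| ≤ 1 := by
  have hp : 0 < (N:ℝ) * R + 1 := by positivity
  calc |dotProduct l t| ≤ ∑ k, |l k * t k| := Finset.abs_sum_le_sum_abs _ _
    _ ≤ ∑ _k : Fin N, (R:ℝ) * (1 / ((N:ℝ) * R + 1)) := Finset.sum_le_sum fun k _ => by
        rw [abs_mul]
        refine mul_le_mul (hl k) ?_ (abs_nonneg _) (by positivity)
        exact (norm_le_pi_norm t k).trans ht
    _ = (N:ℝ) * R / ((N:ℝ) * R + 1) := by simp; ring
    _ ≤ 1 := by rw [div_le_one hp]; linarith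

theorem slice_small18 {N : ℕ} {Ω : Type*} [MeasurableSpace Ω] (P : Measure Ω) [IsProbabilityMeasure P]
    (X : (Fin (N+1) → ℝ) → Ω → ℝ) (hX : GF18 P X) (hd : ∀ ω, ContDiff ℝ 2 fun s => X s ω)
    (R : ℕ) (Λ : Matrix (Fin (N+1)) (Fin (N+1)) ℝ) (hΛ : Λ.det ≠ 0)
    (hneg : ∀ (b b' : Fin (N+1) → ℝ) (_ : ∀ i, 0 ≤ b i ∧ b i < 1) (_ : ∀ i, 0 ≤ b' i ∧ b' i < 1),
      ∃ C : ENNReal, C ≠ ⊤ ∧ ∀ s s' : Fin (N+1) → ℝ,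
        (∀ l : Fin (N+1) → ℝ, ‖l‖ ≤ R → |dotProduct l (s' - s)| ≤ 1) →
        ∫⁻ ω, ∏ i, (ENNReal.ofReal |fderiv ℝ (fun t => X t ω) s (fun j => Λ⁻¹ j i)| ^ (-(b i)) *
          ENNReal.ofReal |fderiv ℝ (fun t => X t ω) s' (fun j => Λ⁻¹ j i)| ^ (-(b' i))) ∂P ≤
        C * ∏ i, ENNReal.ofReal |dotProduct (Λ i) (s' - s)| ^ (-(b' i)))
    (m : ℝ) (hm : 0 < m) (j : Fin (N+1)) (x κ : ℝ) (hx : x = 1 / (4 * ((N:ℝ) + 1))) (hκ : κ = Real.sqrt (1 + x)) :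
    ∃ B : ENNReal, B ≠ ⊤ ∧ ∀ (c : ℝ) (Q : Set (Fin N → ℝ)), MeasurableSet Q →
      Q ⊆ Set.Icc (fun _ : Fin N => (0:ℝ)) (fun _ => m) →
      (∀ y ∈ Q, ∀ y' ∈ Q, ‖y' - y‖ ≤ 1 / ((N:ℝ) * R + 1)) →
      ∫⁻ ω, (∫⁻ y in Q, Psi18 (fun t => X t ω) (Fin.insertNth j c y)) ^ (2 * κ) ∂P ≤ B := by
  obtain ⟨l, hl⟩ := minor18 Λ hΛ j
  have hN : (0:ℝ) ≤ N := by positivity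
  have hx0 : 0 < x := by rw [hx]; positivity
  have hxN : (N:ℝ) * x + x = 1/4 := by rw [hx]; field_simp
  have hx1 : x ≤ 1/4 := by nlinarith
  set γ : ℝ := 1 + x with hγ
  set a : ℝ := 1 - x with ha
  have hκκ : κ * κ = γ := by rw [hκ]; exact Real.mul_self_sqrt (by linarith)
  have hκ1 : 1 < κ := by rw [hκ, Real.lt_sqrt (by norm_num)]; linarith
  have hga : γ * a < 1 := by rw [hγ, ha]; nlinarith
  have hga0 : 0 ≤ γ * a := by rw [hγ, ha]; nlinarith
  let α : Fin (N+1) → ℝ := fun i => if i = l then 1/4 else a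
  let b : Fin (N+1) → ℝ := fun i => if i = l then γ / 2 else γ * a
  let b' : Fin (N+1) → ℝ := fun i => if i = l then 0 else γ * a
  have hb : ∀ i, 0 ≤ b i ∧ b i < 1 := by
    intro i; simp only [b]; split_ifs
    · constructor <;> linarith
    · exact ⟨hga0, hga⟩
  have hb' : ∀ i, 0 ≤ b' i ∧ b' i < 1 := by
    intro i; simp only [b']; split_ifs
    · constructor <;> norm_num
    · exact ⟨hga0, hga⟩
  have hα : ∀ i, 0 < α i := by
    intro i; simp only [α]; split_ifs
    · norm_num
    · linarith
  have hsum : ∑ i, α i = 1/4 + N * a := by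
    rw [Fin.sum_univ_succAbove _ l]
    simp [α, Fin.succAbove_ne]
  let w : Fin (N+1) → (Fin (N+1) → ℝ) := fun i => fun j => Λ⁻¹ j i
  obtain ⟨C1, hC1, hpsi⟩ := psi_le18 w α hα (by rw [hsum, ha]; nlinarith) (by rw [hsum, ha]; nlinarith)
  obtain ⟨C2, hC2, hneg2⟩ := hneg b b' hb hb'
  obtain ⟨C3, hC3, hsing⟩ := sing_int18 _ hl (γ * a) hga m hm
  have hconj : (κ / (κ - 1)).HolderConjugate κ := (Real.HolderConjugate.conjExponent hκ1).symm
  set q := κ / (κ - 1) with hq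
  have hq1 : 1 < q := hconj.lt
  set p := 2 * (κ * q) with hp
  have hp0 : 0 < p := by positivity
  obtain ⟨CA, hCA, hA⟩ := (mom_S18 P X hX hd).2 (((N + 3 : ℕ):ℝ) * p) (by positivity)
  set box := Set.Icc (fun _ : Fin N => (0:ℝ)) (fun _ => m) with hbox
  set v := (volume : Measure (Fin N → ℝ)) box with hv
  have hvt : v ≠ ⊤ := isCompact_Icc.measure_lt_top.ne
  have hC1p : C1 ^ p ≠ ⊤ := ENNReal.rpow_ne_top_of_nonneg hp0.le hC1
  refine ⟨(v * v) ^ (κ - 1) * ((C1 ^ p * CA + C1 ^ p * CA) * (v * v) + (C2 + C2) * C3 * v), ?_, ?_⟩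
  · refine ENNReal.mul_ne_top (ENNReal.rpow_ne_top_of_nonneg (by linarith) (ENNReal.mul_ne_top hvt hvt)) ?_
    finiteness
  intro c Q hQm hQb hQd
  have hQv : (volume.restrict Q) Set.univ ≤ v := by
    rw [Measure.restrict_apply_univ]; exact measure_mono hQb
  haveI : IsFiniteMeasure (volume.restrict Q) := ⟨lt_of_le_of_lt hQv hvt.lt_top⟩
  have cins : Continuous fun y : Fin N → ℝ => (Fin.insertNth j c y : Fin (N+1) → ℝ) :=
    Continuous.finInsertNth j continuous_const continuous_id
  have mins : Measurable fun z : (Fin N → ℝ) × Ω => ((Fin.insertNth j c z.1 : Fin (N+1) → ℝ), z.2) :=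
    (cins.measurable.comp measurable_fst).prodMk measurable_snd
  let A : (Fin N → ℝ) → Ω → ENNReal := fun y ω => C1 * ENNReal.ofReal (1 + S18 (fun t => X t ω) (Fin.insertNth j c y)) ^ (N + 3)
  let Bf : (Fin N → ℝ) → Ω → ENNReal := fun y ω => ∏ i, ENNReal.ofReal |fderiv ℝ (fun t => X t ω) (Fin.insertNth j c y) (w i)| ^ (-(α i))
  have mA : Measurable (Function.uncurry A) := by
    refine Measurable.const_mul (Measurable.pow_const (Measurable.ennreal_ofReal (Measurable.const_add ?_ 1)) _) _
    exact (meas_S18 P X hX hd).comp mins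
  have mB : Measurable (Function.uncurry Bf) := by
    refine Finset.measurable_fun_prod _ fun i _ => ?_
    exact (((meas_fd18 P X hX hd (w i) 0).2.1.comp mins).abs.ennreal_ofReal).pow_const _
  have key := slice_abs18 P (volume.restrict Q) A Bf mA mB κ q hconj (C1 ^ p * CA) (fun y => by
    simp only [A]
    rw [← hp]
    simp_rw [ENNReal.mul_rpow_of_nonneg _ _ hp0.le]
    rw [lintegral_const_mul' _ _ hC1p]
    gcongr
    simp_rw [← ENNReal.rpow_natCast, ← ENNReal.rpow_mul]
    exact hA _) ((C2 + C2) * C3 * v) (by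
    have hMk : ∀ z : (Fin N → ℝ) × (Fin N → ℝ), ∏ i, ENNReal.ofReal |dotProduct (Λ i) ((Fin.insertNth j c z.2 : Fin (N+1) → ℝ) - (Fin.insertNth j c z.1 : Fin (N+1) → ℝ))| ^ (-(b' i)) =
        ∏ i, ENNReal.ofReal |dotProduct ((Λ.submatrix l.succAbove j.succAbove) i) (z.2 - z.1)| ^ (-(γ * a)) := by
      intro z
      rw [Fin.prod_univ_succAbove _ l]
      simp only [b', if_true, neg_zero, ENNReal.rpow_zero, one_mul, Fin.succAbove_ne, if_false, dot_ins18]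
      rfl
    have hptw : ∀ z ∈ Q ×ˢ Q, ∫⁻ ω, (Bf z.1 ω * Bf z.2 ω) ^ (κ * κ) ∂P ≤ (C2 + C2) *
        ∏ i, ENNReal.ofReal |dotProduct ((Λ.submatrix l.succAbove j.succAbove) i) (z.2 - z.1)| ^ (-(γ * a)) := by
      intro z hz
      rw [hκκ, ← hMk, add_mul]
      have hclose : ∀ y ∈ Q, ∀ y' ∈ Q, ∀ l : Fin (N+1) → ℝ, ‖l‖ ≤ R →
          |dotProduct l ((Fin.insertNth j c y' : Fin (N+1) → ℝ) - (Fin.insertNth j c y : Fin (N+1) → ℝ))| ≤ 1 := by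
        intro y hy y' hy' l hl
        rw [dot_ins18]
        exact dot_small18 R _ _ (fun i => (norm_le_pi_norm l _).trans hl) (hQd y hy y' hy')
      refine neg_pair18 P (fun s i ω => ENNReal.ofReal |fderiv ℝ (fun t => X t ω) s (w i)|)
        (fun s i => ((gf_hess18 P X hX hd (w i) 0).1.1 s).abs.ennreal_ofReal) γ a (by linarith) l α b b'
        (by simp [α]) (fun i hi => by simp [α, hi]) (by simp [b]) (fun i hi => by simp [b, hi])
        (by simp [b']) (fun i hi => by simp [b', hi]) _ _ _ (hneg2 _ _ (hclose _ hz.1 _ hz.2)) ?_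
      refine (hneg2 _ _ (hclose _ hz.2 _ hz.1)).trans (le_of_eq ?_)
      congr 1
      refine Finset.prod_congr rfl fun i _ => ?_
      rw [← neg_sub, dotProduct_neg, abs_neg]
    have mG : Measurable fun z : (Fin N → ℝ) × (Fin N → ℝ) => (C2 + C2) *
        ∏ i, ENNReal.ofReal |dotProduct ((Λ.submatrix l.succAbove j.succAbove) i) (z.2 - z.1)| ^ (-(γ * a)) := by
      refine Measurable.const_mul (Finset.measurable_fun_prod _ fun i _ => ?_) _
      refine Measurable.pow_const (Measurable.ennreal_ofReal (Measurable.abs ?_)) _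
      unfold dotProduct
      fun_prop
    calc _ ≤ ∫⁻ z, (C2 + C2) *
        ∏ i, ENNReal.ofReal |dotProduct ((Λ.submatrix l.succAbove j.succAbove) i) (z.2 - z.1)| ^ (-(γ * a))
          ∂((volume.restrict Q).prod (volume.restrict Q)) := by
          rw [Measure.prod_restrict]
          exact setLIntegral_mono' (hQm.prod hQm) hptw
      _ = ∫⁻ y in Q, ∫⁻ y' in Q, (C2 + C2) *
        ∏ i, ENNReal.ofReal |dotProduct ((Λ.submatrix l.succAbove j.succAbove) i) (y' - y)| ^ (-(γ * a)) :=
          lintegral_prod _ mG.aemeasurable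
      _ ≤ ∫⁻ y in Q, (C2 + C2) * C3 := by
          refine setLIntegral_mono' hQm fun y hy => ?_
          rw [lintegral_const_mul' _ _ (by finiteness)]
          gcongr
          exact (lintegral_mono_set hQb).trans (hsing y (hQb hy))
      _ ≤ _ := by
          rw [lintegral_const]
          gcongr)
  refine le_trans (lintegral_mono fun ω => ?_) (key.trans ?_)
  · refine ENNReal.rpow_le_rpow (lintegral_mono fun y => ?_) (by linarith)
    exact hpsi _ _
  · gcongr

end

section
open MeasureTheory Filter Topology

theorem slice_moment18 {N : ℕ} {Ω : Type*} [MeasurableSpace Ω] (P : Measure Ω) [IsProbabilityMeasure P]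
    (X : (Fin (N+1) → ℝ) → Ω → ℝ) (hX : GF18 P X) (hd : ∀ ω, ContDiff ℝ 2 fun s => X s ω)
    (ν : Measure (Fin (N+1) → ℝ)) [IsProbabilityMeasure ν]
    (hν : ∀ (k : ℕ) (t : Fin k → (Fin (N+1) → ℝ)) (c : Fin k → ℝ),
        ∫ ω, Real.cos (∑ i, c i * X (t i) ω) ∂P =
          Real.exp (-(1/2) * ∫ l, ((∑ i, c i * Real.cos (dotProduct l (t i))) ^ 2 +
            (∑ i, c i * Real.sin (dotProduct l (t i))) ^ 2) ∂ν))
    (hB : ∀ v : Fin (N+1) → ℝ, v ≠ 0 → ¬ ∀ᵐ l ∂ν, dotProduct l v = 0) (m : ℝ) (hm : 0 < m) :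
    ∃ κ > (1:ℝ), ∃ B : ENNReal, B ≠ ⊤ ∧ ∀ (j : Fin (N+1)) (c : ℝ),
      ∫⁻ ω, (∫⁻ y in Set.Icc (fun _ : Fin N => (0:ℝ)) (fun _ => m),
        Psi18 (fun t => X t ω) (Fin.insertNth j c y)) ^ (2 * κ) ∂P ≤ B := by
  obtain ⟨R, Λ, hΛ, hneg⟩ := neg_field18 P X hX.1 (fun ω => (hd ω).differentiable (by norm_num)) ν hν hB
  set x : ℝ := 1 / (4 * ((N:ℝ) + 1)) with hx
  have hx0 : 0 < x := by positivity
  set κ := Real.sqrt (1 + x) with hκ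
  have hκ1 : 1 < κ := by rw [hκ, Real.lt_sqrt (by norm_num)]; linarith
  choose B hBt hBb using fun j => slice_small18 P X hX hd R Λ hΛ hneg m hm j x κ hx hκ
  set δ : ℝ := 1 / ((N:ℝ) * R + 1) with hδ
  have hδ0 : 0 < δ := by positivity
  obtain ⟨t, -, htf, hcov⟩ := (isCompact_Icc (a := fun _ : Fin N => (0:ℝ)) (b := fun _ => m)).finite_cover_balls (half_pos hδ0)
  haveI := htf.fintype
  set box := Set.Icc (fun _ : Fin N => (0:ℝ)) (fun _ => m) with hbox
  set n := (Finset.univ : Finset t).card with hn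
  refine ⟨κ, hκ1, (n:ENNReal) ^ (2 * κ - 1) * (n * ∑ j, B j), ?_, fun j c => ?_⟩
  · refine ENNReal.mul_ne_top (ENNReal.rpow_ne_top_of_nonneg (by linarith) (by simp)) (ENNReal.mul_ne_top (by simp) ?_)
    exact ENNReal.sum_ne_top.2 fun j _ => hBt j
  have cins : Continuous fun y : Fin N → ℝ => (Fin.insertNth j c y : Fin (N+1) → ℝ) :=
    Continuous.finInsertNth j continuous_const continuous_id
  have mins : Measurable fun z : Ω × (Fin N → ℝ) => ((Fin.insertNth j c z.2 : Fin (N+1) → ℝ), z.1) :=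
    (cins.measurable.comp measurable_snd).prodMk measurable_fst
  have mP := (meas_Psi18 P X hX hd).comp mins
  let Q : t → Set (Fin N → ℝ) := fun z => box ∩ Metric.ball (z : Fin N → ℝ) (δ / 2)
  have hQm : ∀ z, MeasurableSet (Q z) := fun z => measurableSet_Icc.inter measurableSet_ball
  have hmeas : ∀ z, Measurable fun ω => (∫⁻ y in Q z, Psi18 (fun t => X t ω) (Fin.insertNth j c y)) ^ (2 * κ) := by
    intro z
    exact (Measurable.lintegral_prod_right' (ν := volume.restrict (Q z)) mP).pow_const _
  have hle : ∀ ω, (∫⁻ y in box, Psi18 (fun t => X t ω) (Fin.insertNth j c y)) ^ (2 * κ) ≤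
      (n:ENNReal) ^ (2 * κ - 1) * ∑ z, (∫⁻ y in Q z, Psi18 (fun t => X t ω) (Fin.insertNth j c y)) ^ (2 * κ) := by
    intro ω
    refine le_trans (ENNReal.rpow_le_rpow ?_ (by linarith)) (ENNReal.rpow_sum_le_const_mul_sum_rpow _ _ (by linarith))
    have hs : box ⊆ ⋃ z, Q z := by
      intro y hy
      obtain ⟨z, hz, hyz⟩ := Set.mem_iUnion₂.1 (hcov hy)
      exact Set.mem_iUnion.2 ⟨⟨z, hz⟩, hy, hyz⟩
    refine (lintegral_mono_set hs).trans ((lintegral_iUnion_le _ _).trans ?_)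
    rw [tsum_fintype]
  refine (lintegral_mono hle).trans ?_
  rw [lintegral_const_mul' _ _ (ENNReal.rpow_ne_top_of_nonneg (by linarith) (by simp)), lintegral_finset_sum _ fun z _ => hmeas z]
  gcongr
  calc _ ≤ ∑ z : t, ∑ j, B j := by
        refine Finset.sum_le_sum fun z _ => ?_
        refine (hBb j c (Q z) (hQm z) Set.inter_subset_left ?_).trans
          (Finset.single_le_sum (f := B) (fun _ _ => zero_le) (Finset.mem_univ j))
        intro y hy y' hy'
        have h1 := Metric.mem_ball.1 hy.2
        have h2 := Metric.mem_ball.1 hy'.2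
        rw [← dist_eq_norm]
        have := dist_triangle_right y' y z
        linarith
    _ = _ := by simp [hn]

theorem bulk18 {N : ℕ} (m : ℝ) (g : (Fin (N+1) → ℝ) → ENNReal) (hg : Measurable g) :
    ∫⁻ x in Set.Icc (fun _ : Fin (N+1) => (0:ℝ)) (fun _ => m), g x =
      ∫⁻ c in Set.Icc 0 m, ∫⁻ y in Set.Icc (fun _ : Fin N => (0:ℝ)) (fun _ => m), g (Fin.insertNth 0 c y) := by
  let e := (MeasurableEquiv.piFinSuccAbove (fun _ : Fin (N+1) => ℝ) 0).symm
  have he : MeasurePreserving e := (volume_preserving_piFinSuccAbove (fun _ : Fin (N+1) => ℝ) 0).symm _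
  have hpre : e ⁻¹' Set.Icc (fun _ : Fin (N+1) => (0:ℝ)) (fun _ => m) =
      Set.Icc 0 m ×ˢ Set.Icc (fun _ : Fin N => (0:ℝ)) (fun _ => m) :=
    ((Fin.insertNthOrderIso (fun _ => ℝ) 0).preimage_Icc _ _).trans (Set.Icc_prod_eq _ _)
  rw [← he.setLIntegral_comp_preimage measurableSet_Icc hg, hpre, Measure.volume_eq_prod, ← Measure.prod_restrict,
    lintegral_prod (fun a => g (e a)) (hg.comp e.measurable).aemeasurable]
  rfl

theorem meas_slice18 {N : ℕ} {Ω : Type*} [MeasurableSpace Ω] (Φ : (Fin (N+1) → ℝ) × Ω → ENNReal) (hP : Measurable Φ)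
    (box : Set (Fin N → ℝ)) (j : Fin (N+1)) :
    Measurable fun z : ℝ × Ω => ∫⁻ y in box, Φ (Fin.insertNth j z.1 y, z.2) := by
  have cins : Continuous fun z : ℝ × (Fin N → ℝ) => (Fin.insertNth j z.1 z.2 : Fin (N+1) → ℝ) :=
    Continuous.finInsertNth j continuous_fst continuous_snd
  have h1 : Measurable fun z : (ℝ × Ω) × (Fin N → ℝ) => (Fin.insertNth j z.1.1 z.2 : Fin (N+1) → ℝ) :=
    cins.measurable.comp ((measurable_fst.comp measurable_fst).prodMk measurable_snd)
  have h2 : Measurable fun z : (ℝ × Ω) × (Fin N → ℝ) => Φ ((Fin.insertNth j z.1.1 z.2 : Fin (N+1) → ℝ), z.1.2) :=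
    hP.comp (h1.prodMk (measurable_snd.comp measurable_fst))
  exact Measurable.lintegral_prod_right' (ν := volume.restrict box) h2

theorem agg18 {N : ℕ} {Ω : Type*} [MeasurableSpace Ω] (P : Measure Ω) [IsProbabilityMeasure P]
    (Sl : Fin (N+1) → ℝ → Ω → ENNReal) (mS : ∀ j, Measurable fun z : ℝ × Ω => Sl j z.1 z.2)
    (m κ : ℝ) (hκ : 1 < κ) (B : ENNReal) (hBt : B ≠ ⊤) (hb : ∀ j c, ∫⁻ ω, Sl j c ω ^ (2 * κ) ∂P ≤ B)
    (C : ENNReal) (hC : C ≠ ⊤) :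
    ∃ B' : ENNReal, B' ≠ ⊤ ∧ ∀ G : Ω → ENNReal,
      (∀ ω, G ω ≤ C * ((∫⁻ c in Set.Icc 0 m, Sl 0 c ω) + ∑ j, (Sl j m ω + Sl j 0 ω))) →
      ∫⁻ ω, G ω ^ (2 * κ) ∂P ≤ B' := by
  have hk2 : 1 ≤ 2 * κ := by linarith
  have hk0 : 0 ≤ 2 * κ := by linarith
  have mSw : ∀ j c, Measurable fun ω => Sl j c ω := fun j c => (mS j).comp (measurable_const.prodMk measurable_id)
  have mSc : ∀ j ω, Measurable fun c => Sl j c ω := fun j ω => (mS j).comp (measurable_id.prodMk measurable_const)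
  let Bk : Ω → ENNReal := fun ω => ∫⁻ c in Set.Icc 0 m, Sl 0 c ω
  have mBk : Measurable Bk := by
    have : Measurable fun z : Ω × ℝ => Sl 0 z.2 z.1 := (mS 0).comp (measurable_snd.prodMk measurable_fst)
    exact Measurable.lintegral_prod_right' (ν := volume.restrict (Set.Icc 0 m)) this
  set v := (volume.restrict (Set.Icc 0 m) : Measure ℝ) Set.univ with hv
  have hvt : v ≠ ⊤ := measure_ne_top _ _
  have hvk : v ^ (2 * κ - 1) ≠ ⊤ := ENNReal.rpow_ne_top_of_nonneg (by linarith) hvt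
  have bBk : ∫⁻ ω, Bk ω ^ (2 * κ) ∂P ≤ v ^ (2 * κ - 1) * (B * v) := by
    refine (lintegral_mono fun ω => jensen18 _ _ (mSc 0 ω).aemeasurable (2 * κ) hk2).trans ?_
    rw [lintegral_const_mul' _ _ hvk, lintegral_lintegral_swap]
    · gcongr
      refine (lintegral_mono fun c => hb 0 c).trans ?_
      rw [lintegral_const]
    · have : Measurable fun z : Ω × ℝ => Sl 0 z.2 z.1 ^ (2 * κ) :=
        ((mS 0).comp (measurable_snd.prodMk measurable_fst)).pow_const _
      exact this.aemeasurable
  have twoSum : ∀ a b : ENNReal, (a + b) ^ (2 * κ) ≤ 2 ^ (2 * κ - 1) * (a ^ (2 * κ) + b ^ (2 * κ)) := fun a b =>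
    ENNReal.rpow_add_le_mul_rpow_add_rpow a b hk2
  set D : ENNReal := 2 ^ (2 * κ - 1) with hD
  have hDt : D ≠ ⊤ := ENNReal.rpow_ne_top_of_nonneg (by linarith) (by norm_num)
  set n' : ENNReal := ((Finset.univ : Finset (Fin (N+1))).card : ENNReal) ^ (2 * κ - 1) with hn'
  have hnt : n' ≠ ⊤ := ENNReal.rpow_ne_top_of_nonneg (by linarith) (by simp)
  have hCk : C ^ (2 * κ) ≠ ⊤ := ENNReal.rpow_ne_top_of_nonneg hk0 hC
  refine ⟨C ^ (2 * κ) * (D * (v ^ (2 * κ - 1) * (B * v) + n' * ∑ _j : Fin (N+1), D * (B + B))), ?_, fun G hG => ?_⟩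
  · refine ENNReal.mul_ne_top hCk (ENNReal.mul_ne_top hDt (ENNReal.add_ne_top.2 ⟨?_, ?_⟩))
    · exact ENNReal.mul_ne_top hvk (ENNReal.mul_ne_top hBt hvt)
    · exact ENNReal.mul_ne_top hnt (ENNReal.sum_ne_top.2 fun _ _ => ENNReal.mul_ne_top hDt (by finiteness))
  have hpt : ∀ ω, G ω ^ (2 * κ) ≤
      C ^ (2 * κ) * (D * (Bk ω ^ (2 * κ) + n' * ∑ j, D * (Sl j m ω ^ (2 * κ) + Sl j 0 ω ^ (2 * κ)))) := by
    intro ω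
    refine (ENNReal.rpow_le_rpow (hG ω) hk0).trans ?_
    rw [ENNReal.mul_rpow_of_nonneg _ _ hk0]
    gcongr
    refine (twoSum _ _).trans ?_
    gcongr
    refine (ENNReal.rpow_sum_le_const_mul_sum_rpow _ _ hk2).trans ?_
    gcongr
    exact twoSum _ _
  refine (lintegral_mono hpt).trans ?_
  have ms : ∀ j, Measurable fun ω => D * (Sl j m ω ^ (2 * κ) + Sl j 0 ω ^ (2 * κ)) := fun j =>
    (((mSw j m).pow_const _).add ((mSw j 0).pow_const _)).const_mul _
  rw [lintegral_const_mul' _ _ hCk, lintegral_const_mul' _ _ hDt, lintegral_add_left (mBk.pow_const _),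
    lintegral_const_mul' _ _ hnt, lintegral_finset_sum _ fun j _ => ms j]
  gcongr with j
  rw [lintegral_const_mul' _ _ hDt, lintegral_add_left ((mSw j m).pow_const _)]
  gcongr
  · exact hb j m
  · exact hb j 0

theorem caseB18 {N : ℕ} {Ω : Type*} [MeasurableSpace Ω] (P : Measure Ω) [IsProbabilityMeasure P]
    (X : (Fin (N+1) → ℝ) → Ω → ℝ) (hX : GF18 P X) (hd : ∀ ω, ContDiff ℝ 2 fun s => X s ω)
    (ν : Measure (Fin (N+1) → ℝ)) [IsProbabilityMeasure ν]
    (hν : ∀ (k : ℕ) (t : Fin k → (Fin (N+1) → ℝ)) (c : Fin k → ℝ),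
        ∫ ω, Real.cos (∑ i, c i * X (t i) ω) ∂P =
          Real.exp (-(1/2) * ∫ l, ((∑ i, c i * Real.cos (dotProduct l (t i))) ^ 2 +
            (∑ i, c i * Real.sin (dotProduct l (t i))) ^ 2) ∂ν))
    (hB : ∀ v : Fin (N+1) → ℝ, v ≠ 0 → ¬ ∀ᵐ l ∂ν, dotProduct l v = 0) (m : ℝ) (hm : 0 < m) :
    ∃ κ > (1:ℝ), ∃ B : ENNReal, B ≠ ⊤ ∧ ∀ σ > (0:ℝ),
      ∫⁻ ω, ENNReal.ofReal |∫ s in Set.univ.pi fun _ : Fin (N+1) => Set.Ioo (0:ℝ) m,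
        gaussKernel18 σ (gradient18 (fun t => X t ω) s) * (hessian18 (fun t => X t ω) s).det * X s ω| ^ (2 * κ) ∂P ≤ B := by
  obtain ⟨κ, hκ, B, hBt, hb⟩ := slice_moment18 P X hX hd ν hν hB m hm
  obtain ⟨C, hC, hst⟩ := stokes_bound18 N
  have hP := meas_Psi18 P X hX hd
  set Φ : (Fin (N+1) → ℝ) × Ω → ENNReal := fun p => Psi18 (fun t => X t p.2) p.1 with hΦ
  obtain ⟨B', hB', hagg⟩ := agg18 P (fun j c ω => ∫⁻ y in Set.Icc (fun _ : Fin N => (0:ℝ)) (fun _ => m), Φ (Fin.insertNth j c y, ω))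
    (meas_slice18 Φ hP _) m κ hκ B hBt hb C hC
  refine ⟨κ, hκ, B', hB', fun σ hσ => hagg _ fun ω => ?_⟩
  refine (hst σ hσ (fun t => X t ω) (hd ω) m hm).trans (le_of_eq ?_)
  congr 2
  exact bulk18 m (fun x => Φ (x, ω)) (hP.comp (measurable_id.prodMk measurable_const))

end

section
open MeasureTheory Filter Topology

theorem modif18 {n : ℕ} {Ω : Type*} [MeasurableSpace Ω] (P : Measure Ω) [IsProbabilityMeasure P]
    (X : (Fin n → ℝ) → Ω → ℝ)
    (hC2 : ∀ᵐ ω ∂P, ContDiff ℝ 2 fun s => X s ω)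
    (hGauss : ∀ (k : ℕ) (t : Fin k → (Fin n → ℝ)) (c : Fin k → ℝ),
      ∃ v : NNReal, P.map (fun ω => ∑ i, c i * X (t i) ω) =
        ProbabilityTheory.gaussianReal 0 v)
    (hStat : ∀ (τ : Fin n → ℝ) (k : ℕ) (t : Fin k → (Fin n → ℝ)),
      P.map (fun ω i => X (t i + τ) ω) = P.map (fun ω i => X (t i) ω)) :
    ∃ Y : (Fin n → ℝ) → Ω → ℝ, GF18 P Y ∧ (∀ ω, ContDiff ℝ 2 fun s => Y s ω) ∧
      ∀ᵐ ω ∂P, ∀ s, X s ω = Y s ω := by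
  classical
  have hae : ∀ s, AEMeasurable (X s) P := by
    intro s
    obtain ⟨v, hv⟩ := hGauss 1 (fun _ => s) (fun _ => 1)
    by_contra hc
    have e : (fun ω => ∑ i : Fin 1, (fun _ => (1:ℝ)) i * X ((fun _ => s) i) ω) = X s := by
      funext ω; simp
    rw [e, Measure.map_of_not_aemeasurable hc] at hv
    exact (IsProbabilityMeasure.ne_zero (ProbabilityTheory.gaussianReal 0 v)) hv.symm
  let d : ℕ → (Fin n → ℝ) := TopologicalSpace.denseSeq _
  have hdd : DenseRange d := TopologicalSpace.denseRange_denseSeq _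
  have hD : ∀ᵐ ω ∂P, ∀ k, X (d k) ω = (hae (d k)).mk _ ω := ae_all_iff.2 fun k => (hae (d k)).ae_eq_mk
  obtain ⟨g, hg, hgm, hgs⟩ := (hC2.and hD).exists_measurable_mem
  have hgω : ∀ᵐ ω ∂P, ω ∈ g := hg
  let Y : (Fin n → ℝ) → Ω → ℝ := fun s ω => if ω ∈ g then X s ω else 0
  have hY : ∀ᵐ ω ∂P, ∀ s, X s ω = Y s ω := by
    filter_upwards [hgω] with ω hω s
    simp [Y, hω]
  have hYd : ∀ ω, ContDiff ℝ 2 fun s => Y s ω := by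
    intro ω
    by_cases h : ω ∈ g
    · simp only [Y, h, if_true]; exact (hgs ω h).1
    · simp only [Y, h, if_false]; exact contDiff_const
  have hYk : ∀ k, Measurable (Y (d k)) := by
    intro k
    have : Y (d k) = fun ω => if ω ∈ g then (hae (d k)).mk _ ω else 0 := by
      funext ω
      by_cases h : ω ∈ g
      · simp only [Y, h, if_true]; exact (hgs ω h).2 k
      · simp only [Y, h, if_false]
    rw [this]
    exact Measurable.ite hgm (hae (d k)).measurable_mk measurable_const
  have hYm : ∀ s, Measurable (Y s) := by
    intro s
    have hs : s ∈ closure (Set.range d) := hdd s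
    obtain ⟨u, hu, hlim⟩ := mem_closure_iff_seq_limit.1 hs
    refine measurable_of_tendsto_metrizable (f := fun k => Y (u k)) (fun k => ?_) (tendsto_pi_nhds.2 fun ω => ?_)
    · obtain ⟨i, hi⟩ := hu k
      rw [← hi]; exact hYk i
    · exact ((hYd ω).continuous.tendsto s).comp hlim
  refine ⟨Y, ⟨hYm, fun k t c => ?_, fun τ k t => ?_⟩, hYd, hY⟩
  · obtain ⟨v, hv⟩ := hGauss k t c
    refine ⟨v, hv ▸ Measure.map_congr ?_⟩
    filter_upwards [hY] with ω hω
    simp only [hω]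
  · have h1 : P.map (fun ω i => Y (t i + τ) ω) = P.map (fun ω i => X (t i + τ) ω) := Measure.map_congr (by
      filter_upwards [hY] with ω hω
      simp only [hω])
    have h2 : P.map (fun ω i => Y (t i) ω) = P.map (fun ω i => X (t i) ω) := Measure.map_congr (by
      filter_upwards [hY] with ω hω
      simp only [hω])
    rw [h1, h2, hStat]

theorem final18 {n : ℕ} (m : ℝ) (hm : 0 < m)
    {Ω : Type*} [MeasurableSpace Ω] (μ : Measure Ω) [IsProbabilityMeasure μ]
    (X : (Fin n → ℝ) → Ω → ℝ)
    (hC2 : ∀ᵐ ω ∂μ, ContDiff ℝ 2 fun s => X s ω)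
    (hGauss : ∀ (k : ℕ) (t : Fin k → (Fin n → ℝ)) (c : Fin k → ℝ),
      ∃ v : NNReal, μ.map (fun ω => ∑ i, c i * X (t i) ω) =
        ProbabilityTheory.gaussianReal 0 v)
    (hStat : ∀ (τ : Fin n → ℝ) (k : ℕ) (t : Fin k → (Fin n → ℝ)),
      μ.map (fun ω i => X (t i + τ) ω) = μ.map (fun ω i => X (t i) ω))
    (hVar : ∀ t, ∫ ω, (X t ω) ^ 2 ∂μ = 1) :
    ∃ ε > (0 : ℝ), ∃ B : ℝ, ∀ σ > (0 : ℝ),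
      ∫ ω, |∫ s in Set.univ.pi fun _ : Fin n => Set.Ioo (0 : ℝ) m,
          gaussKernel18 σ (gradient18 (fun t => X t ω) s) *
            (hessian18 (fun t => X t ω) s).det * X s ω| ^ ((2 : ℝ) + ε) ∂μ ≤ B := by
  obtain ⟨Y, hGF, hYd, hY⟩ := modif18 μ X hC2 hGauss hStat
  have hcongr : ∀ (σ ε : ℝ), ∫ ω, |∫ s in Set.univ.pi fun _ : Fin n => Set.Ioo (0 : ℝ) m,
          gaussKernel18 σ (gradient18 (fun t => X t ω) s) *
            (hessian18 (fun t => X t ω) s).det * X s ω| ^ ((2 : ℝ) + ε) ∂μ =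
      ∫ ω, |∫ s in Set.univ.pi fun _ : Fin n => Set.Ioo (0 : ℝ) m,
          gaussKernel18 σ (gradient18 (fun t => Y t ω) s) *
            (hessian18 (fun t => Y t ω) s).det * Y s ω| ^ ((2 : ℝ) + ε) ∂μ := by
    intro σ ε
    refine integral_congr_ae ?_
    filter_upwards [hY] with ω hω
    simp only [hω]
  simp_rw [hcongr]
  rcases n with _ | N
  · refine ⟨1, one_pos, ?_, fun σ _ => le_of_eq ?_⟩
    · exact ∫ ω, |∫ s in Set.univ.pi fun _ : Fin 0 => Set.Ioo (0 : ℝ) m,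
          gaussKernel18 1 (gradient18 (fun t => Y t ω) s) *
            (hessian18 (fun t => Y t ω) s).det * Y s ω| ^ ((2 : ℝ) + 1) ∂μ
    · simp [gaussKernel18]
  have hYVar : ∀ t, ∫ ω, (Y t ω) ^ 2 ∂μ = 1 := by
    intro t
    rw [← hVar t]
    refine integral_congr_ae ?_
    filter_upwards [hY] with ω hω
    simp only [hω]
  obtain ⟨ν, hνp, hν⟩ := spectral18 μ Y (fun ω => (hYd ω).continuous) hGF.1 hGF.2.1 hGF.2.2 hYVar
  by_cases hA : ∃ v : Fin (N+1) → ℝ, v ≠ 0 ∧ ∀ᵐ l ∂ν, dotProduct l v = 0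
  · obtain ⟨v, hv, hA⟩ := hA
    have h0 := caseA18 μ Y hGF hYd ν hν v hv hA
    refine ⟨1, one_pos, 0, fun σ _ => le_of_eq ?_⟩
    refine integral_eq_zero_of_ae ?_
    filter_upwards [h0] with ω hω
    simp only [hω, mul_zero, zero_mul, integral_zero, abs_zero, Pi.zero_apply]
    exact Real.zero_rpow (by norm_num)
  · have hB : ∀ v : Fin (N+1) → ℝ, v ≠ 0 → ¬ ∀ᵐ l ∂ν, dotProduct l v = 0 := fun v hv h => hA ⟨v, hv, h⟩
    obtain ⟨κ, hκ, B, hBt, hb⟩ := caseB18 μ Y hGF hYd ν hν hB m hm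
    refine ⟨2 * κ - 2, by linarith, B.toReal, fun σ hσ => ?_⟩
    have e : (2:ℝ) + (2 * κ - 2) = 2 * κ := by ring
    rw [e]
    refine (le_abs_self _).trans ?_
    rw [← Real.norm_eq_abs, ← toReal_enorm]
    refine ENNReal.toReal_mono hBt (le_trans ?_ (hb σ hσ))
    refine (enorm_integral_le_lintegral_enorm _).trans (le_of_eq (lintegral_congr fun ω => ?_))
    rw [Real.enorm_of_nonneg (by positivity), ENNReal.ofReal_rpow_of_nonneg (abs_nonneg _) (by linarith)]

end

/-- Uniform `(2+ε)`-moment bound for `F^σ = ∫_{(0,m)^n} φ_{σ²I}(∇X) det(∇²X) X ds`, for a tame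
stationary centered unit-variance Gaussian field with all moments of `sup|X|` finite and
uniformly bounded `(2+ε')`-moments of the number of gradient `u`-points. -/
theorem uniform_moment_bound_smoothed_euler {n : ℕ} (m : ℝ) (hm : 0 < m)
    {Ω : Type*} [MeasurableSpace Ω] (μ : Measure Ω) [IsProbabilityMeasure μ]
    (X : (Fin n → ℝ) → Ω → ℝ)
    (hC2 : ∀ᵐ ω ∂μ, ContDiff ℝ 2 fun s => X s ω)
    (hGauss : ∀ (k : ℕ) (t : Fin k → (Fin n → ℝ)) (c : Fin k → ℝ),
      ∃ v : NNReal, μ.map (fun ω => ∑ i, c i * X (t i) ω) =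
        ProbabilityTheory.gaussianReal 0 v)
    (hStat : ∀ (τ : Fin n → ℝ) (k : ℕ) (t : Fin k → (Fin n → ℝ)),
      μ.map (fun ω i => X (t i + τ) ω) = μ.map (fun ω i => X (t i) ω))
    (hVar : ∀ t, ∫ ω, (X t ω) ^ 2 ∂μ = 1)
    (hsup : ∀ k : ℕ, Integrable (fun ω =>
      (⨆ s ∈ Set.univ.pi fun _ : Fin n => Set.Ioo (0 : ℝ) m, |X s ω|) ^ k) μ)
    (hN : ∃ ε' > (0 : ℝ), ∃ B' : ℝ, ∀ u : Fin n → ℝ,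
      ∫ ω, (({s | s ∈ (Set.univ.pi fun _ : Fin n => Set.Ioo (0 : ℝ) m) ∧
          gradient18 (fun t => X t ω) s = u}.ncard : ℝ)) ^ ((2 : ℝ) + ε') ∂μ ≤ B') :
    ∃ ε > (0 : ℝ), ∃ B : ℝ, ∀ σ > (0 : ℝ),
      ∫ ω, |∫ s in Set.univ.pi fun _ : Fin n => Set.Ioo (0 : ℝ) m,
          gaussKernel18 σ (gradient18 (fun t => X t ω) s) *
            (hessian18 (fun t => X t ω) s).det * X s ω| ^ ((2 : ℝ) + ε) ∂μ ≤ B := by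
  exact final18 m hm μ X hC2 hGauss hStat hVar
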